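/- arXiv:2004.08894 — 3 statements merged into one kernel-verified Lean document; each statement's English description precedes it below -/
import Mathlib

section
/- Let u be a real-valued harmonic function on the open unit ball B_3 of R^3 with |u| < 1. Then for every x in B_3, |∇u(x)| < (8/(3√3)) · 1/(1 - |x|²). -/
open MeasureTheory Real in
/-- k-dimensional Lebesgue measure of the unit ball in R^k. -/
noncomputable def unitBallVol (k : Nat) : Real :=
  (volume (Metric.ball (0 : EuclideanSpace Real (Fin k)) 1)).toReal

/-- u is harmonic on s: C^2 and the Laplacian vanishes on s. -/
def IsHarmonicOn {n : Nat} (u : EuclideanSpace Real (Fin n) -> Real)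
    (s : Set (EuclideanSpace Real (Fin n))) : Prop :=
  ContDiffOn Real 2 u s /\ ∀ x ∈ s,
    (∑ i : Fin n, fderiv Real (fun y => fderiv Real u y (EuclideanSpace.single i 1)) x
      (EuclideanSpace.single i 1)) = 0

abbrev E3 := EuclideanSpace ℝ (Fin 3)

section PartOne
open MeasureTheory Set Filter Topology

lemma sp_hasDerivAt_param (f : E3 → ℝ) (hf : ContDiff ℝ 1 f) (k : E3 → ℝ) (hk : Continuous k)
    (hkc : HasCompactSupport k) (A B : E3 → E3) (hA : Continuous A) (hB : Continuous B) (t0 : ℝ) :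
    HasDerivAt (fun t : ℝ => ∫ y, f (A y + t • B y) * k y)
      (∫ y, fderiv ℝ f (A y + t0 • B y) (B y) * k y) t0 := by
  have hfc : Continuous f := hf.continuous
  have hf' : Continuous (fderiv ℝ f) := hf.continuous_fderiv (by norm_num)
  have hcont : Continuous (fun p : ℝ × E3 =>
      fderiv ℝ f (A p.2 + p.1 • B p.2) (B p.2) * k p.2) := by
    apply Continuous.mul _ (by fun_prop)
    apply Continuous.clm_apply
    · exact hf'.comp (by fun_prop)
    · fun_prop
  obtain ⟨C, hC⟩ := (((isCompact_Icc (a := t0 - 1) (b := t0 + 1)).prod hkc).exists_bound_of_continuousOn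
    hcont.continuousOn)
  have hsm : Set.Icc (t0 - 1) (t0 + 1) ∈ 𝓝 t0 := Icc_mem_nhds (by linarith) (by linarith)
  refine (hasDerivAt_integral_of_dominated_loc_of_deriv_le (μ := volume)
    (F := fun t y => f (A y + t • B y) * k y)
    (F' := fun t y => fderiv ℝ f (A y + t • B y) (B y) * k y)
    (bound := (tsupport k).indicator (fun _ => C)) hsm ?_ ?_ ?_ ?_ ?_ ?_).2
  · filter_upwards with t
    apply Continuous.aestronglyMeasurable
    have : Continuous fun y => f (A y + t • B y) := hfc.comp (by fun_prop)
    fun_prop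
  · apply Continuous.integrable_of_hasCompactSupport
    · have : Continuous fun y => f (A y + t0 • B y) := hfc.comp (by fun_prop)
      fun_prop
    · exact hkc.mul_left
  · apply Continuous.aestronglyMeasurable
    exact hcont.comp (by fun_prop : Continuous fun y : E3 => (t0, y))
  · filter_upwards with y t ht
    by_cases hy : y ∈ tsupport k
    · rw [indicator_of_mem hy]
      exact hC (t, y) ⟨ht, hy⟩
    · rw [indicator_of_notMem hy, image_eq_zero_of_notMem_tsupport hy]
      simp
  · rw [integrable_indicator_iff (isClosed_tsupport k).measurableSet]
    exact integrableOn_const (hkc.measure_lt_top.ne) 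
  · filter_upwards with y t ht
    apply HasDerivAt.mul_const
    have h1 : HasDerivAt (fun t : ℝ => A y + t • B y) (B y) t := by
      simpa using ((hasDerivAt_id t).smul_const (B y)).const_add (A y)
    exact ((hf.differentiable (by norm_num) _).hasFDerivAt).comp_hasDerivAt t h1

lemma sp_ibp (f g : E3 → ℝ) (hf : ContDiff ℝ 1 f) (hg : ContDiff ℝ 1 g) (hgc : HasCompactSupport g)
    (v : E3) : ∫ y, f y * fderiv ℝ g y v = - ∫ y, fderiv ℝ f y v * g y := by
  have hf' : Continuous (fderiv ℝ f) := hf.continuous_fderiv (by norm_num)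
  have hg' : Continuous (fderiv ℝ g) := hg.continuous_fderiv (by norm_num)
  have hfc := hf.continuous
  have hgcc := hg.continuous
  apply integral_mul_fderiv_eq_neg_fderiv_mul_of_integrable
  · apply Continuous.integrable_of_hasCompactSupport
    · fun_prop
    · exact hgc.mul_left
  · apply Continuous.integrable_of_hasCompactSupport
    · fun_prop
    · exact (hgc.fderiv_apply (𝕜 := ℝ) v).mul_left
  · apply Continuous.integrable_of_hasCompactSupport
    · fun_prop
    · exact hgc.mul_left
  · intro x _; exact hf.differentiable (by norm_num) x
  · intro x _; exact hg.differentiable (by norm_num) x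

lemma sp_radial_compact (k : ℝ → ℝ) (ρ : ℝ) (hρ : 0 < ρ)
    (hk0 : ∀ t, ρ ^ 2 ≤ t → k t = 0) : HasCompactSupport (fun y : E3 => k (‖y‖ ^ 2)) := by
  apply HasCompactSupport.intro (isCompact_closedBall (0 : E3) ρ)
  intro y hy
  apply hk0
  simp at hy
  nlinarith

lemma sp_mvp (h : E3 → ℝ) (hh : ContDiff ℝ 2 h) (R ρ : ℝ) (hρ : 0 < ρ)
    (hlap : ∀ z : E3, ‖z‖ < R → (∑ i : Fin 3, fderiv ℝ (fun y => fderiv ℝ h y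
      (EuclideanSpace.single i 1)) z (EuclideanSpace.single i 1)) = 0)
    (k : ℝ → ℝ) (hk : Continuous k) (hk0 : ∀ t, ρ ^ 2 ≤ t → k t = 0)
    (c : E3) (hc : ‖c‖ + ρ ≤ R) :
    ∫ y : E3, h (c + y) * k (‖y‖ ^ 2) = h c * ∫ y : E3, k (‖y‖ ^ 2) := by
  have hh1 : ContDiff ℝ 1 h := hh.of_le (by norm_num)
  set K : ℝ → ℝ := fun t => ∫ x in (ρ ^ 2)..t, k x / 2 with hK
  have hKd : ∀ t, HasDerivAt K (k t / 2) t := fun t =>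
    (Continuous.integral_hasStrictDerivAt (f := fun x => k x / 2) (by fun_prop) (ρ ^ 2) t).hasDerivAt
  have hK0 : ∀ t, ρ ^ 2 ≤ t → K t = 0 := by
    intro t ht
    apply intervalIntegral.integral_zero_ae
    filter_upwards with x hx
    rw [uIoc_of_le ht] at hx
    rw [hk0 x hx.1.le]; simp
  have hKC : ContDiff ℝ 1 K := by
    rw [contDiff_one_iff_deriv]
    refine ⟨fun t => (hKd t).differentiableAt, ?_⟩
    have : deriv K = fun t => k t / 2 := funext fun t => (hKd t).deriv
    rw [this]; fun_prop
  set Ψ : E3 → ℝ := fun y => K (‖y‖ ^ 2) with hΨ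
  have hΨC : ContDiff ℝ 1 Ψ := hKC.comp (contDiff_norm_sq ℝ)
  have hΨc : HasCompactSupport Ψ := sp_radial_compact K ρ hρ hK0
  have hΨd : ∀ y (i : Fin 3), fderiv ℝ Ψ y (EuclideanSpace.single i 1) = y i * k (‖y‖ ^ 2) := by
    intro y i
    have h1 : HasFDerivAt (fun y : E3 => ‖y‖ ^ 2) (2 • (innerSL ℝ y)) y :=
      (hasStrictFDerivAt_norm_sq y).hasFDerivAt
    have h2 := (hKd (‖y‖ ^ 2)).comp_hasFDerivAt y h1
    have h3 : fderiv ℝ Ψ y = (k (‖y‖ ^ 2) / 2) • (2 • (innerSL ℝ y)) := h2.fderiv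
    rw [h3]
    simp [EuclideanSpace.inner_single_right]
    ring
  have hkc : HasCompactSupport (fun y : E3 => k (‖y‖ ^ 2)) := sp_radial_compact k ρ hρ hk0
  have hkcont : Continuous (fun y : E3 => k (‖y‖ ^ 2)) := by fun_prop
  set m : ℝ → ℝ := fun s => ∫ y, h (c + s • y) * k (‖y‖ ^ 2) with hm
  have hmd : ∀ s, HasDerivAt m (∫ y, fderiv ℝ h (c + s • y) y * k (‖y‖ ^ 2)) s := fun s =>
    sp_hasDerivAt_param h hh1 (fun y => k (‖y‖ ^ 2)) hkcont hkc (fun _ => c) (fun y => y)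
      continuous_const continuous_id s
  have hzero : ∀ s ∈ Set.Ico (0:ℝ) 1, ∫ y, fderiv ℝ h (c + s • y) y * k (‖y‖ ^ 2) = 0 := by
    intro s hs
    set hi : Fin 3 → E3 → ℝ := fun i y => fderiv ℝ h (c + s • y) (EuclideanSpace.single i 1) with hhi
    have hhiC0 : ∀ i, ContDiff ℝ 1 (fun y => fderiv ℝ h y (EuclideanSpace.single i (1:ℝ))) := fun i =>
      (hh.fderiv_right (m := 1) (by norm_num)).clm_apply contDiff_const
    have hhiC : ∀ i, ContDiff ℝ 1 (hi i) := fun i =>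
      (hhiC0 i).comp (by fun_prop : ContDiff ℝ 1 (fun y : E3 => c + s • y))
    have e1 : ∀ y : E3, fderiv ℝ h (c + s • y) y * k (‖y‖ ^ 2)
        = ∑ i, hi i y * fderiv ℝ Ψ y (EuclideanSpace.single i 1) := by
      intro y
      have : y = ∑ i, y i • (EuclideanSpace.single i (1:ℝ) : E3) := by
        ext j; simp [Fin.sum_univ_three]; fin_cases j <;> simp
      conv_lhs => rw [show fderiv ℝ h (c + s • y) y = fderiv ℝ h (c + s • y) (∑ i, y i • (EuclideanSpace.single i (1:ℝ) : E3)) from by rw [← this]]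
      rw [map_sum, Finset.sum_mul]
      apply Finset.sum_congr rfl
      intro i _
      rw [hΨd, map_smul, smul_eq_mul]
      simp only [hhi]; ring
    have e2 : ∀ i y, fderiv ℝ (hi i) y (EuclideanSpace.single i 1) =
        s * fderiv ℝ (fun y => fderiv ℝ h y (EuclideanSpace.single i (1:ℝ))) (c + s • y)
          (EuclideanSpace.single i 1) := by
      intro i y
      have h1 : HasFDerivAt (fun y : E3 => c + s • y) (s • ContinuousLinearMap.id ℝ E3) y :=
        ((hasFDerivAt_id y).const_smul s).const_add c
      have h2 := (((hhiC0 i).differentiable (by norm_num) (c + s • y)).hasFDerivAt).comp y h1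
      have h3 : fderiv ℝ (hi i) y = _ := h2.fderiv
      rw [h3]; simp
    have hint : ∀ i, Integrable (fun y => fderiv ℝ (hi i) y (EuclideanSpace.single i 1) * Ψ y) := by
      intro i
      apply Continuous.integrable_of_hasCompactSupport
      · have := (hhiC i).continuous_fderiv (by norm_num)
        have := hΨC.continuous
        fun_prop
      · exact hΨc.mul_left
    have hint2 : ∀ i, Integrable (fun y => hi i y * fderiv ℝ Ψ y (EuclideanSpace.single i 1)) := by
      intro i
      apply Continuous.integrable_of_hasCompactSupport
      · have := hΨC.continuous_fderiv (by norm_num)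
        have := (hhiC i).continuous
        fun_prop
      · exact (hΨc.fderiv_apply (𝕜 := ℝ) _).mul_left
    simp_rw [e1]
    rw [integral_finsetSum _ (fun i _ => hint2 i)]
    simp_rw [fun i => sp_ibp (hi i) Ψ (hhiC i) hΨC hΨc (EuclideanSpace.single i 1)]
    rw [Finset.sum_neg_distrib, ← integral_finsetSum _ (fun i _ => hint i), neg_eq_zero]
    apply integral_eq_zero_of_ae
    filter_upwards with y
    simp only [e2, Pi.zero_apply]
    rw [← Finset.sum_mul, ← Finset.mul_sum]
    by_cases hy : ‖y‖ < ρ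
    · rw [hlap]
      · simp
      · calc ‖c + s • y‖ ≤ ‖c‖ + ‖s • y‖ := norm_add_le _ _
          _ = ‖c‖ + s * ‖y‖ := by rw [norm_smul, Real.norm_of_nonneg hs.1]
          _ < R := by nlinarith [hs.1, hs.2, norm_nonneg y]
    · have : Ψ y = 0 := hK0 _ (by push Not at hy; gcongr)
      rw [this, mul_zero]
  have hconst : m 1 = m 0 := by
    have := constant_of_has_deriv_right_zero (f := m) (a := 0) (b := 1)
      (fun s _ => (hmd s).continuousAt.continuousWithinAt)
      (fun s hs => by
        have := hmd s
        rw [hzero s hs] at this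
        exact this.hasDerivWithinAt)
    exact this 1 (by simp)
  simp only [hm] at hconst
  simp only [one_smul, zero_smul, add_zero] at hconst
  rw [hconst, integral_const_mul]

/-- gradient version -/
lemma sp_mvp_grad (h : E3 → ℝ) (hh : ContDiff ℝ 2 h) (R ρ : ℝ) (hρ : 0 < ρ) (hρR : ρ < R)
    (hlap : ∀ z : E3, ‖z‖ < R → (∑ i : Fin 3, fderiv ℝ (fun y => fderiv ℝ h y
      (EuclideanSpace.single i 1)) z (EuclideanSpace.single i 1)) = 0)
    (k : ℝ → ℝ) (hk : ContDiff ℝ 1 k) (hk0 : ∀ t, ρ ^ 2 ≤ t → k t = 0) (e : E3) :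
    ∫ y : E3, h y * (inner ℝ y e * (-2 * deriv k (‖y‖ ^ 2))) = fderiv ℝ h 0 e * ∫ y : E3, k (‖y‖ ^ 2) := by
  have hh1 : ContDiff ℝ 1 h := hh.of_le (by norm_num)
  have hkc : HasCompactSupport (fun y : E3 => k (‖y‖ ^ 2)) := sp_radial_compact k ρ hρ hk0
  have hkC : ContDiff ℝ 1 (fun y : E3 => k (‖y‖ ^ 2)) := hk.comp (contDiff_norm_sq ℝ)
  have hkcont : Continuous (fun y : E3 => k (‖y‖ ^ 2)) := hkC.continuous
  have hd := sp_hasDerivAt_param h hh1 (fun y => k (‖y‖ ^ 2)) hkcont hkc (fun y => y) (fun _ => e)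
      continuous_id continuous_const 0
  simp only [zero_smul, add_zero] at hd
  have hd2 : HasDerivAt (fun t : ℝ => h (t • e) * ∫ y : E3, k (‖y‖ ^ 2))
      (fderiv ℝ h 0 e * ∫ y : E3, k (‖y‖ ^ 2)) 0 := by
    apply HasDerivAt.mul_const
    have h1 : HasDerivAt (fun t : ℝ => t • e) e 0 := by
      simpa using ((hasDerivAt_id (0:ℝ)).smul_const e)
    have h2 : HasFDerivAt h (fderiv ℝ h 0) ((0:ℝ) • e) := by
      rw [zero_smul]
      exact (hh1.differentiable (by norm_num) _).hasFDerivAt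
    exact h2.comp_hasDerivAt 0 h1
  have hev : (fun t : ℝ => ∫ y, h (y + t • e) * k (‖y‖ ^ 2)) =ᶠ[𝓝 0]
      (fun t : ℝ => h (t • e) * ∫ y : E3, k (‖y‖ ^ 2)) := by
    have : ∀ᶠ t : ℝ in 𝓝 0, ‖t • e‖ < R - ρ := by
      have hc : Continuous fun t : ℝ => ‖t • e‖ := by fun_prop
      apply hc.continuousAt.eventually_lt continuousAt_const
      simp; linarith
    filter_upwards [this] with t ht
    rw [← sp_mvp h hh R ρ hρ hlap k hk.continuous hk0 (t • e) (by linarith)]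
    simp_rw [add_comm]
  rw [← (hd.congr_of_eventuallyEq hev.symm).unique hd2]
  have := sp_ibp h _ hh1 hkC hkc e
  rw [← neg_eq_iff_eq_neg] at this
  rw [← this, ← integral_neg]
  congr 1
  ext y
  have h1 : HasFDerivAt (fun y : E3 => ‖y‖ ^ 2) (2 • (innerSL ℝ y)) y :=
      (hasStrictFDerivAt_norm_sq y).hasFDerivAt
  have h2 := ((hk.differentiable (by norm_num) (‖y‖ ^ 2)).hasDerivAt).comp_hasFDerivAt y h1
  have h3 : fderiv ℝ (fun y : E3 => k (‖y‖ ^ 2)) y = (deriv k (‖y‖ ^ 2)) • (2 • (innerSL ℝ y)) := h2.fderiv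
  rw [h3]
  simp only [_root_.smul_apply, innerSL_apply_apply, smul_eq_mul, nsmul_eq_mul]
  push_cast
  ring
end PartOne

section PartTwo
open MeasureTheory Set Filter Topology

/-- The quadratic denominator. -/
noncomputable def spD (x y : E3) : ℝ := 1 - 2 * inner ℝ x y + ‖x‖ ^ 2 * ‖y‖ ^ 2

/-- The Moebius transformation of the ball. -/
noncomputable def spT (x y : E3) : E3 :=
  x + ((1 - ‖x‖ ^ 2) / spD x y) • (‖y‖ ^ 2 • x - y)

lemma spD_pos (x y : E3) (hx : ‖x‖ < 1) (hy : ‖y‖ < 1) : 0 < spD x y := by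
  have h1 := real_inner_le_norm x y
  have h2 : ‖x‖ * ‖y‖ < 1 := by nlinarith [norm_nonneg x, norm_nonneg y]
  unfold spD
  nlinarith [sq_pos_of_pos (sub_pos.2 h2)]

lemma spT_norm (x y : E3) (hx : ‖x‖ < 1) (hy : ‖y‖ < 1) : ‖spT x y‖ < 1 := by
  have hD := spD_pos x y hx hy
  have key : 1 - ‖spT x y‖ ^ 2 = (1 - ‖x‖ ^ 2) * (1 - ‖y‖ ^ 2) / spD x y := by
    have e1 : ‖spT x y‖ ^ 2 = ‖x‖ ^ 2 + 2 * ((1 - ‖x‖ ^ 2) / spD x y) * (‖y‖ ^ 2 * ‖x‖ ^ 2 - inner ℝ x y)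
        + ((1 - ‖x‖ ^ 2) / spD x y) ^ 2 * (‖y‖ ^ 4 * ‖x‖ ^ 2 - 2 * ‖y‖ ^ 2 * inner ℝ x y + ‖y‖ ^ 2) := by
      unfold spT
      rw [norm_add_sq_real, norm_smul, mul_pow, norm_sub_sq_real, norm_smul, inner_smul_right, inner_sub_right,
        inner_smul_right, inner_smul_left, real_inner_self_eq_norm_sq, mul_pow, Real.norm_eq_abs, sq_abs,
        Real.norm_eq_abs, sq_abs]
      simp only [conj_trivial]
      ring
    rw [e1]
    have hD' : spD x y ≠ 0 := hD.ne'
    have hi : inner ℝ x y = (1 + ‖x‖ ^ 2 * ‖y‖ ^ 2 - spD x y) / 2 := by unfold spD; ring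
    rw [hi]
    field_simp
    ring
  have : 0 < 1 - ‖spT x y‖ ^ 2 := by
    rw [key]
    have a1 : 0 < 1 - ‖x‖ ^ 2 := by nlinarith [norm_nonneg x]
    have a2 : 0 < 1 - ‖y‖ ^ 2 := by nlinarith [norm_nonneg y]
    positivity
  nlinarith [norm_nonneg (spT x y)]

lemma spD_contDiff (x : E3) : ContDiff ℝ 2 (spD x) := by
  unfold spD
  have h1 := contDiff_norm_sq ℝ (E := E3) (n := 2)
  have h2 : ContDiff ℝ 2 (fun y : E3 => (inner ℝ x y : ℝ)) := (innerSL ℝ x).contDiff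
  fun_prop

lemma spT_contDiffOn (x : E3) (hx : ‖x‖ < 1) : ContDiffOn ℝ 2 (spT x) (Metric.ball 0 1) := by
  unfold spT
  have h1 := (spD_contDiff x).contDiffOn (s := Metric.ball 0 1)
  have h2 := (contDiff_norm_sq ℝ (E := E3) (n := 2)).contDiffOn (s := Metric.ball 0 1)
  have h3 : ContDiffOn ℝ 2 (fun y => (1 - ‖x‖ ^ 2) / spD x y) (Metric.ball 0 1) :=
    contDiffOn_const.div h1 fun y hy => (spD_pos x y hx (by simpa using hy)).ne'
  exact contDiffOn_const.add (h3.smul ((h2.smul contDiffOn_const).sub contDiffOn_id))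

lemma sp_line {F : E3 → ℝ} {y v : E3} {d : ℝ} (hF : DifferentiableAt ℝ F y)
    (hd : HasDerivAt (fun t : ℝ => F (y + t • v)) d 0) : fderiv ℝ F y v = d := by
  have := hF.hasFDerivAt.hasLineDerivAt v
  exact HasDerivAt.unique this hd

/-- directional derivatives of coordinates -/
lemma sp_norm_line (y : E3) (i : Fin 3) :
    HasDerivAt (fun t : ℝ => ‖y + t • (EuclideanSpace.single i (1:ℝ) : E3)‖ ^ 2) (2 * y i) 0 := by
  have h1 : HasFDerivAt (fun y : E3 => ‖y‖ ^ 2) (2 • (innerSL ℝ y)) y :=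
      (hasStrictFDerivAt_norm_sq y).hasFDerivAt
  have := h1.hasLineDerivAt (EuclideanSpace.single i (1:ℝ) : E3)
  simpa [HasLineDerivAt, EuclideanSpace.inner_single_right] using this

lemma spD_line (x y : E3) (i : Fin 3) :
    HasDerivAt (fun t : ℝ => spD x (y + t • (EuclideanSpace.single i (1:ℝ) : E3)))
      (-2 * x i + 2 * ‖x‖ ^ 2 * y i) 0 := by
  unfold spD
  have h1 : HasDerivAt (fun t : ℝ => inner ℝ x (y + t • (EuclideanSpace.single i (1:ℝ) : E3))) (x i) 0 := by
    have e : (fun t : ℝ => inner ℝ x (y + t • (EuclideanSpace.single i (1:ℝ) : E3))) =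
        fun t => inner ℝ x y + t * x i := by
      ext t
      rw [inner_add_right, inner_smul_right, EuclideanSpace.inner_single_right]; simp
    rw [e]
    simpa using ((hasDerivAt_id (0:ℝ)).mul_const (x i)).const_add (inner ℝ x y)
  refine (((h1.const_mul 2).const_sub 1).add ((sp_norm_line y i).const_mul (‖x‖ ^ 2))).congr_deriv ?_
  ring

/-- coordinates of the derivative of T -/
noncomputable def spTij (x : E3) (i j : Fin 3) (y : E3) : ℝ :=
  (1 - ‖x‖ ^ 2) * ((2 * y i * x j - (if i = j then 1 else 0)) / spD x y
    - (‖y‖ ^ 2 * x j - y j) * (-2 * x i + 2 * ‖x‖ ^ 2 * y i) / spD x y ^ 2)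

lemma sp_coord_line (y : E3) (i j : Fin 3) :
    HasDerivAt (fun t : ℝ => (y + t • (EuclideanSpace.single i (1:ℝ) : E3)) j) (if i = j then 1 else 0) 0 := by
  have e : (fun t : ℝ => (y + t • (EuclideanSpace.single i (1:ℝ) : E3)) j) =
    fun t => y j + t * (if i = j then 1 else 0) := by
    ext t
    by_cases h : i = j
    · subst h; simp
    · have h' : ¬ j = i := fun q => h q.symm
      simp [h, h']
  rw [e]
  simpa using ((hasDerivAt_id (0:ℝ)).mul_const (if i = j then (1:ℝ) else 0)).const_add (y j)

lemma spT_coord_line (x y : E3) (hD : spD x y ≠ 0) (i j : Fin 3) :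
    HasDerivAt (fun t : ℝ => spT x (y + t • (EuclideanSpace.single i (1:ℝ) : E3)) j) (spTij x i j y) 0 := by
  have e : (fun t : ℝ => spT x (y + t • (EuclideanSpace.single i (1:ℝ) : E3)) j) =
    fun t => x j + ((1 - ‖x‖ ^ 2) / spD x (y + t • (EuclideanSpace.single i (1:ℝ) : E3))) *
      (‖y + t • (EuclideanSpace.single i (1:ℝ) : E3)‖ ^ 2 * x j -
        (y + t • (EuclideanSpace.single i (1:ℝ) : E3)) j) := by
    ext t; simp [spT]
  rw [e]
  have h1 := spD_line x y i
  have h2 := sp_norm_line y i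
  have h3 := sp_coord_line y i j
  have h4 := ((((hasDerivAt_const (0:ℝ) (1 - ‖x‖ ^ 2)).div h1 (by simpa using hD))).mul
    ((h2.mul_const (x j)).sub h3)).const_add (x j)
  refine h4.congr_deriv ?_
  simp only [zero_smul, add_zero, spTij, Pi.div_apply, Pi.sub_apply]
  field_simp
  ring

lemma spT_line (x y : E3) (hD : spD x y ≠ 0) (i : Fin 3) :
    HasDerivAt (fun t : ℝ => spT x (y + t • (EuclideanSpace.single i (1:ℝ) : E3)))
      (∑ j, spTij x i j y • (EuclideanSpace.single j (1:ℝ) : E3)) 0 := by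
  have e : ∀ z : E3, z = ∑ j, z j • (EuclideanSpace.single j (1:ℝ) : E3) := by
    intro z; ext j; simp [Fin.sum_univ_three]; fin_cases j <;> simp
  have : (fun t : ℝ => spT x (y + t • (EuclideanSpace.single i (1:ℝ) : E3))) =
    fun t => ∑ j, spT x (y + t • (EuclideanSpace.single i (1:ℝ) : E3)) j • (EuclideanSpace.single j (1:ℝ) : E3) :=
    funext fun t => e _
  rw [this]
  exact HasDerivAt.fun_sum fun j _ => (spT_coord_line x y hD i j).smul_const _

lemma sp_comp_line (x y : E3) (hx : ‖x‖ < 1) (hy : ‖y‖ < 1) (F : E3 → ℝ)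
    (hF : DifferentiableAt ℝ F (spT x y)) (i : Fin 3) :
    HasDerivAt (fun t : ℝ => F (spT x (y + t • (EuclideanSpace.single i (1:ℝ) : E3))))
      (∑ j, spTij x i j y * fderiv ℝ F (spT x y) (EuclideanSpace.single j (1:ℝ))) 0 := by
  have h1 := spT_line x y (spD_pos x y hx hy).ne' i
  have h2 : HasFDerivAt F (fderiv ℝ F (spT x y)) (spT x (y + (0:ℝ) • (EuclideanSpace.single i (1:ℝ) : E3))) := by
    simpa using hF.hasFDerivAt
  have := h2.comp_hasDerivAt 0 h1
  simpa [map_sum, map_smul, Function.comp_def] using this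

lemma spW_line (x y : E3) (hx : ‖x‖ < 1) (hy : ‖y‖ < 1) (i : Fin 3) :
    HasDerivAt (fun t : ℝ => (√(spD x (y + t • (EuclideanSpace.single i (1:ℝ) : E3))))⁻¹)
      ((√(spD x y))⁻¹ * (- (1/2) * ((-2 * x i + 2 * ‖x‖ ^ 2 * y i) / spD x y))) 0 := by
  have hD := spD_pos x y hx hy
  have h1 := (spD_line x y i).sqrt (by simpa using hD.ne')
  have h2 := h1.inv (by simpa using (Real.sqrt_pos.2 hD).ne')
  refine h2.congr_deriv ?_
  simp only [zero_smul, add_zero]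
  rw [Real.sq_sqrt hD.le]
  have := (Real.sqrt_pos.2 hD).ne'
  field_simp

/-- The Kelvin transform. -/
noncomputable def spH (u : E3 → ℝ) (x y : E3) : ℝ := (√(spD x y))⁻¹ * u (spT x y)

lemma spH_contDiffOn (u : E3 → ℝ) (hu : ContDiffOn ℝ 2 u (Metric.ball 0 1)) (x : E3) (hx : ‖x‖ < 1) :
    ContDiffOn ℝ 2 (spH u x) (Metric.ball 0 1) := by
  unfold spH
  have hpos : ∀ y ∈ Metric.ball (0:E3) 1, spD x y ≠ 0 := fun y hy =>
    (spD_pos x y hx (by simpa using hy)).ne'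
  apply ContDiffOn.mul
  · apply ContDiffOn.inv
    · exact (spD_contDiff x).contDiffOn.sqrt hpos
    · intro y hy
      exact (Real.sqrt_pos.2 (spD_pos x y hx (by simpa using hy))).ne'
  · apply hu.comp (spT_contDiffOn x hx)
    intro y hy
    simpa using spT_norm x y hx (by simpa using hy)

lemma spH_fderiv (u : E3 → ℝ) (hu : ContDiffOn ℝ 2 u (Metric.ball 0 1)) (x : E3) (hx : ‖x‖ < 1)
    (y : E3) (hy : ‖y‖ < 1) (i : Fin 3) :
    fderiv ℝ (spH u x) y (EuclideanSpace.single i 1) =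
      (√(spD x y))⁻¹ * (- (1/2) * ((-2 * x i + 2 * ‖x‖ ^ 2 * y i) / spD x y) * u (spT x y) +
        ∑ j, spTij x i j y * fderiv ℝ u (spT x y) (EuclideanSpace.single j (1:ℝ))) := by
  have hmem : Metric.ball (0:E3) 1 ∈ 𝓝 y := Metric.isOpen_ball.mem_nhds (by simpa using hy)
  have hmem2 : Metric.ball (0:E3) 1 ∈ 𝓝 (spT x y) :=
    Metric.isOpen_ball.mem_nhds (by simpa using spT_norm x y hx hy)
  apply sp_line
  · exact ((spH_contDiffOn u hu x hx).contDiffAt hmem).differentiableAt (by norm_num)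
  · have h1 := spW_line x y hx hy i
    have h2 := sp_comp_line x y hx hy u ((hu.contDiffAt hmem2).differentiableAt (by norm_num)) i
    refine (h1.mul h2).congr_deriv ?_
    simp only [zero_smul, add_zero]
    ring

noncomputable def spTiij (x : E3) (i j : Fin 3) (y : E3) : ℝ :=
  (1 - ‖x‖ ^ 2) * (2 * x j / spD x y
    - 2 * (2 * y i * x j - (if i = j then 1 else 0)) * (-2 * x i + 2 * ‖x‖ ^ 2 * y i) / spD x y ^ 2
    - (‖y‖ ^ 2 * x j - y j) * (2 * ‖x‖ ^ 2) / spD x y ^ 2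
    + 2 * (‖y‖ ^ 2 * x j - y j) * (-2 * x i + 2 * ‖x‖ ^ 2 * y i) ^ 2 / spD x y ^ 3)

lemma spDi_line (x y : E3) (i : Fin 3) :
    HasDerivAt (fun t : ℝ => -2 * x i + 2 * ‖x‖ ^ 2 * (y + t • (EuclideanSpace.single i (1:ℝ) : E3)) i)
      (2 * ‖x‖ ^ 2) 0 := by
  have h3 := sp_coord_line y i i
  simp only [if_true] at h3
  refine ((h3.const_mul (2 * ‖x‖ ^ 2)).const_add (-2 * x i)).congr_deriv ?_
  ring

lemma spTij_line (x y : E3) (hD : spD x y ≠ 0) (i j : Fin 3) :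
    HasDerivAt (fun t : ℝ => spTij x i j (y + t • (EuclideanSpace.single i (1:ℝ) : E3))) (spTiij x i j y) 0 := by
  have h1 := spD_line x y i
  have h2 := sp_norm_line y i
  have h3 := sp_coord_line y i j
  have h4 := sp_coord_line y i i
  simp only [if_true] at h4
  have h5 := spDi_line x y i
  have hD' : spD x (y + (0:ℝ) • (EuclideanSpace.single i (1:ℝ) : E3)) ≠ 0 := by simpa using hD
  have h6 := ((((h4.const_mul 2).mul_const (x j)).sub_const (if i = j then 1 else 0)).div h1 hD').sub
    ((((h2.mul_const (x j)).sub h3).mul h5).div (h1.pow 2) (pow_ne_zero 2 hD'))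
  refine (h6.const_mul (1 - ‖x‖ ^ 2)).congr_deriv ?_
  simp only [zero_smul, add_zero, spTiij, Pi.div_apply, Pi.sub_apply, Pi.mul_apply, Pi.pow_apply]
  field_simp
  ring

lemma sp_nsq (x : E3) : ‖x‖ ^ 2 = x 0 ^ 2 + x 1 ^ 2 + x 2 ^ 2 := by
  rw [EuclideanSpace.norm_sq_eq]; simp [Fin.sum_univ_three]

lemma sp_inner (x y : E3) : inner ℝ x y = x 0 * y 0 + x 1 * y 1 + x 2 * y 2 := by
  simp [PiLp.inner_apply, Fin.sum_univ_three]; ring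

lemma sp_idA (x y : E3) : ∑ i, (-2 * x i + 2 * ‖x‖ ^ 2 * y i) ^ 2 = 4 * ‖x‖ ^ 2 * spD x y := by
  simp only [spD, sp_nsq, sp_inner, Fin.sum_univ_three]; ring

lemma sp_idB (x y : E3) (hD : spD x y ≠ 0) (j : Fin 3) :
    ∑ i, (- ((-2 * x i + 2 * ‖x‖ ^ 2 * y i) / spD x y) * spTij x i j y + spTiij x i j y) = 0 := by
  have hA := sp_idA x y
  have hB : (∑ i, (2 * y i * x j - (if i = j then 1 else 0)) * (-2 * x i + 2 * ‖x‖ ^ 2 * y i))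
     = 2 * x j * spD x y + 2 * ‖x‖ ^ 2 * (‖y‖ ^ 2 * x j - y j) := by
    simp only [spD, sp_nsq, sp_inner, Fin.sum_univ_three]; fin_cases j <;> simp <;> ring
  have : ∀ i, (- ((-2 * x i + 2 * ‖x‖ ^ 2 * y i) / spD x y) * spTij x i j y + spTiij x i j y) =
    (1 - ‖x‖ ^ 2) * ((2 * x j / spD x y - (‖y‖ ^ 2 * x j - y j) * (2 * ‖x‖ ^ 2) / spD x y ^ 2)
     - 3 / spD x y ^ 2 * ((2 * y i * x j - (if i = j then 1 else 0)) * (-2 * x i + 2 * ‖x‖ ^ 2 * y i))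
     + 3 * (‖y‖ ^ 2 * x j - y j) / spD x y ^ 3 * (-2 * x i + 2 * ‖x‖ ^ 2 * y i) ^ 2) := by
    intro i
    unfold spTij spTiij
    field_simp
    ring
  simp_rw [this]
  rw [← Finset.mul_sum, Finset.sum_add_distrib, Finset.sum_sub_distrib, ← Finset.mul_sum, ← Finset.mul_sum, hA, hB]
  simp only [Finset.sum_const, Finset.card_univ, Fintype.card_fin, nsmul_eq_mul]
  push_cast
  field_simp
  ring

lemma sp_idC (x y : E3) (hD : spD x y ≠ 0) (j k : Fin 3) :
    ∑ i, spTij x i j y * spTij x i k y = if j = k then ((1 - ‖x‖ ^ 2) / spD x y) ^ 2 else 0 := by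
  have e : ∀ i j, spTij x i j y = (1 - ‖x‖ ^ 2) / spD x y ^ 2 * ((2 * y i * x j - (if i = j then 1 else 0)) * spD x y
    - (‖y‖ ^ 2 * x j - y j) * (-2 * x i + 2 * ‖x‖ ^ 2 * y i)) := by
    intro i j; unfold spTij; field_simp
  have e2 : ∑ i, ((2 * y i * x j - (if i = j then 1 else 0)) * spD x y
    - (‖y‖ ^ 2 * x j - y j) * (-2 * x i + 2 * ‖x‖ ^ 2 * y i)) * ((2 * y i * x k - (if i = k then 1 else 0)) * spD x y
    - (‖y‖ ^ 2 * x k - y k) * (-2 * x i + 2 * ‖x‖ ^ 2 * y i)) = if j = k then spD x y ^ 2 else 0 := by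
    simp only [spD, sp_nsq, sp_inner, Fin.sum_univ_three]
    fin_cases j <;> fin_cases k <;> simp <;> ring
  have e3 : ∀ i, spTij x i j y * spTij x i k y = ((1 - ‖x‖ ^ 2) / spD x y ^ 2) ^ 2 *
    (((2 * y i * x j - (if i = j then 1 else 0)) * spD x y
    - (‖y‖ ^ 2 * x j - y j) * (-2 * x i + 2 * ‖x‖ ^ 2 * y i)) * ((2 * y i * x k - (if i = k then 1 else 0)) * spD x y
    - (‖y‖ ^ 2 * x k - y k) * (-2 * x i + 2 * ‖x‖ ^ 2 * y i))) := by
    intro i; rw [e, e]; ring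
  simp_rw [e3]
  rw [← Finset.mul_sum, e2]
  split_ifs
  · field_simp
  · simp

lemma spH_lap (u : E3 → ℝ) (hu : IsHarmonicOn u (Metric.ball 0 1)) (x : E3) (hx : ‖x‖ < 1)
    (y : E3) (hy : ‖y‖ < 1) :
    (∑ i : Fin 3, fderiv ℝ (fun y => fderiv ℝ (spH u x) y (EuclideanSpace.single i 1)) y
      (EuclideanSpace.single i 1)) = 0 := by
  have hmem : Metric.ball (0:E3) 1 ∈ 𝓝 y := Metric.isOpen_ball.mem_nhds (by simpa using hy)
  have hTy := spT_norm x y hx hy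
  have hmem2 : Metric.ball (0:E3) 1 ∈ 𝓝 (spT x y) :=
    Metric.isOpen_ball.mem_nhds (by simpa using hTy)
  have hD := spD_pos x y hx hy
  have hD0 := hD.ne'
  set uj : Fin 3 → E3 → ℝ := fun j z => fderiv ℝ u z (EuclideanSpace.single j 1) with huj
  have hujd : ∀ j, DifferentiableAt ℝ (uj j) (spT x y) := by
    intro j
    have h1 : ContDiffAt ℝ 1 (fderiv ℝ u) (spT x y) :=
      (hu.1.contDiffAt hmem2).fderiv_right (m := 1) (by norm_num)
    exact (h1.clm_apply contDiffAt_const).differentiableAt (by norm_num)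
  have key : ∀ i : Fin 3, fderiv ℝ (fun y => fderiv ℝ (spH u x) y (EuclideanSpace.single i 1)) y
      (EuclideanSpace.single i 1) = (√(spD x y))⁻¹ *
      ((3 / 4 * (-2 * x i + 2 * ‖x‖ ^ 2 * y i) ^ 2 / spD x y ^ 2 - ‖x‖ ^ 2 / spD x y) * u (spT x y)
       + ∑ j, (- ((-2 * x i + 2 * ‖x‖ ^ 2 * y i) / spD x y) * spTij x i j y + spTiij x i j y) * uj j (spT x y)
       + ∑ j, ∑ k, spTij x i j y * spTij x i k y * fderiv ℝ (uj j) (spT x y) (EuclideanSpace.single k 1)) := by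
    intro i
    apply sp_line
    · have h1 : ContDiffAt ℝ 1 (fderiv ℝ (spH u x)) y :=
        ((spH_contDiffOn u hu.1 x hx).contDiffAt hmem).fderiv_right (m := 1) (by norm_num)
      exact (h1.clm_apply contDiffAt_const).differentiableAt (by norm_num)
    · have hev : (fun t : ℝ => fderiv ℝ (spH u x) (y + t • (EuclideanSpace.single i (1:ℝ) : E3)) (EuclideanSpace.single i 1))
        =ᶠ[𝓝 0] fun t : ℝ => (√(spD x (y + t • (EuclideanSpace.single i (1:ℝ) : E3))))⁻¹ *
        (- (1/2) * ((-2 * x i + 2 * ‖x‖ ^ 2 * (y + t • (EuclideanSpace.single i (1:ℝ) : E3)) i) /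
          spD x (y + t • (EuclideanSpace.single i (1:ℝ) : E3))) * u (spT x (y + t • (EuclideanSpace.single i (1:ℝ) : E3))) +
        ∑ j, spTij x i j (y + t • (EuclideanSpace.single i (1:ℝ) : E3)) *
          uj j (spT x (y + t • (EuclideanSpace.single i (1:ℝ) : E3)))) := by
        have : ∀ᶠ t : ℝ in 𝓝 0, ‖y + t • (EuclideanSpace.single i (1:ℝ) : E3)‖ < 1 := by
          have hc : Continuous fun t : ℝ => ‖y + t • (EuclideanSpace.single i (1:ℝ) : E3)‖ := by fun_prop
          apply hc.continuousAt.eventually_lt continuousAt_const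
          simpa using hy
        filter_upwards [this] with t ht
        exact spH_fderiv u hu.1 x hx _ ht i
      refine HasDerivAt.congr_of_eventuallyEq ?_ hev
      have hDz : spD x (y + (0:ℝ) • (EuclideanSpace.single i (1:ℝ) : E3)) ≠ 0 := by simpa using hD0
      have a1 := spW_line x y hx hy i
      have a2 := ((spDi_line x y i).div (spD_line x y i) hDz).const_mul (-(1/2))
      have a3 := sp_comp_line x y hx hy u ((hu.1.contDiffAt hmem2).differentiableAt (by norm_num)) i
      have a4 : HasDerivAt (fun t : ℝ => ∑ j, spTij x i j (y + t • (EuclideanSpace.single i (1:ℝ) : E3)) *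
          uj j (spT x (y + t • (EuclideanSpace.single i (1:ℝ) : E3))))
          (∑ j, (spTiij x i j y * uj j (spT x y) +
            spTij x i j y * ∑ k, spTij x i k y * fderiv ℝ (uj j) (spT x y) (EuclideanSpace.single k (1:ℝ)))) 0 := by
        apply HasDerivAt.fun_sum
        intro j _
        refine ((spTij_line x y hD0 i j).mul (sp_comp_line x y hx hy (uj j) (hujd j) i)).congr_deriv ?_
        simp only [zero_smul, add_zero]
      refine (a1.mul ((a2.mul a3).add a4)).congr_deriv ?_
      simp only [zero_smul, add_zero, Pi.div_apply, Pi.mul_apply, Pi.add_apply, Fin.sum_univ_three, huj]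
      field_simp
      ring
  simp_rw [key]
  rw [← Finset.mul_sum, Finset.sum_add_distrib, Finset.sum_add_distrib, ← Finset.sum_mul]
  have hA := sp_idA x y
  have t1 : ∑ i, (3 / 4 * (-2 * x i + 2 * ‖x‖ ^ 2 * y i) ^ 2 / spD x y ^ 2 - ‖x‖ ^ 2 / spD x y) = 0 := by
    have : ∀ i, (3 / 4 * (-2 * x i + 2 * ‖x‖ ^ 2 * y i) ^ 2 / spD x y ^ 2 - ‖x‖ ^ 2 / spD x y) =
      3 / 4 / spD x y ^ 2 * (-2 * x i + 2 * ‖x‖ ^ 2 * y i) ^ 2 - ‖x‖ ^ 2 / spD x y := by intro i; ring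
    simp_rw [this]
    rw [Finset.sum_sub_distrib, ← Finset.mul_sum, hA]
    simp only [Finset.sum_const, Finset.card_univ, Fintype.card_fin, nsmul_eq_mul]
    push_cast
    field_simp
    ring
  rw [t1, Finset.sum_comm]
  have t2 : ∀ j, ∑ i, (- ((-2 * x i + 2 * ‖x‖ ^ 2 * y i) / spD x y) * spTij x i j y + spTiij x i j y) * uj j (spT x y) = 0 := by
    intro j; rw [← Finset.sum_mul, sp_idB x y hD0 j, zero_mul]
  simp_rw [t2]
  rw [Finset.sum_comm]
  have t3 : ∀ j, ∑ i, ∑ k, spTij x i j y * spTij x i k y * fderiv ℝ (uj j) (spT x y) (EuclideanSpace.single k 1)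
     = ((1 - ‖x‖ ^ 2) / spD x y) ^ 2 * fderiv ℝ (uj j) (spT x y) (EuclideanSpace.single j 1) := by
    intro j
    rw [Finset.sum_comm]
    simp_rw [← Finset.sum_mul, sp_idC x y hD0 j]
    simp
  simp_rw [t3]
  rw [← Finset.mul_sum, hu.2 (spT x y) (by simpa using hTy)]
  simp

lemma spH_zero (u : E3 → ℝ) (x : E3) : spH u x 0 = u x := by
  simp [spH, spD, spT]

lemma spH_fderiv_zero (u : E3 → ℝ) (hu : ContDiffOn ℝ 2 u (Metric.ball 0 1)) (x : E3) (hx : ‖x‖ < 1) (e : E3) :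
    fderiv ℝ (spH u x) 0 e = inner ℝ x e * u x - (1 - ‖x‖ ^ 2) * fderiv ℝ u x e := by
  have h0 := spH_fderiv u hu x hx 0 (by simp)
  have hT : spT x 0 = x := by simp [spT]
  have hD : spD x 0 = 1 := by simp [spD]
  have he : e = ∑ j, e j • (EuclideanSpace.single j (1:ℝ) : E3) := by
    ext j; simp [Fin.sum_univ_three]; fin_cases j <;> simp
  have h1 : ∀ L : E3 →L[ℝ] ℝ, L e = ∑ j, e j * L (EuclideanSpace.single j (1:ℝ)) := by
    intro L
    conv_lhs => rw [he]
    simp [map_sum, map_smul]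
  rw [h1 (fderiv ℝ (spH u x) 0), h1 (fderiv ℝ u x)]
  simp_rw [h0]
  rw [hT, hD, sp_inner]
  simp [spTij, hD, Fin.sum_univ_three]
  ring

lemma spH_bound (u : E3 → ℝ) (hb : ∀ y ∈ Metric.ball (0 : E3) 1, |u y| < 1) (x : E3) (hx : ‖x‖ < 1)
    (y : E3) (hy : ‖y‖ < 1) : |spH u x y| ≤ (√(spD x y))⁻¹ := by
  unfold spH
  have h1 := hb (spT x y) (by simpa using spT_norm x y hx hy)
  have h2 : 0 ≤ (√(spD x y))⁻¹ := by positivity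
  rw [abs_mul, abs_of_nonneg h2]
  nlinarith
end PartTwo

section PartFour
open MeasureTheory Set Filter Topology

/-- base radius -/
noncomputable def spS (r τ : ℝ) : ℝ := √(9 - r ^ 2 + r ^ 2 * τ ^ 2)
noncomputable def spL (r c τ : ℝ) : ℝ := spS r τ + c * τ
noncomputable def spA (r c τ : ℝ) : ℝ := spL r c τ ^ 3 * (√(spL r c τ ^ 2 - (6 - 2 * r ^ 2)))⁻¹
noncomputable def spP (r c τ : ℝ) : ℝ := spL r c τ ^ 2 / (spL r c τ ^ 2 - (6 - 2 * r ^ 2))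

lemma spS_pos (r τ : ℝ) (hr : 0 ≤ r) (hr1 : r < 1) : 0 < spS r τ := by
  apply Real.sqrt_pos.2; nlinarith [mul_nonneg (sq_nonneg r) (sq_nonneg τ)]

lemma spS_sq (r τ : ℝ) (hr : 0 ≤ r) (hr1 : r < 1) : spS r τ ^ 2 = 9 - r ^ 2 + r ^ 2 * τ ^ 2 := by
  apply Real.sq_sqrt; nlinarith [mul_nonneg (sq_nonneg r) (sq_nonneg τ)]

lemma spL_ge (r c τ : ℝ) (hr : 0 ≤ r) (hr1 : r < 1) (hc : c = r ∨ c = -r) (h1 : -1 ≤ τ) (h2 : τ ≤ 1) :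
    3 - r ≤ spL r c τ := by
  have key : 3 - r - c * τ ≤ spS r τ := by
    apply Real.le_sqrt_of_sq_le
    rcases hc with rfl | rfl
    · nlinarith [mul_nonneg (by linarith : 0 ≤ 1 + τ) (by nlinarith : 0 ≤ 6 * c - 2 * c ^ 2)]
    · nlinarith [mul_nonneg (by linarith : 0 ≤ 1 - τ) (by nlinarith : 0 ≤ 6 * r - 2 * r ^ 2)]
  unfold spL; linarith

lemma spL_gap (r c τ : ℝ) (hr : 0 ≤ r) (hr1 : r < 1) (hc : c = r ∨ c = -r) (h1 : -1 ≤ τ) (h2 : τ ≤ 1) :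
    0 < spL r c τ ^ 2 - (6 - 2 * r ^ 2) := by
  have := spL_ge r c τ hr hr1 hc h1 h2
  nlinarith [sq_pos_of_pos (sub_pos.2 hr1)]

lemma spS_deriv (r τ : ℝ) (hr : 0 ≤ r) (hr1 : r < 1) :
    HasDerivAt (spS r) (r ^ 2 * τ / spS r τ) τ := by
  have h0 : (9 - r ^ 2 + r ^ 2 * τ ^ 2) ≠ 0 := by nlinarith [mul_nonneg (sq_nonneg r) (sq_nonneg τ)]
  have h1 : HasDerivAt (fun τ : ℝ => 9 - r ^ 2 + r ^ 2 * τ ^ 2) (r ^ 2 * (2 * τ)) τ := by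
    simpa using ((hasDerivAt_pow 2 τ).const_mul (r ^ 2)).const_add (9 - r ^ 2)
  refine (h1.sqrt h0).congr_deriv ?_
  have := (spS_pos r τ hr hr1).ne'
  unfold spS at *
  field_simp

lemma spL_deriv (r c τ : ℝ) (hr : 0 ≤ r) (hr1 : r < 1) (hc : c = r ∨ c = -r) :
    HasDerivAt (spL r c) (c * spL r c τ / spS r τ) τ := by
  refine ((spS_deriv r τ hr hr1).add ((hasDerivAt_id τ).const_mul c)).congr_deriv ?_
  have := (spS_pos r τ hr hr1).ne'
  have hc2 : c ^ 2 = r ^ 2 := by rcases hc with rfl | rfl <;> ring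
  unfold spL
  rw [← hc2]
  field_simp
  ring

lemma spA_deriv (r c τ : ℝ) (hr : 0 ≤ r) (hr1 : r < 1) (hc : c = r ∨ c = -r) (h1 : -1 ≤ τ) (h2 : τ ≤ 1) :
    HasDerivAt (spA r c) (c * spA r c τ * (3 - spP r c τ) / spS r τ) τ := by
  have hg := spL_gap r c τ hr hr1 hc h1 h2
  have hL := spL_deriv r c τ hr hr1 hc
  have hS := (spS_pos r τ hr hr1).ne'
  have hq := Real.sqrt_pos.2 hg
  have h3 := ((hL.pow 2).sub_const (6 - 2 * r ^ 2)).sqrt (by simpa using hg.ne')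
  have h4 := (hL.pow 3).mul (h3.inv (by simpa using hq.ne'))
  refine h4.congr_deriv ?_
  simp only [Pi.pow_apply, Pi.inv_apply, spA, spP]
  rw [Real.sq_sqrt hg.le]
  have hg' := hg.ne'
  have hq' := hq.ne'
  field_simp
  ring

lemma spP_deriv (r c τ : ℝ) (hr : 0 ≤ r) (hr1 : r < 1) (hc : c = r ∨ c = -r) (h1 : -1 ≤ τ) (h2 : τ ≤ 1) :
    HasDerivAt (spP r c) (c * (-2 * spP r c τ * (spP r c τ - 1)) / spS r τ) τ := by
  have hg := spL_gap r c τ hr hr1 hc h1 h2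
  have hL := spL_deriv r c τ hr hr1 hc
  have hS := (spS_pos r τ hr hr1).ne'
  have h4 := (hL.pow 2).div ((hL.pow 2).sub_const (6 - 2 * r ^ 2)) (by simpa using hg.ne')
  refine h4.congr_deriv ?_
  simp only [Pi.pow_apply, spP]
  have hg' := hg.ne'
  field_simp
  ring

noncomputable def spN (r τ : ℝ) : ℝ :=
  spS r τ * (spA r r τ * (3 - spP r r τ) - spA r (-r) τ * (3 - spP r (-r) τ)) - r * τ * (spA r r τ + spA r (-r) τ)

lemma spA_nonneg (r c τ : ℝ) (hr : 0 ≤ r) (hr1 : r < 1) (hc : c = r ∨ c = -r) (h1 : -1 ≤ τ) (h2 : τ ≤ 1) :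
    0 ≤ spA r c τ := by
  have := spL_ge r c τ hr hr1 hc h1 h2
  have : 0 ≤ spL r c τ := by linarith
  unfold spA; positivity

lemma spN_deriv (r τ : ℝ) (hr : 0 ≤ r) (hr1 : r < 1) (h1 : -1 ≤ τ) (h2 : τ ≤ 1) :
    HasDerivAt (spN r) (r * (spA r r τ * (3 * spP r r τ ^ 2 - 8 * spP r r τ + 8)
      + spA r (-r) τ * (3 * spP r (-r) τ ^ 2 - 8 * spP r (-r) τ + 8))) τ := by
  have hS := (spS_pos r τ hr hr1).ne'
  have a1 := spS_deriv r τ hr hr1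
  have a2 := spA_deriv r r τ hr hr1 (Or.inl rfl) h1 h2
  have a3 := spA_deriv r (-r) τ hr hr1 (Or.inr rfl) h1 h2
  have a4 := spP_deriv r r τ hr hr1 (Or.inl rfl) h1 h2
  have a5 := spP_deriv r (-r) τ hr hr1 (Or.inr rfl) h1 h2
  refine ((a1.mul ((a2.mul (a4.const_sub 3)).sub (a3.mul (a5.const_sub 3)))).sub
    (((hasDerivAt_id τ).const_mul r).mul (a2.add a3))).congr_deriv ?_
  simp only [Pi.mul_apply, Pi.sub_apply, Pi.add_apply, id]
  field_simp
  ring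

lemma spN_nonneg (r τ : ℝ) (hr : 0 ≤ r) (hr1 : r < 1) (h1 : 0 ≤ τ) (h2 : τ ≤ 1) : 0 ≤ spN r τ := by
  have hm : MonotoneOn (spN r) (Icc 0 1) := by
    apply monotoneOn_of_deriv_nonneg (convex_Icc 0 1)
    · intro t ht
      exact (spN_deriv r t hr hr1 (by linarith [ht.1]) ht.2).continuousAt.continuousWithinAt
    · intro t ht
      rw [interior_Icc] at ht
      exact (spN_deriv r t hr hr1 (by linarith [ht.1]) ht.2.le).differentiableAt.differentiableWithinAt
    · intro t ht
      rw [interior_Icc] at ht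
      rw [(spN_deriv r t hr hr1 (by linarith [ht.1]) ht.2.le).deriv]
      have b1 := spA_nonneg r r t hr hr1 (Or.inl rfl) (by linarith [ht.1]) ht.2.le
      have b2 := spA_nonneg r (-r) t hr hr1 (Or.inr rfl) (by linarith [ht.1]) ht.2.le
      have b3 : ∀ p : ℝ, 0 ≤ 3 * p ^ 2 - 8 * p + 8 := fun p => by nlinarith [sq_nonneg (3 * p - 4)]
      exact mul_nonneg hr (add_nonneg (mul_nonneg b1 (b3 _)) (mul_nonneg b2 (b3 _)))
  have := hm (left_mem_Icc.2 zero_le_one) ⟨h1, h2⟩ h1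
  have h0 : spN r 0 = 0 := by simp [spN, spA, spP, spL]
  linarith

noncomputable def spM (r τ : ℝ) : ℝ := (spA r r τ + spA r (-r) τ) / spS r τ

lemma spM_mono (r : ℝ) (hr : 0 ≤ r) (hr1 : r < 1) : MonotoneOn (spM r) (Icc 0 1) := by
  have hd : ∀ t, 0 ≤ t → t ≤ 1 → HasDerivAt (spM r) (r * spN r t / spS r t ^ 3) t := by
    intro t h1 h2
    have hS := (spS_pos r t hr hr1).ne'
    have a1 := spS_deriv r t hr hr1
    have a2 := spA_deriv r r t hr hr1 (Or.inl rfl) (by linarith) h2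
    have a3 := spA_deriv r (-r) t hr hr1 (Or.inr rfl) (by linarith) h2
    refine ((a2.add a3).div a1 hS).congr_deriv ?_
    simp only [Pi.add_apply, spN]
    field_simp
    ring
  apply monotoneOn_of_deriv_nonneg (convex_Icc 0 1)
  · intro t ht
    exact (hd t ht.1 ht.2).continuousAt.continuousWithinAt
  · intro t ht
    rw [interior_Icc] at ht
    exact (hd t ht.1.le ht.2.le).differentiableAt.differentiableWithinAt
  · intro t ht
    rw [interior_Icc] at ht
    rw [(hd t ht.1.le ht.2.le).deriv]
    have := spN_nonneg r t hr hr1 ht.1.le ht.2.le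
    have := spS_pos r t hr hr1
    positivity

lemma spM_cont (r : ℝ) (hr : 0 ≤ r) (hr1 : r < 1) (c : ℝ) (hc : c = r ∨ c = -r) :
   ContinuousOn (fun τ => spA r c τ / spS r τ) (Icc (-1) 1) := by
  intro t ht
  exact ((spA_deriv r c t hr hr1 hc ht.1 ht.2).continuousAt.div (spS_deriv r t hr hr1).continuousAt
    (spS_pos r t hr hr1).ne').continuousWithinAt

lemma sp_subst (r : ℝ) (hr : 0 ≤ r) (hr1 : r < 1) (j : ℝ → ℝ → ℝ)
    (hj : Continuous (fun p : ℝ × ℝ => j p.1 p.2))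
    (hom : ∀ c α β, 0 ≤ c → j (c * α) (c * β) = c * j α β)
    (hev : ∀ α β, j (-α) β = j α β) :
    ∫ t in (-1:ℝ)..1, j (3 * t - r) (3 * √(1 - t ^ 2)) * (√(1 + r ^ 2 - 2 * r * t))⁻¹ =
      √3 / 3 * ∫ τ in (0:ℝ)..1, spM r τ * j τ (√(1 - τ ^ 2)) := by
  have hJc : Continuous (fun τ : ℝ => j τ (√(1 - τ ^ 2))) :=
    hj.comp (by fun_prop : Continuous fun τ : ℝ => (τ, √(1 - τ ^ 2)))
  set g : ℝ → ℝ := fun t => j (3 * t - r) (3 * √(1 - t ^ 2)) * (√(1 + r ^ 2 - 2 * r * t))⁻¹ with hg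
  set f : ℝ → ℝ := fun τ => (spL r (-r) τ * τ + r) / 3 with hf
  set f' : ℝ → ℝ := fun τ => spL r (-r) τ ^ 2 / (3 * spS r τ) with hf'
  have hu : uIcc (-1:ℝ) 1 = Icc (-1) 1 := uIcc_of_le (by norm_num)
  have hLK : ∀ τ, spL r (-r) τ ^ 2 + 2 * r * τ * spL r (-r) τ = 9 - r ^ 2 := by
    intro τ
    have := spS_sq r τ hr hr1
    unfold spL; nlinarith
  have hfd : ∀ τ, HasDerivAt f (f' τ) τ := by
    intro τ
    have hS := (spS_pos r τ hr hr1).ne'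
    refine ((((spL_deriv r (-r) τ hr hr1 (Or.inr rfl)).mul (hasDerivAt_id τ)).add_const r).div_const 3).congr_deriv ?_
    simp only [hf', id]
    field_simp
    unfold spL
    ring
  have hsS : ∀ t, 1 + r ^ 2 - 2 * r * f t = (spL r (-r) t ^ 2 - (6 - 2 * r ^ 2)) / 3 := by
    intro t
    simp only [hf]
    have := hLK t
    linarith
  have hsub := intervalIntegral.integral_comp_mul_deriv'' (a := -1) (b := 1) (f := f) (f' := f') (g := g)
    (fun t _ => (hfd t).continuousAt.continuousWithinAt)
    (fun t _ => (hfd t).hasDerivWithinAt)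
    (by
      intro t _
      have hS := (spS_pos r t hr hr1).ne'
      exact (((spL_deriv r (-r) t hr hr1 (Or.inr rfl)).continuousAt.pow 2).div
        (continuousAt_const.mul (spS_deriv r t hr hr1).continuousAt) (mul_ne_zero (by norm_num) hS)).continuousWithinAt)
    (by
      rintro _ ⟨t, ht, rfl⟩
      rw [hu] at ht
      have hpos : 0 < 1 + r ^ 2 - 2 * r * f t := by
        rw [hsS]
        have := spL_gap r (-r) t hr hr1 (Or.inr rfl) ht.1 ht.2
        positivity
      apply ContinuousAt.continuousWithinAt
      apply ContinuousAt.mul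
      · exact (hj.comp (by fun_prop : Continuous fun t : ℝ => (3 * t - r, 3 * √(1 - t ^ 2)))).continuousAt
      · apply ContinuousAt.inv₀
        · fun_prop
        · exact (Real.sqrt_pos.2 hpos).ne')
  have hS1 : ∀ t : ℝ, t ^ 2 = 1 → spS r t = 3 := by
    intro t ht
    unfold spS
    rw [ht, show (9 - r ^ 2 + r ^ 2 * 1) = 3 ^ 2 by ring, Real.sqrt_sq (by norm_num)]
  have hf1 : f 1 = 1 := by simp [hf, spL, hS1]
  have hfm1 : f (-1) = -1 := by simp [hf, spL, hS1]
  rw [hf1, hfm1] at hsub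
  rw [← hsub]
  have e1 : ∀ t ∈ uIcc (-1:ℝ) 1, (g ∘ f) t * f' t = √3 / 3 * (spA r (-r) t / spS r t * j t (√(1 - t ^ 2))) := by
    intro t ht
    rw [hu] at ht
    have hL := spL_ge r (-r) t hr hr1 (Or.inr rfl) ht.1 ht.2
    have hgap := spL_gap r (-r) t hr hr1 (Or.inr rfl) ht.1 ht.2
    have hL0 : 0 ≤ spL r (-r) t := by linarith
    have hS := spS_pos r t hr hr1
    simp only [Function.comp, hg]
    rw [hsS]
    have i1 : 3 * f t - r = spL r (-r) t * t := by simp only [hf]; ring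
    have i2 : 3 * √(1 - f t ^ 2) = spL r (-r) t * √(1 - t ^ 2) := by
      have : 1 - f t ^ 2 = (spL r (-r) t / 3) ^ 2 * (1 - t ^ 2) := by
        simp only [hf]; linear_combination (-1 / 9) * hLK t
      rw [this, Real.sqrt_mul (sq_nonneg _), Real.sqrt_sq (by positivity)]; ring
    rw [i1, i2, hom _ _ _ hL0, Real.sqrt_div hgap.le]
    simp only [hf', spA]
    have q1 := (Real.sqrt_pos.2 hgap).ne'
    have q3 : √3 ^ 2 = 3 := Real.sq_sqrt (by norm_num)
    field_simp
  rw [intervalIntegral.integral_congr e1, intervalIntegral.integral_const_mul]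
  congr 1
  have hJev : ∀ t, j (-t) (√(1 - (-t) ^ 2)) = j t (√(1 - t ^ 2)) := by
    intro t; rw [hev, neg_sq]
  have hint : ∀ c, (c = r ∨ c = -r) → ∀ a ∈ Icc (-1:ℝ) 1, ∀ b ∈ Icc (-1:ℝ) 1,
      IntervalIntegrable (fun t => spA r c t / spS r t * j t (√(1 - t ^ 2))) volume a b := by
    intro c hc a ha b hb
    apply ContinuousOn.intervalIntegrable
    apply ContinuousOn.mul _ hJc.continuousOn
    exact (spM_cont r hr hr1 c hc).mono ((convex_Icc (-1:ℝ) 1).ordConnected.uIcc_subset ha hb)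
  have hm1 : (-1:ℝ) ∈ Icc (-1:ℝ) 1 := by norm_num
  have h0 : (0:ℝ) ∈ Icc (-1:ℝ) 1 := by norm_num
  have hp1 : (1:ℝ) ∈ Icc (-1:ℝ) 1 := by norm_num
  rw [← intervalIntegral.integral_add_adjacent_intervals (hint (-r) (Or.inr rfl) _ hm1 _ h0)
    (hint (-r) (Or.inr rfl) _ h0 _ hp1)]
  have e2 : ∫ t in (-1:ℝ)..0, spA r (-r) t / spS r t * j t (√(1 - t ^ 2)) =
      ∫ t in (0:ℝ)..1, spA r r t / spS r t * j t (√(1 - t ^ 2)) := by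
    rw [show (-1:ℝ) = -1 from rfl]
    have := intervalIntegral.integral_comp_neg (a := 0) (b := 1)
      (fun t => spA r (-r) t / spS r t * j t (√(1 - t ^ 2)))
    rw [neg_zero] at this
    rw [← this]
    apply intervalIntegral.integral_congr
    intro t _
    simp only
    rw [hJev]
    have s1 : spS r (-t) = spS r t := by simp [spS]
    have s2 : spA r (-r) (-t) = spA r r t := by simp [spA, spL, s1]
    rw [s1, s2]
  rw [e2, ← intervalIntegral.integral_add (hint r (Or.inl rfl) _ h0 _ hp1) (hint (-r) (Or.inr rfl) _ h0 _ hp1)]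
  apply intervalIntegral.integral_congr
  intro t _
  simp only [spM]
  ring

lemma sp_cross (M J : ℝ → ℝ) (hM : MonotoneOn M (Icc 0 1)) (hMc : ContinuousOn M (Icc 0 1)) (hJ : Continuous J)
    (hJ0 : ∀ t, 0 ≤ J t)
    (hanti : ∀ a b, 0 < a → a ≤ b → b ≤ 1 → a * J b ≤ b * J a)
    (hint : ∫ t in (0:ℝ)..1, J t = Real.pi) :
    ∫ t in (0:ℝ)..1, M t * J t ≤ ∫ t in (0:ℝ)..1, M t * (2 * Real.pi * |t|) := by
  set A : Set ℝ := {t | t ∈ Icc (0:ℝ) 1 ∧ 2 * Real.pi * t ≤ J t} with hA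
  have hA0 : (0:ℝ) ∈ A := ⟨by norm_num, by simpa using hJ0 0⟩
  have hbdd : BddAbove A := ⟨1, fun t ht => ht.1.2⟩
  set T := sSup A with hT
  have hT0 : 0 ≤ T := le_csSup hbdd hA0
  have hT1 : T ≤ 1 := csSup_le ⟨0, hA0⟩ fun t ht => ht.1.2
  have hpt : ∀ t ∈ Icc (0:ℝ) 1, 0 ≤ (M t - M T) * (2 * Real.pi * |t| - J t) := by
    intro t ht
    rw [abs_of_nonneg ht.1]
    rcases lt_trichotomy t T with h | h | h
    · obtain ⟨b, hb, htb⟩ := exists_lt_of_lt_csSup ⟨0, hA0⟩ h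
      have h1 : 2 * Real.pi * t ≤ J t := by
        rcases ht.1.eq_or_lt with h0 | h0
        · rw [← h0]; simpa using hJ0 0
        · have h3 := hanti t b h0 htb.le hb.1.2
          have hb0 : 0 < b := h0.trans htb
          have h4 := mul_le_mul_of_nonneg_left hb.2 h0.le
          have : b * (2 * Real.pi * t) ≤ b * J t := by nlinarith
          exact le_of_mul_le_mul_left this hb0
      have h2 := hM ht ⟨hT0, hT1⟩ h.le
      nlinarith
    · rw [h]; simp
    · have h1 : J t < 2 * Real.pi * t := by
        by_contra hc
        push Not at hc
        exact absurd (le_csSup hbdd (show t ∈ A from ⟨ht, hc⟩)) (not_le.2 h)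
      have h2 := hM ⟨hT0, hT1⟩ ht h.le
      nlinarith
  have hu : uIcc (0:ℝ) 1 = Icc 0 1 := uIcc_of_le zero_le_one
  have i1 : IntervalIntegrable (fun t => M t * J t) volume 0 1 :=
    ContinuousOn.intervalIntegrable (by rw [hu]; exact hMc.mul hJ.continuousOn)
  have i2 : IntervalIntegrable (fun t => M t * (2 * Real.pi * |t|)) volume 0 1 :=
    ContinuousOn.intervalIntegrable (by rw [hu]; exact hMc.mul (by fun_prop))
  have i3 : IntervalIntegrable (fun t => J t) volume 0 1 := hJ.intervalIntegrable _ _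
  have i4 : IntervalIntegrable (fun t => (2 * Real.pi * |t|)) volume 0 1 :=
    Continuous.intervalIntegrable (by fun_prop) _ _
  have hnn : 0 ≤ ∫ t in (0:ℝ)..1, (M t - M T) * (2 * Real.pi * |t| - J t) :=
    intervalIntegral.integral_nonneg zero_le_one hpt
  have e : ∫ t in (0:ℝ)..1, (M t - M T) * (2 * Real.pi * |t| - J t) =
     (∫ t in (0:ℝ)..1, M t * (2 * Real.pi * |t|)) - (∫ t in (0:ℝ)..1, M t * J t)
      - M T * ((∫ t in (0:ℝ)..1, (2 * Real.pi * |t|)) - ∫ t in (0:ℝ)..1, J t) := by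
    rw [← intervalIntegral.integral_sub i4 i3, ← intervalIntegral.integral_sub i2 i1,
      ← intervalIntegral.integral_const_mul, ← intervalIntegral.integral_sub (i2.sub i1) ((i4.sub i3).const_mul _)]
    apply intervalIntegral.integral_congr
    intro t _
    simp only
    ring
  have e5 : ∫ t in (0:ℝ)..1, (2 * Real.pi * |t|) = Real.pi := by
    have : ∫ t in (0:ℝ)..1, (2 * Real.pi * |t|) = ∫ t in (0:ℝ)..1, (2 * Real.pi * t) := by
      apply intervalIntegral.integral_congr
      intro t ht
      rw [hu] at ht
      simp only [abs_of_nonneg ht.1]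
    rw [this, intervalIntegral.integral_const_mul, integral_id]; ring
  rw [e, e5, hint] at hnn
  linarith

noncomputable def spPhi (r : ℝ) : ℝ := (√(1 + r ^ 2 / 3) + 2) ^ 2 / (3 * (√(1 + r ^ 2 / 3) + 1))

lemma sp_N0 (r : ℝ) (hr : 0 ≤ r) (hr1 : r < 1) :
    ∫ t in (-1:ℝ)..1, |3 * t - r| * (√(1 + r ^ 2 - 2 * r * t))⁻¹ = 2 * spPhi r := by
  have hpos : ∀ t ∈ Icc (-1:ℝ) 1, 0 < 1 + r ^ 2 - 2 * r * t := by
    intro t ht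
    nlinarith [sq_pos_of_pos (sub_pos.2 hr1), mul_nonneg hr (sub_nonneg.2 ht.2)]
  have hcont : ∀ f : ℝ → ℝ, Continuous f → ContinuousOn (fun t => f t * (√(1 + r ^ 2 - 2 * r * t))⁻¹) (Icc (-1:ℝ) 1) := by
    intro f hf t ht
    apply ContinuousAt.continuousWithinAt
    apply hf.continuousAt.mul
    apply ContinuousAt.inv₀
    · fun_prop
    · exact (Real.sqrt_pos.2 (hpos t ht)).ne'
  have hint : ∀ f : ℝ → ℝ, Continuous f → ∀ a ∈ Icc (-1:ℝ) 1, ∀ b ∈ Icc (-1:ℝ) 1,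
      IntervalIntegrable (fun t => f t * (√(1 + r ^ 2 - 2 * r * t))⁻¹) volume a b := by
    intro f hf a ha b hb
    apply ContinuousOn.intervalIntegrable
    exact (hcont f hf).mono ((convex_Icc (-1:ℝ) 1).ordConnected.uIcc_subset ha hb)
  have hm1 : (-1:ℝ) ∈ Icc (-1:ℝ) 1 := by norm_num
  have h0 : r / 3 ∈ Icc (-1:ℝ) 1 := ⟨by linarith, by linarith⟩
  have hp1 : (1:ℝ) ∈ Icc (-1:ℝ) 1 := by norm_num
  have hc : Continuous fun t : ℝ => |3 * t - r| := by fun_prop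
  have hc2 : Continuous fun t : ℝ => 3 * t - r := by fun_prop
  rw [← intervalIntegral.integral_add_adjacent_intervals (hint _ hc _ hm1 _ h0) (hint _ hc _ h0 _ hp1)]
  have e1 : ∫ t in (-1:ℝ)..(r/3), |3 * t - r| * (√(1 + r ^ 2 - 2 * r * t))⁻¹ =
     - ∫ t in (-1:ℝ)..(r/3), (3 * t - r) * (√(1 + r ^ 2 - 2 * r * t))⁻¹ := by
    rw [← intervalIntegral.integral_neg]
    apply intervalIntegral.integral_congr
    intro t ht
    rw [uIcc_of_le h0.1] at ht
    simp only
    rw [abs_of_nonpos (by linarith [ht.2])]; ring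
  have e2 : ∫ t in (r/3)..1, |3 * t - r| * (√(1 + r ^ 2 - 2 * r * t))⁻¹ =
     ∫ t in (r/3)..1, (3 * t - r) * (√(1 + r ^ 2 - 2 * r * t))⁻¹ := by
    apply intervalIntegral.integral_congr
    intro t ht
    rw [uIcc_of_le h0.2] at ht
    simp only
    rw [abs_of_nonneg (by linarith [ht.1])]
  rw [e1, e2]
  rcases hr.eq_or_lt with h | h
  · subst h
    simp [spPhi]
    rw [intervalIntegral.integral_const_mul, intervalIntegral.integral_const_mul, integral_id, integral_id]
    norm_num
  · have hG : ∀ t ∈ Icc (-1:ℝ) 1, HasDerivAt (fun t => - (√(1 + r ^ 2 - 2 * r * t) * (r * t + 1)) / r ^ 2)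
        ((3 * t - r) * (√(1 + r ^ 2 - 2 * r * t))⁻¹) t := by
      intro t ht
      have hp := hpos t ht
      have hq := (Real.sqrt_pos.2 hp).ne'
      have d1 : HasDerivAt (fun t => 1 + r ^ 2 - 2 * r * t) (- (2 * r)) t := by
        simpa using ((hasDerivAt_id t).const_mul (2 * r)).const_sub (1 + r ^ 2)
      have d2 : HasDerivAt (fun t => r * t + 1) r t := by
        simpa using ((hasDerivAt_id t).const_mul r).add_const 1
      refine ((((d1.sqrt hp.ne').mul d2).neg).div_const (r ^ 2)).congr_deriv ?_
      have hs := Real.sq_sqrt hp.le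
      field_simp
      rw [hs]
      ring
    have hI : ∀ a ∈ Icc (-1:ℝ) 1, ∀ b ∈ Icc (-1:ℝ) 1,
        ∫ t in a..b, (3 * t - r) * (√(1 + r ^ 2 - 2 * r * t))⁻¹ =
        - (√(1 + r ^ 2 - 2 * r * b) * (r * b + 1)) / r ^ 2 - - (√(1 + r ^ 2 - 2 * r * a) * (r * a + 1)) / r ^ 2 := by
      intro a ha b hb
      apply intervalIntegral.integral_eq_sub_of_hasDerivAt
      · intro t ht
        exact hG t ((convex_Icc (-1:ℝ) 1).ordConnected.uIcc_subset ha hb ht)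
      · exact hint _ hc2 _ ha _ hb
    rw [hI _ hm1 _ h0, hI _ h0 _ hp1]
    have w1 : √(1 + r ^ 2 - 2 * r * 1) = 1 - r := by
      rw [show 1 + r ^ 2 - 2 * r * 1 = (1 - r) ^ 2 by ring, Real.sqrt_sq (by linarith)]
    have w2 : √(1 + r ^ 2 - 2 * r * (-1)) = 1 + r := by
      rw [show 1 + r ^ 2 - 2 * r * (-1) = (1 + r) ^ 2 by ring, Real.sqrt_sq (by linarith)]
    have w3 : √(1 + r ^ 2 - 2 * r * (r / 3)) = √(1 + r ^ 2 / 3) := by congr 1; ring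
    rw [w1, w2, w3]
    unfold spPhi
    have hp2 : √(1 + r ^ 2 / 3) ^ 2 = 1 + r ^ 2 / 3 := Real.sq_sqrt (by positivity)
    set p := √(1 + r ^ 2 / 3) with hp
    have hpp : 0 ≤ p := Real.sqrt_nonneg _
    have hr2 : r ^ 2 = 3 * (p ^ 2 - 1) := by rw [hp2]; ring
    have hr0 : r ^ 2 ≠ 0 := by positivity
    have hp1 : p ^ 2 - 1 ≠ 0 := by intro hh; rw [hh] at hr2; simp at hr2; exact h.ne' hr2
    have hp3 : p + 1 ≠ 0 := by positivity
    have lhs : -(-(p * (r * (r / 3) + 1)) / r ^ 2 - -((1 + r) * (r * -1 + 1)) / r ^ 2) +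
      (-((1 - r) * (r * 1 + 1)) / r ^ 2 - -(p * (r * (r / 3) + 1)) / r ^ 2) = 
      2 * (p * (1 + r ^ 2 / 3) - (1 - r ^ 2)) / r ^ 2 := by ring
    rw [lhs, ← hp2, hr2]
    field_simp
    ring

lemma spPhi_mono (a b : ℝ) (ha : 0 ≤ a) (hab : a ≤ b) : spPhi a ≤ spPhi b := by
  unfold spPhi
  have h1 : √(1 + a ^ 2 / 3) ≤ √(1 + b ^ 2 / 3) := by gcongr
  have h2 : 0 ≤ √(1 + a ^ 2 / 3) := by positivity
  set p := √(1 + a ^ 2 / 3)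
  set q := √(1 + b ^ 2 / 3)
  have h3 : 0 ≤ q := h2.trans h1
  rw [div_le_div_iff₀ (by positivity) (by positivity)]
  nlinarith [mul_nonneg (mul_nonneg h2 h3) (sub_nonneg.2 h1), mul_nonneg (add_nonneg h2 h3) (sub_nonneg.2 h1)]

lemma spPhi_nonneg (a : ℝ) : 0 ≤ spPhi a := by unfold spPhi; positivity

lemma spPhi_lt (r : ℝ) (hr : 0 ≤ r) (hr1 : r < 1) : spPhi r < 8 / (3 * √3) := by
  have h3 : √3 ^ 2 = 3 := Real.sq_sqrt (by norm_num)
  have h3p : 0 < √3 := by positivity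
  have hq : √(1 + r ^ 2 / 3) < 2 / √3 := by
    rw [Real.sqrt_lt' (by positivity), div_pow, h3]
    nlinarith
  have h2 : 1 ≤ √(1 + r ^ 2 / 3) := by
    rw [Real.one_le_sqrt]; nlinarith [sq_nonneg r]
  unfold spPhi
  set p := √(1 + r ^ 2 / 3)
  have e : 8 / (3 * √3) = (2 / √3 + 2) ^ 2 / (3 * (2 / √3 + 1)) := by
    rw [div_eq_div_iff (by positivity) (by positivity)]
    field_simp
    nlinarith
  rw [e]
  set q := 2 / √3
  have hq0 : 0 < q := by positivity
  rw [div_lt_div_iff₀ (by positivity) (by positivity)]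
  have h2' : 0 ≤ p := by linarith
  nlinarith [mul_nonneg (mul_nonneg h2' hq0.le) (sub_nonneg.2 hq.le), mul_pos (by linarith : 0 < p + q) (sub_pos.2 hq)]

noncomputable def spj (e1 e2 e3 α β : ℝ) : ℝ :=
  ∫ φ in (-Real.pi)..Real.pi, max |e3 * α| |β * (e1 * Real.cos φ + e2 * Real.sin φ)|

lemma spj_eq (e1 e2 e3 α β : ℝ) :
    ∫ φ in (-Real.pi)..Real.pi, |e3 * α + β * (e1 * Real.cos φ + e2 * Real.sin φ)| = spj e1 e2 e3 α β := by
  set f : ℝ → ℝ := fun φ => |e3 * α + β * (e1 * Real.cos φ + e2 * Real.sin φ)| with hf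
  have hper : Function.Periodic f (2 * Real.pi) := by
    intro φ; simp [hf]
  have hfc : Continuous f := by fun_prop
  have h1 : ∫ φ in (-Real.pi)..Real.pi, f (φ + Real.pi) = ∫ φ in (-Real.pi)..Real.pi, f φ := by
    rw [intervalIntegral.integral_comp_add_right]
    have := hper.intervalIntegral_add_eq 0 (-Real.pi)
    rw [show -Real.pi + Real.pi = 0 by ring, show Real.pi + Real.pi = 0 + 2 * Real.pi by ring, this]
    congr 1; ring
  have h2 : ∫ φ in (-Real.pi)..Real.pi, (f φ + f (φ + Real.pi)) = 2 * spj e1 e2 e3 α β := by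
    unfold spj
    rw [← intervalIntegral.integral_const_mul]
    apply intervalIntegral.integral_congr
    intro φ _
    simp only [hf, Real.cos_add_pi, Real.sin_add_pi]
    rw [show e1 * -Real.cos φ + e2 * -Real.sin φ = -(e1 * Real.cos φ + e2 * Real.sin φ) by ring]
    set X := β * (e1 * Real.cos φ + e2 * Real.sin φ) with hX
    rw [show β * -(e1 * Real.cos φ + e2 * Real.sin φ) = - X by rw [hX]; ring]
    set Y := e3 * α
    rcases le_total |Y| |X| with h | h
    · rw [max_eq_right h]
      rcases abs_cases X with hX | hX <;> rcases abs_cases Y with hY | hY <;>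
      rcases abs_cases (Y + X) with h3 | h3 <;> rcases abs_cases (Y + -X) with h4 | h4 <;> linarith
    · rw [max_eq_left h]
      rcases abs_cases X with hX | hX <;> rcases abs_cases Y with hY | hY <;>
      rcases abs_cases (Y + X) with h3 | h3 <;> rcases abs_cases (Y + -X) with h4 | h4 <;> linarith
  have hfc2 : Continuous fun φ : ℝ => f (φ + Real.pi) := hfc.comp (by fun_prop)
  rw [intervalIntegral.integral_add (hfc.intervalIntegrable _ _) (hfc2.intervalIntegrable _ _), h1] at h2
  linarith

lemma spj_cont (e1 e2 e3 : ℝ) : Continuous (fun p : ℝ × ℝ => spj e1 e2 e3 p.1 p.2) := by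
  unfold spj
  apply intervalIntegral.continuous_parametric_intervalIntegral_of_continuous'
  simp only [Function.uncurry_def]
  fun_prop

lemma spj_hom (e1 e2 e3 c α β : ℝ) (hc : 0 ≤ c) : spj e1 e2 e3 (c * α) (c * β) = c * spj e1 e2 e3 α β := by
  unfold spj
  rw [← intervalIntegral.integral_const_mul]
  apply intervalIntegral.integral_congr
  intro φ _
  simp only
  rw [show e3 * (c * α) = c * (e3 * α) by ring, mul_assoc c β, abs_mul c, abs_mul c, abs_of_nonneg hc,
    mul_max_of_nonneg _ _ hc]

lemma spj_even (e1 e2 e3 α β : ℝ) : spj e1 e2 e3 (-α) β = spj e1 e2 e3 α β := by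
  simp [spj]

lemma spj_mono (e1 e2 e3 α β β' : ℝ) (hb : 0 ≤ β) (h : β ≤ β') : spj e1 e2 e3 α β ≤ spj e1 e2 e3 α β' := by
  unfold spj
  apply intervalIntegral.integral_mono_on (by linarith [Real.pi_pos])
  · apply Continuous.intervalIntegrable; fun_prop
  · apply Continuous.intervalIntegrable; fun_prop
  · intro φ _
    apply max_le_max le_rfl
    rw [abs_mul, abs_mul, abs_of_nonneg hb, abs_of_nonneg (hb.trans h)]
    gcongr

lemma spj_nonneg (e1 e2 e3 α β : ℝ) : 0 ≤ spj e1 e2 e3 α β := by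
  unfold spj
  apply intervalIntegral.integral_nonneg (by linarith [Real.pi_pos])
  intro φ _
  positivity

lemma sp_angular (e1 e2 e3 r : ℝ) (hr : 0 ≤ r) (hr1 : r < 1)
    (hint : ∫ t in (-1:ℝ)..1, spj e1 e2 e3 t (√(1 - t ^ 2)) = 2 * Real.pi) :
    ∫ t in (-1:ℝ)..1, (∫ φ in (-Real.pi)..Real.pi,
      |3 * (e3 * t + √(1 - t ^ 2) * (e1 * Real.cos φ + e2 * Real.sin φ)) - r * e3|) *
      (√(1 + r ^ 2 - 2 * r * t))⁻¹ ≤ 4 * Real.pi * spPhi r := by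
  have hJc : Continuous (fun τ : ℝ => spj e1 e2 e3 τ (√(1 - τ ^ 2))) :=
    (spj_cont e1 e2 e3).comp (by fun_prop : Continuous fun τ : ℝ => (τ, √(1 - τ ^ 2)))
  have hhalf : ∫ t in (0:ℝ)..1, spj e1 e2 e3 t (√(1 - t ^ 2)) = Real.pi := by
    rw [← intervalIntegral.integral_add_adjacent_intervals (hJc.intervalIntegrable (-1) 0)
      (hJc.intervalIntegrable 0 1)] at hint
    have := intervalIntegral.integral_comp_neg (a := 0) (b := 1) (fun t => spj e1 e2 e3 t (√(1 - t ^ 2)))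
    simp only [spj_even, neg_sq, neg_zero] at this
    linarith
  have e0 : ∀ t, (∫ φ in (-Real.pi)..Real.pi,
      |3 * (e3 * t + √(1 - t ^ 2) * (e1 * Real.cos φ + e2 * Real.sin φ)) - r * e3|) =
      spj e1 e2 e3 (3 * t - r) (3 * √(1 - t ^ 2)) := by
    intro t
    rw [← spj_eq]
    congr 1
    ext φ
    congr 1; ring
  simp_rw [e0]
  rw [sp_subst r hr hr1 (spj e1 e2 e3) (spj_cont e1 e2 e3) (fun c α β hc => spj_hom e1 e2 e3 c α β hc)
    (spj_even e1 e2 e3)]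
  have h2 := sp_subst r hr hr1 (fun α _ => 2 * Real.pi * |α|) (by fun_prop)
    (fun c α _ hc => by rw [abs_mul, abs_of_nonneg hc]; ring) (fun α _ => by rw [abs_neg])
  have h3 : ∫ t in (-1:ℝ)..1, 2 * Real.pi * |3 * t - r| * (√(1 + r ^ 2 - 2 * r * t))⁻¹ = 4 * Real.pi * spPhi r := by
    have := sp_N0 r hr hr1
    simp_rw [mul_assoc (2 * Real.pi)]
    rw [intervalIntegral.integral_const_mul, this]; ring
  rw [← h3, h2]
  apply mul_le_mul_of_nonneg_left _ (by positivity)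
  apply sp_cross _ (fun τ => spj e1 e2 e3 τ (√(1 - τ ^ 2))) (spM_mono r hr hr1) _ hJc (fun t => spj_nonneg _ _ _ _ _) _ hhalf
  · have hsub : Icc (0:ℝ) 1 ⊆ Icc (-1) 1 := Icc_subset_Icc_left (by norm_num)
    have := ((spM_cont r hr hr1 r (Or.inl rfl)).mono hsub).add ((spM_cont r hr hr1 (-r) (Or.inr rfl)).mono hsub)
    apply this.congr
    intro t _
    simp only [spM, Pi.add_apply]
    ring
  · intro a b ha hab hb
    have hb0 : 0 ≤ b := ha.le.trans hab
    rw [← spj_hom _ _ _ _ _ _ ha.le, ← spj_hom _ _ _ _ _ _ hb0, mul_comm b a]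
    apply spj_mono
    · positivity
    · rw [← Real.sqrt_sq ha.le, ← Real.sqrt_sq hb0, ← Real.sqrt_mul (sq_nonneg _), ← Real.sqrt_mul (sq_nonneg _),
        Real.sqrt_sq ha.le, Real.sqrt_sq hb0]
      apply Real.sqrt_le_sqrt
      nlinarith

end PartFour

section PartThree
open MeasureTheory Set Filter Topology ENNReal

lemma sp_split (g : E3 → ℝ≥0∞) (hg : Measurable g) :
    ∫⁻ y, g y = ∫⁻ q : ℝ × (ℝ × ℝ), g (!₂[q.2.1, q.2.2, q.1] : E3) := by
  have m1 := (volume_preserving_piFinSuccAbove (fun _ : Fin 3 => ℝ) 2).symm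
  have m2 := (volume_preserving_finTwoArrow ℝ).symm
  have m3 := (MeasurePreserving.id (volume : Measure ℝ)).prod m2
  have m4 := (PiLp.volume_preserving_toLp (Fin 3)).comp (m1.comp m3)
  rw [← m4.lintegral_comp hg]
  congr 1
  ext q
  congr 1
  ext i
  fin_cases i <;> rfl

lemma sp_polar (f : ℝ → ℝ → ℝ≥0∞) (hf : Measurable (fun p : ℝ × ℝ => f p.1 p.2)) :
    ∫⁻ p : ℝ × ℝ, f p.1 p.2 = ∫⁻ s in Ioi (0:ℝ), ∫⁻ φ in Ioo (-Real.pi) Real.pi,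
      ENNReal.ofReal s * f (s * Real.cos φ) (s * Real.sin φ) := by
  rw [← lintegral_comp_polarCoord_symm (fun p => f p.1 p.2)]
  simp only [polarCoord_target, polarCoord_symm_apply, smul_eq_mul]
  rw [Measure.volume_eq_prod, ← Measure.prod_restrict, lintegral_prod]
  apply Measurable.aemeasurable
  apply Measurable.mul (by fun_prop)
  exact hf.comp (by fun_prop : Measurable fun p : ℝ × ℝ => (p.1 * Real.cos p.2, p.1 * Real.sin p.2))

lemma sp_cos_sub (G : ℝ → ℝ → ℝ≥0∞) :
    ∫⁻ θ in Ioo (-Real.pi) Real.pi, ENNReal.ofReal (Real.sin θ) * G (Real.sin θ) (Real.cos θ) =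
      ∫⁻ t in Ioo (-1:ℝ) 1, G (√(1 - t ^ 2)) t := by
  have himg : Set.image Real.cos (Ioo 0 Real.pi) = Ioo (-1) 1 := by
    apply Subset.antisymm
    · exact Real.mapsTo_cos_Ioo.image_subset
    · intro t ht
      refine ⟨Real.arccos t, ⟨Real.arccos_pos.2 ht.2, ?_⟩, Real.cos_arccos ht.1.le ht.2.le⟩
      apply lt_of_le_of_ne (Real.arccos_le_pi t)
      intro h
      rw [Real.arccos_eq_pi] at h
      linarith [ht.1]
  rw [← himg, lintegral_image_eq_lintegral_abs_deriv_mul (f' := fun θ => - Real.sin θ) measurableSet_Ioo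
    (fun θ _ => (Real.hasDerivAt_cos θ).hasDerivWithinAt) (Real.injOn_cos.mono Ioo_subset_Icc_self)]
  have h1 : ∫⁻ θ in Ioo (-Real.pi) Real.pi, ENNReal.ofReal (Real.sin θ) * G (Real.sin θ) (Real.cos θ)
     = ∫⁻ θ in Ioo 0 Real.pi, ENNReal.ofReal (Real.sin θ) * G (Real.sin θ) (Real.cos θ) := by
    rw [← lintegral_indicator measurableSet_Ioo, ← lintegral_indicator measurableSet_Ioo]
    congr 1
    ext θ
    by_cases h : θ ∈ Ioo 0 Real.pi
    · rw [indicator_of_mem h, indicator_of_mem (show θ ∈ Ioo (-Real.pi) Real.pi from ⟨by linarith [h.1, Real.pi_pos], h.2⟩)]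
    · rw [indicator_of_notMem h]
      by_cases h' : θ ∈ Ioo (-Real.pi) Real.pi
      · rw [indicator_of_mem h']
        have : θ ≤ 0 := by
          by_contra hc; push Not at hc; exact h ⟨hc, h'.2⟩
        rw [ENNReal.ofReal_of_nonpos (Real.sin_nonpos_of_nonpos_of_neg_pi_le this h'.1.le), zero_mul]
      · rw [indicator_of_notMem h']
  rw [h1]
  apply setLIntegral_congr_fun measurableSet_Ioo
  intro θ hθ
  have hs := Real.sin_pos_of_mem_Ioo hθ
  simp only
  rw [abs_neg, abs_of_pos hs, ← Real.abs_sin_eq_sqrt_one_sub_cos_sq, abs_of_pos hs]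

lemma sp_sph (g : E3 → ℝ≥0∞) (hg : Measurable g) :
    ∫⁻ y, g y = ∫⁻ s in Ioi (0:ℝ), ENNReal.ofReal (s ^ 2) * ∫⁻ t in Ioo (-1:ℝ) 1,
      ∫⁻ φ in Ioo (-Real.pi) Real.pi,
        g (!₂[s * √(1 - t ^ 2) * Real.cos φ, s * √(1 - t ^ 2) * Real.sin φ, s * t] : E3) := by
  have hm : Measurable fun q : ℝ × ℝ × ℝ => (!₂[q.2.1, q.2.2, q.1] : E3) := by
    apply Continuous.measurable
    apply (PiLp.continuous_toLp 2 _).comp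
    apply continuous_pi
    intro i
    fin_cases i <;> simp <;> fun_prop
  have hgm : Measurable fun q : ℝ × ℝ × ℝ => g (!₂[q.2.1, q.2.2, q.1] : E3) := hg.comp hm
  set K : ℝ → ℝ → ℝ≥0∞ := fun ρ z => ∫⁻ φ in Ioo (-Real.pi) Real.pi,
    g (!₂[ρ * Real.cos φ, ρ * Real.sin φ, z] : E3) with hK
  have hKm : Measurable fun p : ℝ × ℝ => K p.2 p.1 := by
    apply Measurable.lintegral_prod_right' (f := fun q : (ℝ × ℝ) × ℝ =>
      g (!₂[q.1.2 * Real.cos q.2, q.1.2 * Real.sin q.2, q.1.1] : E3))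
    exact hgm.comp (by fun_prop : Measurable fun q : (ℝ × ℝ) × ℝ => (q.1.1, q.1.2 * Real.cos q.2, q.1.2 * Real.sin q.2))
  rw [sp_split g hg, Measure.volume_eq_prod, lintegral_prod _ hgm.aemeasurable]
  have e1 : ∀ z : ℝ, ∫⁻ p : ℝ × ℝ, g (!₂[p.1, p.2, z] : E3) = ∫⁻ ρ : ℝ, ENNReal.ofReal ρ * K ρ z := by
    intro z
    rw [sp_polar (fun a b => g (!₂[a, b, z] : E3)) (hgm.comp (by fun_prop : Measurable fun p : ℝ × ℝ => (z, p.1, p.2)))]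
    rw [← lintegral_indicator measurableSet_Ioi]
    congr 1
    ext ρ
    by_cases h : ρ ∈ Ioi (0:ℝ)
    · rw [indicator_of_mem h, lintegral_const_mul]
      exact hgm.comp (by fun_prop : Measurable fun φ : ℝ => (z, ρ * Real.cos φ, ρ * Real.sin φ))
    · rw [indicator_of_notMem h, ENNReal.ofReal_of_nonpos (by simpa using h), zero_mul]
  simp_rw [e1]
  have hKm2 : Measurable fun p : ℝ × ℝ => ENNReal.ofReal p.2 * K p.2 p.1 := by
    apply Measurable.mul (by fun_prop) hKm
  rw [← lintegral_prod (μ := volume) (ν := volume) _ hKm2.aemeasurable, ← Measure.volume_eq_prod,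
    sp_polar (fun a b => ENNReal.ofReal b * K b a) hKm2]
  apply setLIntegral_congr_fun measurableSet_Ioi
  intro s hs
  have hs0 : 0 < s := hs
  simp only
  rw [← sp_cos_sub (fun a b => ∫⁻ φ in Ioo (-Real.pi) Real.pi,
        g (!₂[s * a * Real.cos φ, s * a * Real.sin φ, s * b] : E3)), ← lintegral_const_mul']
  · congr 1
    ext θ
    rw [ENNReal.ofReal_mul hs0.le, ENNReal.ofReal_pow hs0.le]
    simp only [hK]
    ring
  · exact ENNReal.ofReal_ne_top

/-- angular comparison -/
lemma sp_rot (x y : E3) (h : ‖x‖ = ‖y‖) : ∃ L : E3 ≃ₗᵢ[ℝ] E3, L x = y :=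
  ⟨(ℝ ∙ (x - y))ᗮ.reflection, Submodule.reflection_sub h⟩

lemma sp_lint_Ioo (f : ℝ → ℝ) (a b : ℝ) (hab : a ≤ b) (hf : ContinuousOn f (Icc a b)) (h0 : ∀ t ∈ Icc a b, 0 ≤ f t) :
    ∫⁻ t in Ioo a b, ENNReal.ofReal (f t) = ENNReal.ofReal (∫ t in a..b, f t) := by
  rw [intervalIntegral.integral_of_le hab, ← integral_Icc_eq_integral_Ioc, integral_Icc_eq_integral_Ioo,
    ofReal_integral_eq_lintegral_ofReal]
  · exact (hf.integrableOn_Icc.mono_set Ioo_subset_Icc_self)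
  · rw [EventuallyLE, ae_restrict_iff' measurableSet_Ioo]
    filter_upwards with t ht using h0 t (Ioo_subset_Icc_self ht)

lemma sp_lint2 (f : ℝ → ℝ → ℝ) (hf : ∀ t ∈ Icc (-1:ℝ) 1, Continuous (f t)) (h0 : ∀ t φ, 0 ≤ f t φ)
    (hc : ContinuousOn (fun t => ∫ φ in (-Real.pi)..Real.pi, f t φ) (Icc (-1) 1)) :
    ∫⁻ t in Ioo (-1:ℝ) 1, ∫⁻ φ in Ioo (-Real.pi) Real.pi, ENNReal.ofReal (f t φ) =
      ENNReal.ofReal (∫ t in (-1:ℝ)..1, ∫ φ in (-Real.pi)..Real.pi, f t φ) := by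
  have hpi : -Real.pi ≤ Real.pi := by linarith [Real.pi_pos]
  rw [← sp_lint_Ioo _ (-1) 1 (by norm_num) hc (fun t _ => intervalIntegral.integral_nonneg hpi fun φ _ => h0 t φ)]
  apply setLIntegral_congr_fun measurableSet_Ioo
  intro t ht
  exact sp_lint_Ioo _ _ _ hpi (hf t (Ioo_subset_Icc_self ht)).continuousOn fun φ _ => h0 t φ

noncomputable def spQ (s t φ : ℝ) : E3 :=
  !₂[s * √(1 - t ^ 2) * Real.cos φ, s * √(1 - t ^ 2) * Real.sin φ, s * t]

lemma spQ_norm (s t φ : ℝ) (ht : t ∈ Icc (-1:ℝ) 1) : ‖spQ s t φ‖ ^ 2 = s ^ 2 := by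
  have h : √(1 - t ^ 2) ^ 2 = 1 - t ^ 2 := Real.sq_sqrt (by nlinarith [ht.1, ht.2])
  have h2 := Real.sin_sq_add_cos_sq φ
  rw [sp_nsq]
  simp [spQ]
  linear_combination s ^ 2 * √(1 - t ^ 2) ^ 2 * h2 + s ^ 2 * h

lemma spQ_norm' (s t φ : ℝ) (ht : t ∈ Icc (-1:ℝ) 1) (hs : 0 ≤ s) : ‖spQ s t φ‖ = s := by
  have := spQ_norm s t φ ht
  rwa [sq_eq_sq₀ (norm_nonneg _) hs] at this

lemma spQ_inner (s t φ : ℝ) (e : E3) :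
    inner ℝ (spQ s t φ) e = s * (e 2 * t + √(1 - t ^ 2) * (e 0 * Real.cos φ + e 1 * Real.sin φ)) := by
  rw [sp_inner]
  simp [spQ]
  ring

lemma sp_sphQ (g : E3 → ℝ≥0∞) (hg : Measurable g) :
    ∫⁻ y, g y = ∫⁻ s in Ioi (0:ℝ), ENNReal.ofReal (s ^ 2) * ∫⁻ t in Ioo (-1:ℝ) 1,
      ∫⁻ φ in Ioo (-Real.pi) Real.pi, g (spQ s t φ) := sp_sph g hg

lemma sp_Jlint (e : E3) : ∫⁻ t in Ioo (-1:ℝ) 1, ∫⁻ φ in Ioo (-Real.pi) Real.pi,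
    ENNReal.ofReal |e 2 * t + √(1 - t ^ 2) * (e 0 * Real.cos φ + e 1 * Real.sin φ)| =
    ENNReal.ofReal (∫ t in (-1:ℝ)..1, spj (e 0) (e 1) (e 2) t (√(1 - t ^ 2))) := by
  rw [sp_lint2]
  · simp_rw [spj_eq]
  · intro t _; fun_prop
  · intro t φ; positivity
  · simp_rw [spj_eq]
    exact ((spj_cont (e 0) (e 1) (e 2)).comp (by fun_prop : Continuous fun τ : ℝ => (τ, √(1 - τ ^ 2)))).continuousOn

lemma sp_Jball (e : E3) : ∫⁻ y : E3, (Metric.ball (0:E3) 1).indicator (fun y => ENNReal.ofReal |inner ℝ y e|) y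
    = ENNReal.ofReal (1 / 4) * ENNReal.ofReal (∫ t in (-1:ℝ)..1, spj (e 0) (e 1) (e 2) t (√(1 - t ^ 2))) := by
  rw [sp_sphQ]
  · rw [← sp_Jlint]
    have e1 : ∫⁻ s in Ioi (0:ℝ), ENNReal.ofReal (s ^ 2) * ∫⁻ t in Ioo (-1:ℝ) 1, ∫⁻ φ in Ioo (-Real.pi) Real.pi,
       (Metric.ball (0:E3) 1).indicator (fun y => ENNReal.ofReal |inner ℝ y e|) (spQ s t φ) =
      ∫⁻ s in Ioi (0:ℝ), (Ioo (0:ℝ) 1).indicator (fun s => ENNReal.ofReal (s ^ 3)) s * ∫⁻ t in Ioo (-1:ℝ) 1, ∫⁻ φ in Ioo (-Real.pi) Real.pi,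
    ENNReal.ofReal |e 2 * t + √(1 - t ^ 2) * (e 0 * Real.cos φ + e 1 * Real.sin φ)| := by
      apply setLIntegral_congr_fun measurableSet_Ioi
      intro s hs
      have hs0 : 0 < s := hs
      simp only
      by_cases h1 : s < 1
      · rw [indicator_of_mem (show s ∈ Ioo (0:ℝ) 1 from ⟨hs0, h1⟩), pow_succ s 2, ENNReal.ofReal_mul (by positivity), mul_assoc]
        congr 1
        rw [← lintegral_const_mul' _ _ ENNReal.ofReal_ne_top]
        apply setLIntegral_congr_fun measurableSet_Ioo
        intro t ht
        simp only
        rw [← lintegral_const_mul' _ _ ENNReal.ofReal_ne_top]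
        congr 1
        ext φ
        have hn := spQ_norm' s t φ (Ioo_subset_Icc_self ht) hs0.le
        rw [indicator_of_mem (by simpa [hn] using h1), spQ_inner, abs_mul, abs_of_pos hs0, ENNReal.ofReal_mul hs0.le]
      · rw [indicator_of_notMem (fun h : s ∈ Ioo (0:ℝ) 1 => h1 h.2), zero_mul]
        have : ∫⁻ t in Ioo (-1:ℝ) 1, ∫⁻ φ in Ioo (-Real.pi) Real.pi,
          (Metric.ball (0:E3) 1).indicator (fun y => ENNReal.ofReal |inner ℝ y e|) (spQ s t φ) = 
          ∫⁻ t in Ioo (-1:ℝ) 1, ∫⁻ φ in Ioo (-Real.pi) Real.pi, 0 := by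
          apply setLIntegral_congr_fun measurableSet_Ioo
          intro t ht
          simp only
          congr 1
          ext φ
          have hn := spQ_norm' s t φ (Ioo_subset_Icc_self ht) hs0.le
          rw [indicator_of_notMem (by simpa [hn] using h1)]
        rw [this]; simp
    rw [e1, lintegral_mul_const]
    · congr 1
      rw [lintegral_indicator measurableSet_Ioo, Measure.restrict_restrict measurableSet_Ioo,
        inter_eq_self_of_subset_left (show Ioo (0:ℝ) 1 ⊆ Ioi 0 from fun s hs => hs.1),
        sp_lint_Ioo _ 0 1 (by norm_num) (by fun_prop) (fun t ht => by have := ht.1; positivity)]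
      congr 1
      rw [integral_pow]
      norm_num
    · exact Measurable.indicator (by fun_prop) measurableSet_Ioo
  · apply Measurable.indicator _ measurableSet_ball
    apply Continuous.measurable
    exact ENNReal.continuous_ofReal.comp (by fun_prop)

lemma sp_Jtotal (e : E3) (he : ‖e‖ = 1) :
    ∫ t in (-1:ℝ)..1, spj (e 0) (e 1) (e 2) t (√(1 - t ^ 2)) = 2 * Real.pi := by
  set e3 : E3 := EuclideanSpace.single 2 1 with he3
  obtain ⟨L, hL⟩ := sp_rot e e3 (by simp [he, he3])
  have hI : ∫⁻ y : E3, (Metric.ball (0:E3) 1).indicator (fun y => ENNReal.ofReal |inner ℝ y e|) y =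
     ∫⁻ y : E3, (Metric.ball (0:E3) 1).indicator (fun y => ENNReal.ofReal |inner ℝ y e3|) y := by
    rw [← L.measurePreserving.lintegral_comp (f := (Metric.ball (0:E3) 1).indicator (fun y => ENNReal.ofReal |inner ℝ y e3|))]
    · congr 1
      ext y
      by_cases hy : y ∈ Metric.ball (0:E3) 1
      · rw [indicator_of_mem hy, indicator_of_mem (by simpa using hy), ← hL, L.inner_map_map]
      · rw [indicator_of_notMem hy, indicator_of_notMem (by simpa using hy)]
    · apply Measurable.indicator _ measurableSet_ball
      apply Continuous.measurable
      exact ENNReal.continuous_ofReal.comp (by fun_prop)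
  rw [sp_Jball, sp_Jball] at hI
  have h4 : ENNReal.ofReal (1/4) ≠ 0 := by simp
  have hI2 := (ENNReal.mul_right_inj h4 ENNReal.ofReal_ne_top).1 hI
  have hnn : ∀ e : E3, 0 ≤ ∫ t in (-1:ℝ)..1, spj (e 0) (e 1) (e 2) t (√(1 - t ^ 2)) := fun e =>
    intervalIntegral.integral_nonneg (by norm_num) fun t _ => spj_nonneg _ _ _ _ _
  rw [ENNReal.ofReal_eq_ofReal_iff (hnn _) (hnn _)] at hI2
  rw [hI2]
  have e5 : ∀ t, spj (e3 0) (e3 1) (e3 2) t (√(1 - t ^ 2)) = 2 * Real.pi * |t| := by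
    intro t
    have : ∀ φ : ℝ, max |e3 2 * t| |√(1 - t ^ 2) * (e3 0 * Real.cos φ + e3 1 * Real.sin φ)| = |t| := by
      intro φ; simp [he3]
    unfold spj
    simp_rw [this]
    rw [intervalIntegral.integral_const, smul_eq_mul]
    ring
  simp_rw [e5]
  rw [intervalIntegral.integral_const_mul]
  have e6 : ∫ t in (-1:ℝ)..1, |t| = 1 := by
    rw [← intervalIntegral.integral_add_adjacent_intervals (b := 0)
      (Continuous.intervalIntegrable (by fun_prop) _ _) (Continuous.intervalIntegrable (by fun_prop) _ _)]
    have a1 : ∫ t in (-1:ℝ)..0, |t| = ∫ t in (-1:ℝ)..0, -t := by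
      apply intervalIntegral.integral_congr
      intro t ht
      rw [uIcc_of_le (by norm_num)] at ht
      exact abs_of_nonpos ht.2
    have a2 : ∫ t in (0:ℝ)..1, |t| = ∫ t in (0:ℝ)..1, t := by
      apply intervalIntegral.integral_congr
      intro t ht
      rw [uIcc_of_le (by norm_num)] at ht
      exact abs_of_nonneg ht.1
    rw [a1, a2, intervalIntegral.integral_neg, integral_id, integral_id]
    norm_num
  rw [e6, mul_one]

end PartThree

section PartFive
open MeasureTheory Set Filter Topology ENNReal

lemma spD_single (r s t φ : ℝ) (ht : t ∈ Icc (-1:ℝ) 1) :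
    spD (EuclideanSpace.single 2 r) (spQ s t φ) = 1 + (s * r) ^ 2 - 2 * (s * r) * t := by
  unfold spD
  rw [spQ_norm s t φ ht, real_inner_comm, spQ_inner]
  simp
  ring

lemma sp_key (r : ℝ) (hr : 0 ≤ r) (hr1 : r < 1) (e : E3) (he : ‖e‖ = 1) (κ : ℝ → ℝ) (hκ : Continuous κ)
    (hκ0 : ∀ t, 0 ≤ κ t) (hκ1 : ∀ t, 1 ≤ t → κ t = 0) :
    ∫⁻ y : E3, ENNReal.ofReal (κ (‖y‖ ^ 2) * (|inner ℝ y e - inner ℝ (EuclideanSpace.single 2 r : E3) e * ‖y‖ ^ 2 / 3|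
      * (√(spD (EuclideanSpace.single 2 r) y))⁻¹)) ≤
    ∫⁻ y : E3, ENNReal.ofReal (κ (‖y‖ ^ 2) * (‖y‖ * (spPhi r / 3))) := by
  have hDm : Measurable (spD (EuclideanSpace.single 2 r : E3)) := (spD_contDiff _).continuous.measurable
  rw [sp_sphQ, sp_sphQ]
  rotate_left
  · apply Measurable.ennreal_ofReal
    exact Continuous.measurable (by fun_prop)
  · apply Measurable.ennreal_ofReal
    apply Measurable.mul (Continuous.measurable (by fun_prop))
    apply Measurable.mul (Continuous.measurable (by fun_prop))
    exact (Real.continuous_sqrt.measurable.comp hDm).inv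
  apply setLIntegral_mono' measurableSet_Ioi
  intro s hs
  have hs0 : 0 < s := hs
  refine mul_le_mul_right ?_ _
  by_cases h1 : s < 1
  swap
  · have hz : κ (s ^ 2) = 0 := hκ1 _ (by nlinarith)
    apply le_of_eq
    apply setLIntegral_congr_fun measurableSet_Ioo
    intro t ht
    simp only
    congr 1
    ext φ
    rw [spQ_norm s t φ (Ioo_subset_Icc_self ht), hz]
    simp
  have hq0 : 0 ≤ s * r := by positivity
  have hq1 : s * r < 1 := by nlinarith
  have hang := sp_angular (e 0) (e 1) (e 2) (s * r) hq0 hq1 (sp_Jtotal e he)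
  have hLHS : ∫⁻ t in Ioo (-1:ℝ) 1, ∫⁻ φ in Ioo (-Real.pi) Real.pi,
      ENNReal.ofReal (κ (‖spQ s t φ‖ ^ 2) * (|inner ℝ (spQ s t φ) e - inner ℝ (EuclideanSpace.single 2 r : E3) e * ‖spQ s t φ‖ ^ 2 / 3|
      * (√(spD (EuclideanSpace.single 2 r) (spQ s t φ)))⁻¹)) =
      ENNReal.ofReal (κ (s ^ 2) * (s / 3)) * ∫⁻ t in Ioo (-1:ℝ) 1, ∫⁻ φ in Ioo (-Real.pi) Real.pi,
        ENNReal.ofReal (|3 * (e 2 * t + √(1 - t ^ 2) * (e 0 * Real.cos φ + e 1 * Real.sin φ)) - s * r * e 2| *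
          (√(1 + (s * r) ^ 2 - 2 * (s * r) * t))⁻¹) := by
    rw [← lintegral_const_mul' _ _ ENNReal.ofReal_ne_top]
    apply setLIntegral_congr_fun measurableSet_Ioo
    intro t ht
    simp only
    rw [← lintegral_const_mul' _ _ ENNReal.ofReal_ne_top]
    congr 1
    ext φ
    have ht' := Ioo_subset_Icc_self ht
    rw [← ENNReal.ofReal_mul (mul_nonneg (hκ0 _) (by positivity)), spD_single r s t φ ht', spQ_norm s t φ ht', spQ_inner]
    congr 1
    have : inner ℝ (EuclideanSpace.single 2 r : E3) e = r * e 2 := by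
      rw [EuclideanSpace.inner_single_left]; simp
    rw [this, show s * (e 2 * t + √(1 - t ^ 2) * (e 0 * Real.cos φ + e 1 * Real.sin φ)) - r * e 2 * s ^ 2 / 3 =
      (s / 3) * (3 * (e 2 * t + √(1 - t ^ 2) * (e 0 * Real.cos φ + e 1 * Real.sin φ)) - s * r * e 2) by ring,
      abs_mul, abs_of_pos (by positivity : 0 < s / 3)]
    ring
  have hRHS : ∫⁻ t in Ioo (-1:ℝ) 1, ∫⁻ φ in Ioo (-Real.pi) Real.pi,
      ENNReal.ofReal (κ (‖spQ s t φ‖ ^ 2) * (‖spQ s t φ‖ * (spPhi r / 3))) =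
      ENNReal.ofReal (κ (s ^ 2) * (s / 3)) * ENNReal.ofReal (4 * Real.pi * spPhi r) := by
    have : ∫⁻ t in Ioo (-1:ℝ) 1, ∫⁻ φ in Ioo (-Real.pi) Real.pi,
      ENNReal.ofReal (κ (‖spQ s t φ‖ ^ 2) * (‖spQ s t φ‖ * (spPhi r / 3))) =
       ∫⁻ t in Ioo (-1:ℝ) 1, ∫⁻ φ in Ioo (-Real.pi) Real.pi, ENNReal.ofReal (κ (s ^ 2) * (s * (spPhi r / 3))) := by
      apply setLIntegral_congr_fun measurableSet_Ioo
      intro t ht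
      simp only
      congr 1
      ext φ
      rw [spQ_norm' s t φ (Ioo_subset_Icc_self ht) hs0.le]
    rw [this, setLIntegral_const, setLIntegral_const, Real.volume_Ioo, Real.volume_Ioo,
      ← ENNReal.ofReal_mul (mul_nonneg (hκ0 _) (mul_nonneg hs0.le (div_nonneg (spPhi_nonneg r) (by norm_num)))),
      ← ENNReal.ofReal_mul (mul_nonneg (mul_nonneg (hκ0 _) (mul_nonneg hs0.le (div_nonneg (spPhi_nonneg r) (by norm_num)))) (by linarith [Real.pi_pos])),
      ← ENNReal.ofReal_mul (mul_nonneg (hκ0 _) (by positivity))]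
    congr 1
    ring
  rw [hLHS, hRHS]
  refine mul_le_mul_right ?_ _
  have hDpos : ∀ t ∈ Icc (-1:ℝ) 1, 0 < 1 + (s * r) ^ 2 - 2 * (s * r) * t := by
    intro t ht
    nlinarith [ht.1, ht.2, mul_nonneg hq0 (sub_nonneg.2 ht.2), mul_pos (sub_pos.2 hq1) (sub_pos.2 hq1)]
  have hinner : ∀ t, ∫ φ in (-Real.pi)..Real.pi, |3 * (e 2 * t + √(1 - t ^ 2) * (e 0 * Real.cos φ + e 1 * Real.sin φ)) - s * r * e 2|
      = spj (e 0) (e 1) (e 2) (3 * t - s * r) (3 * √(1 - t ^ 2)) := by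
    intro t
    rw [← spj_eq]
    congr 1
    ext φ
    congr 1
    ring
  rw [sp_lint2]
  · apply ENNReal.ofReal_le_ofReal
    simp_rw [intervalIntegral.integral_mul_const]
    refine hang.trans ?_
    have := spPhi_mono (s * r) r hq0 (by nlinarith)
    gcongr
  · intro t _; fun_prop
  · intro t φ; positivity
  · simp_rw [intervalIntegral.integral_mul_const, hinner]
    apply ContinuousOn.mul
    · exact ((spj_cont (e 0) (e 1) (e 2)).comp (by fun_prop : Continuous fun τ : ℝ => (3 * τ - s * r, 3 * √(1 - τ ^ 2)))).continuousOn
    · apply ContinuousOn.inv₀ (Continuous.continuousOn (by fun_prop))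
      intro t ht
      exact (Real.sqrt_pos.2 (hDpos t ht)).ne'

lemma sp_key' (x : E3) (hx : ‖x‖ < 1) (e : E3) (he : ‖e‖ = 1) (κ : ℝ → ℝ) (hκ : Continuous κ)
    (hκ0 : ∀ t, 0 ≤ κ t) (hκ1 : ∀ t, 1 ≤ t → κ t = 0) :
    ∫⁻ y : E3, ENNReal.ofReal (κ (‖y‖ ^ 2) * (|inner ℝ y e - inner ℝ x e * ‖y‖ ^ 2 / 3|
      * (√(spD x y))⁻¹)) ≤
    ∫⁻ y : E3, ENNReal.ofReal (κ (‖y‖ ^ 2) * (‖y‖ * (spPhi ‖x‖ / 3))) := by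
  obtain ⟨L, hL⟩ := sp_rot x (EuclideanSpace.single 2 ‖x‖ : E3) (by simp)
  refine le_trans (le_of_eq ?_) (sp_key ‖x‖ (norm_nonneg _) hx (L e) (by simp [he]) κ hκ hκ0 hκ1)
  have hDm : Measurable (spD (EuclideanSpace.single 2 ‖x‖ : E3)) := (spD_contDiff _).continuous.measurable
  symm
  rw [← L.measurePreserving.lintegral_comp]
  · congr 1
    ext y
    rw [← hL]
    simp only [spD, L.inner_map_map, L.norm_map]
  · apply Measurable.ennreal_ofReal
    apply Measurable.mul (Continuous.measurable (by fun_prop))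
    apply Measurable.mul (Continuous.measurable (by fun_prop))
    exact (Real.continuous_sqrt.measurable.comp hDm).inv

end PartFive

section PartSix
open MeasureTheory Set Filter Topology ENNReal

lemma sp_kernel (α β : ℝ) (h0 : 0 < α) (hαβ : α < β) : ∃ ω : ℝ → ℝ, ContDiff ℝ 1 ω ∧ (∀ t, β ≤ t → ω t = 0) ∧
    (∀ t, 0 ≤ ω t) ∧ 0 < ω 0 ∧ (∀ t, 0 ≤ -2 * deriv ω t) ∧ (∀ t, β ≤ t → -2 * deriv ω t = 0) ∧
    (∀ t, t ≤ α → -2 * deriv ω t = 0) := by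
  have hd : 0 < β - α := by linarith
  refine ⟨fun t => Real.smoothTransition ((β - t) / (β - α)), ?_, ?_, ?_, ?_, ?_, ?_, ?_⟩
  · exact (Real.smoothTransition.contDiff (n := 1)).comp (by fun_prop)
  · intro t ht
    exact Real.smoothTransition.zero_of_nonpos (div_nonpos_of_nonpos_of_nonneg (by linarith) hd.le)
  · intro t; exact Real.smoothTransition.nonneg _
  · exact Real.smoothTransition.pos_of_pos (div_pos (by linarith) hd)
  · intro t
    have : Antitone (fun t => Real.smoothTransition ((β - t) / (β - α))) := by
      intro a b hab
      apply Real.smoothTransition.monotone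
      gcongr
    have := this.deriv_nonpos (x := t)
    linarith
  · intro t ht
    have : IsLocalMin (fun t => Real.smoothTransition ((β - t) / (β - α))) t := by
      apply Eventually.of_forall
      intro s
      simp only
      rw [Real.smoothTransition.zero_of_nonpos (div_nonpos_of_nonpos_of_nonneg (by linarith) hd.le : (β - t) / (β - α) ≤ 0)]
      exact Real.smoothTransition.nonneg _
    rw [this.deriv_eq_zero, mul_zero]
  · intro t ht
    have : IsLocalMax (fun t => Real.smoothTransition ((β - t) / (β - α))) t := by
      apply Eventually.of_forall
      intro s
      simp only
      rw [Real.smoothTransition.one_of_one_le (x := (β - t) / (β - α)) (by rw [le_div_iff₀ hd]; linarith)]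
      exact Real.smoothTransition.le_one _
    rw [this.deriv_eq_zero, mul_zero]

lemma sp_moment (ρ : ℝ) (hρ : 0 < ρ) (ω : ℝ → ℝ) (hω : ContDiff ℝ 1 ω) (hω0 : ∀ t, ρ ^ 2 ≤ t → ω t = 0)
    (hκ1 : ∀ t, ρ ^ 2 ≤ t → -2 * deriv ω t = 0) :
    ∫ y : E3, ‖y‖ ^ 2 * (-2 * deriv ω (‖y‖ ^ 2)) = 3 * ∫ y : E3, ω (‖y‖ ^ 2) := by
  have hκc : Continuous fun t => -2 * deriv ω t := continuous_const.mul (hω.continuous_deriv (by norm_num))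
  have hκcs := sp_radial_compact (fun t => -2 * deriv ω t) ρ hρ hκ1
  have hκcy : Continuous fun y : E3 => -2 * deriv ω (‖y‖ ^ 2) := hκc.comp (by fun_prop)
  have hi : ∀ i : Fin 3, ∫ y : E3, y i * (y i * (-2 * deriv ω (‖y‖ ^ 2))) = ∫ y : E3, ω (‖y‖ ^ 2) := by
    intro i
    set l : E3 →L[ℝ] ℝ := innerSL ℝ (EuclideanSpace.single i (1:ℝ) : E3) with hl
    have hly : ∀ y, l y = y i := by
      intro y; rw [hl, innerSL_apply_apply, EuclideanSpace.inner_single_left]; simp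
    have := sp_mvp_grad (fun y => l y) l.contDiff (ρ + 1) ρ hρ (by linarith) (by
      intro z _
      apply Finset.sum_eq_zero
      intro j _
      have : (fun y => fderiv ℝ (fun y => l y) y (EuclideanSpace.single j 1)) = fun _ => l (EuclideanSpace.single j 1) := by
        ext y; rw [l.fderiv]
      rw [this]; simp) ω hω hω0 (EuclideanSpace.single i 1)
    rw [l.fderiv, hly] at this
    simp only [hly, EuclideanSpace.inner_single_right] at this
    simpa using this
  have hint : ∀ i : Fin 3, Integrable fun y : E3 => y i * (y i * (-2 * deriv ω (‖y‖ ^ 2))) := by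
    intro i
    apply Continuous.integrable_of_hasCompactSupport
    · fun_prop
    · exact (hκcs.mul_left (f := fun y : E3 => y i)).mul_left (f := fun y : E3 => y i)
  have : (fun y : E3 => ‖y‖ ^ 2 * (-2 * deriv ω (‖y‖ ^ 2))) = fun y : E3 => ∑ i : Fin 3, y i * (y i * (-2 * deriv ω (‖y‖ ^ 2))) := by
    ext y
    rw [Fin.sum_univ_three]
    nth_rewrite 1 [sp_nsq y]
    ring
  rw [this, integral_finsetSum _ (fun i _ => hint i)]
  simp_rw [hi]
  simp

lemma sp_main (h : E3 → ℝ) (hh : ContDiff ℝ 2 h) (R ρ a : ℝ) (ha : 0 < a) (haρ : a < ρ) (hρR : ρ < R) (hR : R ≤ 1)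
    (hlap : ∀ z : E3, ‖z‖ < R → (∑ i : Fin 3, fderiv ℝ (fun y => fderiv ℝ h y
      (EuclideanSpace.single i 1)) z (EuclideanSpace.single i 1)) = 0)
    (x : E3) (hx : ‖x‖ < 1) (hb : ∀ y, ‖y‖ < 1 → |h y| ≤ (√(spD x y))⁻¹) (e : E3) (he : ‖e‖ = 1) :
    |fderiv ℝ h 0 e - inner ℝ x e * h 0| ≤ spPhi ‖x‖ / a := by
  have hρ : 0 < ρ := ha.trans haρ
  obtain ⟨ω, hω, hω0, hωn, hωp, hκn, hκb, hκa⟩ := sp_kernel (a ^ 2) (ρ ^ 2) (by positivity) (by nlinarith)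
  set κ : ℝ → ℝ := fun t => -2 * deriv ω t with hκ
  have hκc : Continuous κ := continuous_const.mul (hω.continuous_deriv (by norm_num))
  have hκcs := sp_radial_compact κ ρ hρ hκb
  have hκcy : Continuous fun y : E3 => κ (‖y‖ ^ 2) := hκc.comp (by fun_prop)
  have hhc := hh.continuous
  have hmom : ∫ y : E3, ‖y‖ ^ 2 * κ (‖y‖ ^ 2) = 3 * ∫ y : E3, ω (‖y‖ ^ 2) := sp_moment ρ hρ ω hω hω0 hκb
  have h1 : ∫ y : E3, h y * (inner ℝ y e * κ (‖y‖ ^ 2)) = fderiv ℝ h 0 e * ∫ y : E3, ω (‖y‖ ^ 2) :=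
    sp_mvp_grad h hh R ρ hρ hρR hlap ω hω hω0 e
  have h2 := sp_mvp h hh R ρ hρ hlap (fun t => t * κ t) (by fun_prop) (fun t ht => by
    have := hκb t ht
    simp only [hκ, this, mul_zero]) 0 (by simpa using hρR.le)
  simp only [zero_add] at h2
  rw [hmom] at h2
  set I := ∫ y : E3, ω (‖y‖ ^ 2) with hI
  have hωc : Continuous fun y : E3 => ω (‖y‖ ^ 2) := hω.continuous.comp (by fun_prop)
  have hIpos : 0 < I := by
    apply hωc.integral_pos_of_hasCompactSupport_nonneg_nonzero (sp_radial_compact ω ρ hρ hω0) (fun y => hωn _) (x := 0)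
    simpa using hωp.ne'
  have i1 : Integrable fun y : E3 => h y * (inner ℝ y e * κ (‖y‖ ^ 2)) := by
    apply Continuous.integrable_of_hasCompactSupport (by fun_prop)
    exact (hκcs.mul_left (f := fun y : E3 => inner ℝ y e)).mul_left (f := h)
  have i2 : Integrable fun y : E3 => h y * (‖y‖ ^ 2 * κ (‖y‖ ^ 2)) := by
    apply Continuous.integrable_of_hasCompactSupport (by fun_prop)
    exact (hκcs.mul_left (f := fun y : E3 => ‖y‖ ^ 2)).mul_left (f := h)
  have h3 : (fderiv ℝ h 0 e - inner ℝ x e * h 0) * I =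
      ∫ y : E3, h y * (κ (‖y‖ ^ 2) * (inner ℝ y e - inner ℝ x e * ‖y‖ ^ 2 / 3)) := by
    have : (fun y : E3 => h y * (κ (‖y‖ ^ 2) * (inner ℝ y e - inner ℝ x e * ‖y‖ ^ 2 / 3))) =
       fun y : E3 => h y * (inner ℝ y e * κ (‖y‖ ^ 2)) - (inner ℝ x e / 3) * (h y * (‖y‖ ^ 2 * κ (‖y‖ ^ 2))) := by
      ext y; ring
    rw [this, integral_sub i1 (i2.const_mul _), integral_const_mul, h1, h2]
    ring
  -- comparison
  have hΦ := spPhi_nonneg ‖x‖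
  have i3 : Integrable fun y : E3 => κ (‖y‖ ^ 2) * (‖y‖ * (spPhi ‖x‖ / 3)) := by
    apply Continuous.integrable_of_hasCompactSupport (by fun_prop)
    exact hκcs.mul_right
  have i4 : Integrable fun y : E3 => (spPhi ‖x‖ / (3 * a)) * (‖y‖ ^ 2 * κ (‖y‖ ^ 2)) := by
    apply Integrable.const_mul
    apply Continuous.integrable_of_hasCompactSupport (by fun_prop)
    exact hκcs.mul_left
  have h4 : |∫ y : E3, h y * (κ (‖y‖ ^ 2) * (inner ℝ y e - inner ℝ x e * ‖y‖ ^ 2 / 3))| ≤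
      ∫ y : E3, κ (‖y‖ ^ 2) * (‖y‖ * (spPhi ‖x‖ / 3)) := by
    have hnn : 0 ≤ ∫ y : E3, κ (‖y‖ ^ 2) * (‖y‖ * (spPhi ‖x‖ / 3)) :=
      integral_nonneg fun y => mul_nonneg (hκn _) (by positivity)
    rw [← ENNReal.ofReal_le_ofReal_iff hnn, ofReal_integral_eq_lintegral_ofReal i3
      (Eventually.of_forall fun y => mul_nonneg (hκn _) (by positivity)), ← Real.enorm_eq_ofReal_abs]
    refine (enorm_integral_le_lintegral_enorm _).trans ?_
    refine le_trans ?_ (sp_key' x hx e he κ hκc hκn (fun t ht => hκb t (by nlinarith)))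
    apply lintegral_mono
    intro y
    simp only
    rw [Real.enorm_eq_ofReal_abs]
    apply ENNReal.ofReal_le_ofReal
    rw [abs_mul, abs_mul, abs_of_nonneg (show 0 ≤ κ (‖y‖ ^ 2) from hκn _)]
    by_cases hy : ‖y‖ < 1
    · have := hb y hy
      calc |h y| * (κ (‖y‖ ^ 2) * |inner ℝ y e - inner ℝ x e * ‖y‖ ^ 2 / 3|) ≤
          (√(spD x y))⁻¹ * (κ (‖y‖ ^ 2) * |inner ℝ y e - inner ℝ x e * ‖y‖ ^ 2 / 3|) :=
            mul_le_mul_of_nonneg_right this (mul_nonneg (hκn _) (abs_nonneg _))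
        _ = _ := by ring
    · have : κ (‖y‖ ^ 2) = 0 := hκb _ (by nlinarith)
      rw [this]; simp
  have h5 : ∫ y : E3, κ (‖y‖ ^ 2) * (‖y‖ * (spPhi ‖x‖ / 3)) ≤ (spPhi ‖x‖ / a) * I := by
    have : (spPhi ‖x‖ / a) * I = ∫ y : E3, (spPhi ‖x‖ / (3 * a)) * (‖y‖ ^ 2 * κ (‖y‖ ^ 2)) := by
      rw [integral_const_mul, hmom]
      field_simp
    rw [this]
    apply integral_mono i3 i4
    intro y
    simp only
    by_cases hy : ‖y‖ ^ 2 ≤ a ^ 2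
    · have : κ (‖y‖ ^ 2) = 0 := hκa _ hy
      rw [this]; simp
    · have hy' : a ≤ ‖y‖ := by
        by_contra hc
        push Not at hc
        exact hy (by have := norm_nonneg y; nlinarith)
      have : spPhi ‖x‖ / (3 * a) * (‖y‖ ^ 2 * κ (‖y‖ ^ 2)) = κ (‖y‖ ^ 2) * (‖y‖ * (spPhi ‖x‖ / 3)) * (‖y‖ / a) := by
        field_simp
      rw [this]
      exact le_mul_of_one_le_right (mul_nonneg (hκn _) (by positivity)) (by rwa [one_le_div ha])
  rw [← h3, abs_mul, abs_of_pos hIpos] at h4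
  exact le_of_mul_le_mul_right (h4.trans h5) hIpos

lemma sp_dir (u : E3 → ℝ) (hu : IsHarmonicOn u (Metric.ball 0 1))
    (hb : ∀ y ∈ Metric.ball (0 : E3) 1, |u y| < 1) (x : E3) (hx : ‖x‖ < 1) (e : E3) (he : ‖e‖ = 1)
    (a : ℝ) (ha : 0 < a) (ha1 : a < 1) :
    (1 - ‖x‖ ^ 2) * |fderiv ℝ u x e| ≤ spPhi ‖x‖ / a := by
  set R := (a + 1) / 2 with hR
  have hRa : a < R := by rw [hR]; linarith
  have hR1 : R < 1 := by rw [hR]; linarith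
  let χ : ContDiffBump (0 : E3) := ⟨R, (R + 1) / 2, by linarith, by linarith⟩
  have hC := spH_contDiffOn u hu.1 x hx
  set h : E3 → ℝ := fun y => χ y * spH u x y with hh
  have heq : ∀ z : E3, ‖z‖ < R → h =ᶠ[𝓝 z] spH u x := by
    intro z hz
    have : χ =ᶠ[𝓝 z] 1 := χ.eventuallyEq_one_of_mem_ball (by simpa [χ] using hz)
    filter_upwards [this] with y hy
    simp [hh, hy]
  have hsm : ContDiff ℝ 2 h := by
    rw [contDiff_iff_contDiffAt]
    intro z
    by_cases hz : ‖z‖ < 1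
    · apply ContDiffAt.mul χ.contDiffAt
      exact hC.contDiffAt (Metric.isOpen_ball.mem_nhds (by simpa using hz))
    · have hz2 : z ∈ (Metric.closedBall (0:E3) ((R + 1) / 2))ᶜ := by
        simp; linarith
      have : h =ᶠ[𝓝 z] fun _ => 0 := by
        filter_upwards [Metric.isClosed_closedBall.isOpen_compl.mem_nhds hz2] with y hy
        have : χ y = 0 := χ.zero_of_le_dist (by simp [χ] at hy ⊢; linarith)
        simp [hh, this]
      exact contDiffAt_const.congr_of_eventuallyEq this
  have hlap : ∀ z : E3, ‖z‖ < R → (∑ i : Fin 3, fderiv ℝ (fun y => fderiv ℝ h y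
      (EuclideanSpace.single i 1)) z (EuclideanSpace.single i 1)) = 0 := by
    intro z hz
    rw [← spH_lap u hu x hx z (hz.trans hR1)]
    apply Finset.sum_congr rfl
    intro i _
    have : (fun y => fderiv ℝ h y (EuclideanSpace.single i 1)) =ᶠ[𝓝 z] fun y => fderiv ℝ (spH u x) y (EuclideanSpace.single i 1) := by
      filter_upwards [(heq z hz).fderiv (𝕜 := ℝ)] with y hy
      rw [hy]
    rw [this.fderiv_eq]
  have hbd : ∀ y, ‖y‖ < 1 → |h y| ≤ (√(spD x y))⁻¹ := by
    intro y hy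
    refine le_trans ?_ (spH_bound u hb x hx y hy)
    rw [hh, abs_mul, abs_of_nonneg χ.nonneg]
    exact mul_le_of_le_one_left (abs_nonneg _) χ.le_one
  have := sp_main h hsm R ((a + R) / 2) a ha (by linarith) (by linarith) hR1.le hlap x hx hbd e he
  have h00 := heq 0 (by simp; linarith)
  rw [h00.fderiv_eq, h00.eq_of_nhds, spH_zero, spH_fderiv_zero u hu.1 x hx e] at this
  have hp : 0 < 1 - ‖x‖ ^ 2 := by nlinarith [norm_nonneg x]
  rw [show inner ℝ x e * u x - (1 - ‖x‖ ^ 2) * fderiv ℝ u x e - inner ℝ x e * u x = -((1 - ‖x‖ ^ 2) * fderiv ℝ u x e) by ring,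
    abs_neg, abs_mul, abs_of_pos hp] at this
  exact this

lemma sp_dir' (u : E3 → ℝ) (hu : IsHarmonicOn u (Metric.ball 0 1))
    (hb : ∀ y ∈ Metric.ball (0 : E3) 1, |u y| < 1) (x : E3) (hx : ‖x‖ < 1) (e : E3) (he : ‖e‖ = 1) :
    (1 - ‖x‖ ^ 2) * |fderiv ℝ u x e| ≤ spPhi ‖x‖ := by
  have ht : Tendsto (fun a : ℝ => spPhi ‖x‖ / a) (𝓝[<] 1) (𝓝 (spPhi ‖x‖ / 1)) := by
    apply Tendsto.mono_left _ nhdsWithin_le_nhds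
    exact tendsto_const_nhds.div tendsto_id (by norm_num)
  rw [div_one] at ht
  apply ge_of_tendsto ht
  filter_upwards [Ioo_mem_nhdsLT (show (0:ℝ) < 1 by norm_num)] with a ha
  exact sp_dir u hu hb x hx e he a ha.1 ha.2

end PartSix


theorem schwarz_pick_harmonic_dim3
    (u : EuclideanSpace Real (Fin 3) -> Real)
    (hu : IsHarmonicOn u (Metric.ball 0 1))
    (hb : ∀ y ∈ Metric.ball (0 : EuclideanSpace Real (Fin 3)) 1, |u y| < 1)
    (x : EuclideanSpace Real (Fin 3)) (hx : x ∈ Metric.ball (0 : EuclideanSpace Real (Fin 3)) 1) :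
    ‖fderiv Real u x‖ < 8 / (3 * Real.sqrt 3) * (1 / (1 - ‖x‖^2)) := by
  have hx1 : ‖x‖ < 1 := by simpa using hx
  have hp : 0 < 1 - ‖x‖ ^ 2 := by nlinarith [norm_nonneg x]
  have hle : ‖fderiv ℝ u x‖ ≤ spPhi ‖x‖ * (1 / (1 - ‖x‖ ^ 2)) := by
    apply ContinuousLinearMap.opNorm_le_of_unit_norm
      (mul_nonneg (spPhi_nonneg _) (one_div_pos.2 hp).le)
    intro e he
    have := sp_dir' u hu hb x hx1 e he
    rw [Real.norm_eq_abs, mul_one_div, le_div_iff₀ hp]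
    linarith
  refine hle.trans_lt ?_
  exact mul_lt_mul_of_pos_right (spPhi_lt ‖x‖ (norm_nonneg _) hx1) (one_div_pos.2 hp)
end

section
/- If u is a real-valued harmonic function on the unit ball B_n of R^n with |u| < 1 on B_n, then |∇u(0)| ≤ 2·vol_{n-1}(B_{n-1})/vol_n(B_n). -/
open MeasureTheory Filter Topology

namespace HS

lemma integ {n : ℕ} {f : EuclideanSpace ℝ (Fin n) → ℝ} (hf : Continuous f)
    (h0 : ∀ y, 1 < ‖y‖ → f y = 0) : Integrable f := by
  apply hf.integrable_of_hasCompactSupport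
  apply HasCompactSupport.intro (isCompact_closedBall (0 : EuclideanSpace ℝ (Fin n)) 1)
  intro x hx
  apply h0
  simpa using hx

lemma ibp {n : ℕ} {f g : EuclideanSpace ℝ (Fin n) → ℝ} (hf : ContDiff ℝ 1 f) (hg : ContDiff ℝ 1 g)
    (h0 : ∀ y, 1 < ‖y‖ → f y = 0) (v : EuclideanSpace ℝ (Fin n)) :
    ∫ x, f x * fderiv ℝ g x v = - ∫ x, fderiv ℝ f x v * g x := by
  have h1 : ∀ y, 1 < ‖y‖ → fderiv ℝ f y = 0 := by
    intro y hy
    have : f =ᶠ[𝓝 y] fun _ => 0 := by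
      filter_upwards [(isOpen_lt continuous_const continuous_norm).mem_nhds hy] with z hz
      exact h0 z hz
    rw [this.fderiv_eq]; simp
  have cf := hf.continuous_fderiv (by norm_num)
  have cg := hg.continuous_fderiv (by norm_num)
  have cf0 := hf.continuous
  have cg0 := hg.continuous
  apply integral_mul_fderiv_eq_neg_fderiv_mul_of_integrable
  · exact integ (by fun_prop) (fun y hy => by simp [h1 y hy])
  · exact integ (by fun_prop) (fun y hy => by simp [h0 y hy])
  · exact integ (by fun_prop) (fun y hy => by simp [h0 y hy])
  · intro x _; exact (hf.differentiable (by norm_num)) x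
  · intro x _; exact (hg.differentiable (by norm_num)) x

lemma fderiv_phi {n : ℕ} {ψ : ℝ → ℝ} (hψ : ContDiff ℝ 2 ψ) (y v : EuclideanSpace ℝ (Fin n)) :
    fderiv ℝ (fun y : EuclideanSpace ℝ (Fin n) => ψ (‖y‖^2)) y v
      = 2 * deriv ψ (‖y‖^2) * inner ℝ y v := by
  have h1 := (hasFDerivAt_id (𝕜 := ℝ) y).norm_sq
  have h2 := ((hψ.differentiable (by norm_num)) (‖y‖^2)).hasDerivAt
  have h3 := h2.comp_hasFDerivAt y h1
  have h4 : HasFDerivAt (fun y : EuclideanSpace ℝ (Fin n) => ψ (‖y‖^2)) _ y := h3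
  rw [h4.fderiv]
  simp
  ring

lemma deriv_zero {ψ : ℝ → ℝ} {b : ℝ} (h0 : ∀ s, b < s → ψ s = 0) :
   ∀ s, b < s → deriv ψ s = 0 := by
  intro s hs
  have : ψ =ᶠ[𝓝 s] fun _ => 0 := by
    filter_upwards [lt_mem_nhds hs] with z hz
    exact h0 z hz
  rw [this.deriv_eq]; simp

lemma one_lt_sq {n : ℕ} {y : EuclideanSpace ℝ (Fin n)} (h : 1 < ‖y‖) : 1 < ‖y‖^2 := by nlinarith

/-- Integration by parts, first order. -/
lemma ibp1 {n : ℕ} {ψ : ℝ → ℝ} (hψ : ContDiff ℝ 2 ψ) (h0 : ∀ s, 1 < s → ψ s = 0)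
    {w : EuclideanSpace ℝ (Fin n) → ℝ} (hw : ContDiff ℝ 1 w) (i : Fin n) :
    ∫ y, 2 * deriv ψ (‖y‖^2) * y i * w y
      = - ∫ y, ψ (‖y‖^2) * fderiv ℝ w y (EuclideanSpace.single i 1) := by
  rw [ibp (f := fun y : EuclideanSpace ℝ (Fin n) => ψ (‖y‖^2)) _ hw, neg_neg]
  · congr 1; ext y
    rw [fderiv_phi hψ]
    simp [EuclideanSpace.inner_single_right]
  · intro y hy; exact h0 _ (one_lt_sq hy)
  · exact (hψ.of_le (by norm_num)).comp (contDiff_norm_sq ℝ)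

/-- Integration by parts, second order. -/
lemma ibp2 {n : ℕ} {ψ : ℝ → ℝ} (hψ : ContDiff ℝ 2 ψ) (h0 : ∀ s, 1 < s → ψ s = 0)
    {w : EuclideanSpace ℝ (Fin n) → ℝ} (hw : ContDiff ℝ 2 w) (i : Fin n)
    (hlap : ∀ y, ψ (‖y‖^2) ≠ 0 →
      (∑ j : Fin n, fderiv ℝ (fun y => fderiv ℝ w y (EuclideanSpace.single j 1)) y
      (EuclideanSpace.single j 1)) = 0) :
    ∫ y, 2 * deriv ψ (‖y‖^2) * y i * fderiv ℝ w y y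
      = ∫ y, 2 * deriv ψ (‖y‖^2) * y i * w y := by
  have cφ : ContDiff ℝ 1 (fun y : EuclideanSpace ℝ (Fin n) => ψ (‖y‖^2)) :=
    (hψ.of_le (by norm_num)).comp (contDiff_norm_sq ℝ)
  have cyi : ∀ i : Fin n, ContDiff ℝ 1 (fun y : EuclideanSpace ℝ (Fin n) => y i) := by
    intro i; fun_prop
  have cyφ : ContDiff ℝ 1 (fun y : EuclideanSpace ℝ (Fin n) => y i * ψ (‖y‖^2)) := (cyi i).mul cφ
  have cdψ : Continuous (deriv ψ) := hψ.continuous_deriv (by norm_num)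
  have cψ : Continuous ψ := hψ.continuous
  have hd0 := deriv_zero h0
  have cw' : ContDiff ℝ 1 (fderiv ℝ w) := hw.fderiv_right (by norm_num)
  have cw1 := cw'.continuous
  have cwj : ∀ j : Fin n, ContDiff ℝ 1 (fun y => fderiv ℝ w y (EuclideanSpace.single j 1)) := by
    intro j; exact cw'.clm_apply contDiff_const
  have cwjj : ∀ j : Fin n, Continuous (fun y => fderiv ℝ (fun y => fderiv ℝ w y (EuclideanSpace.single j 1)) y (EuclideanSpace.single j 1)) := by
    intro j
    exact ((cwj j).continuous_fderiv (by norm_num)).clm_apply continuous_const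
  have e1 : ∀ j : Fin n, ∫ y : EuclideanSpace ℝ (Fin n), (y i * ψ (‖y‖^2)) * fderiv ℝ (fun y => fderiv ℝ w y (EuclideanSpace.single j 1)) y (EuclideanSpace.single j 1)
     = - ∫ y : EuclideanSpace ℝ (Fin n), ((if i = j then ψ (‖y‖^2) else 0) + 2 * deriv ψ (‖y‖^2) * y i * y j) * fderiv ℝ w y (EuclideanSpace.single j 1) := by
    intro j
    rw [ibp cyφ (cwj j)]
    · congr 2; ext y
      congr 1
      have hA : HasFDerivAt (fun y : EuclideanSpace ℝ (Fin n) => y i) (EuclideanSpace.proj i : EuclideanSpace ℝ (Fin n) →L[ℝ] ℝ) y :=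
        (EuclideanSpace.proj i : EuclideanSpace ℝ (Fin n) →L[ℝ] ℝ).hasFDerivAt
      have hB := ((cφ.differentiable (by norm_num)) y).hasFDerivAt
      have hC := hA.mul hB
      have hD : HasFDerivAt (fun y : EuclideanSpace ℝ (Fin n) => y i * ψ (‖y‖^2)) _ y := hC
      rw [hD.fderiv]
      simp only [add_apply, smul_apply, fderiv_phi hψ]
      simp [EuclideanSpace.inner_single_right]
      split_ifs <;> ring
    · intro y hy; simp [h0 _ (one_lt_sq hy)]
  have e2 : ∑ j : Fin n, ∫ y : EuclideanSpace ℝ (Fin n), (y i * ψ (‖y‖^2)) * fderiv ℝ (fun y => fderiv ℝ w y (EuclideanSpace.single j 1)) y (EuclideanSpace.single j 1) = 0 := by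
    rw [← integral_finsetSum]
    · rw [← integral_zero (EuclideanSpace ℝ (Fin n)) ℝ]
      congr 1; ext y
      rw [← Finset.mul_sum]
      by_cases h : ψ (‖y‖^2) = 0
      · simp [h]
      · rw [hlap y h]; simp
    · intro j _
      have := cwjj j
      exact integ (by fun_prop) (fun y hy => by simp [h0 _ (one_lt_sq hy)])
  rw [Finset.sum_congr rfl (fun j _ => e1 j), Finset.sum_neg_distrib, neg_eq_zero, ← integral_finsetSum] at e2
  · rw [ibp1 hψ h0 (hw.of_le (by norm_num)), eq_neg_iff_add_eq_zero, ← integral_add]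
    · rw [← e2]
      congr 1; ext y
      simp only [add_mul, Finset.sum_add_distrib, ite_mul, zero_mul, Finset.sum_ite_eq, Finset.mem_univ, if_true]
      rw [add_comm]
      congr 1
      have hy : y = ∑ j, y j • EuclideanSpace.single j (1:ℝ) := by
        ext k; simp [Pi.single_apply]
      conv_lhs => rw [show fderiv ℝ w y y = fderiv ℝ w y (∑ j, y j • EuclideanSpace.single j (1:ℝ)) from congrArg _ hy]
      rw [map_sum, Finset.mul_sum]
      simp only [map_smul, smul_eq_mul, mul_assoc]
    · exact integ (by fun_prop) (fun y hy => by simp [hd0 _ (one_lt_sq hy)])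
    · exact integ (by fun_prop) (fun y hy => by simp [h0 _ (one_lt_sq hy)])
  · intro j _
    apply integ
    · split_ifs <;> fun_prop
    · intro y hy; simp [hd0 _ (one_lt_sq hy), h0 _ (one_lt_sq hy)]

lemma fderiv_scale {n : ℕ} {u : EuclideanSpace ℝ (Fin n) → ℝ} (hu : Differentiable ℝ u) (r : ℝ)
    (y v : EuclideanSpace ℝ (Fin n)) :
    fderiv ℝ (fun y => u (r • y)) y v = r * fderiv ℝ u (r • y) v := by
  have h1 : HasFDerivAt (fun y : EuclideanSpace ℝ (Fin n) => r • y) (r • ContinuousLinearMap.id ℝ _) y :=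
    (hasFDerivAt_id y).const_smul r
  have h2 : HasFDerivAt (fun y => u (r • y)) _ y := (hu (r • y)).hasFDerivAt.comp y h1
  rw [h2.fderiv]
  simp

lemma scaled {n : ℕ} {ψ : ℝ → ℝ} (hψ : ContDiff ℝ 2 ψ) {b : ℝ} (hb : b ≤ 1)
    (h0 : ∀ s, b ≤ s → ψ s = 0)
    {u : EuclideanSpace ℝ (Fin n) → ℝ} (hu : ContDiff ℝ 2 u) (i : Fin n)
    (hlap : ∀ y, ‖y‖^2 < b →
      (∑ j : Fin n, fderiv ℝ (fun y => fderiv ℝ u y (EuclideanSpace.single j 1)) y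
      (EuclideanSpace.single j 1)) = 0) {r : ℝ} (hr0 : 0 ≤ r) (hr1 : r ≤ 1) :
    r * ∫ y, 2 * deriv ψ (‖y‖^2) * y i * fderiv ℝ u (r • y) y
      = ∫ y, 2 * deriv ψ (‖y‖^2) * y i * u (r • y) := by
  have hu1 := hu.differentiable (by norm_num)
  have cu' : ContDiff ℝ 1 (fderiv ℝ u) := hu.fderiv_right (by norm_num)
  have h0' : ∀ s, 1 < s → ψ s = 0 := fun s hs => h0 s (by linarith)
  have := ibp2 hψ h0' (w := fun y => u (r • y)) (hu.comp (contDiff_const_smul r)) i ?_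
  · rw [← this, ← integral_const_mul]
    congr 1; ext y
    rw [fderiv_scale hu1]; ring
  · intro y hy
    have hy' : ‖y‖^2 < b := by
      by_contra h; exact hy (h0 _ (not_lt.1 h))
    have hry : ‖r • y‖^2 < b := by
      rw [norm_smul, mul_pow, Real.norm_eq_abs, sq_abs]
      have : r^2 ≤ 1 := by nlinarith
      nlinarith [sq_nonneg ‖y‖]
    have key := hlap _ hry
    have : ∀ j : Fin n, fderiv ℝ (fun y => fderiv ℝ (fun y => u (r • y)) y (EuclideanSpace.single j 1)) y
      (EuclideanSpace.single j 1) = r^2 * fderiv ℝ (fun y => fderiv ℝ u y (EuclideanSpace.single j 1)) (r • y)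
      (EuclideanSpace.single j 1) := by
      intro j
      have cj : ContDiff ℝ 1 (fun y => fderiv ℝ u y (EuclideanSpace.single j 1)) :=
        cu'.clm_apply contDiff_const
      have cjd := cj.differentiable (by norm_num)
      have e : (fun y => fderiv ℝ (fun y => u (r • y)) y (EuclideanSpace.single j 1))
        = fun y => r * (fun z => fderiv ℝ u z (EuclideanSpace.single j 1)) (r • y) := by
        ext z; rw [fderiv_scale hu1]
      rw [e, fderiv_const_mul, smul_apply, fderiv_scale cjd]
      · simp; ring
      · exact (cjd.comp (differentiable_id.const_smul r)) y
    simp only [this]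
    rw [← Finset.mul_sum, key, mul_zero]

lemma hasDeriv {n : ℕ} {ψ : ℝ → ℝ} (hψ : ContDiff ℝ 2 ψ) (h0 : ∀ s, 1 < s → ψ s = 0)
    {u : EuclideanSpace ℝ (Fin n) → ℝ} (hu : ContDiff ℝ 2 u) (hc : HasCompactSupport u) (i : Fin n)
    (r : ℝ) :
    HasDerivAt (fun r : ℝ => ∫ y, 2 * deriv ψ (‖y‖^2) * y i * u (r • y))
      (∫ y, 2 * deriv ψ (‖y‖^2) * y i * fderiv ℝ u (r • y) y) r := by
  have hd0 := deriv_zero h0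
  have cdψ : Continuous (deriv ψ) := hψ.continuous_deriv (by norm_num)
  have cu := hu.continuous
  have cu' : Continuous (fderiv ℝ u) := hu.continuous_fderiv (by norm_num)
  obtain ⟨C, hC⟩ := (hc.fderiv (𝕜 := ℝ)).exists_bound_of_continuous cu'
  refine (hasDerivAt_integral_of_dominated_loc_of_deriv_le (𝕜 := ℝ) (μ := volume) (s := Set.univ)
    (F := fun (r : ℝ) (y : EuclideanSpace ℝ (Fin n)) => 2 * deriv ψ (‖y‖^2) * y i * u (r • y))
    (F' := fun (r : ℝ) (y : EuclideanSpace ℝ (Fin n)) => 2 * deriv ψ (‖y‖^2) * y i * fderiv ℝ u (r • y) y)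
    (bound := fun y : EuclideanSpace ℝ (Fin n) => |2 * deriv ψ (‖y‖^2) * y i| * (C * ‖y‖)) univ_mem ?_ ?_ ?_ ?_ ?_ ?_).2
  · refine Eventually.of_forall fun r => ?_
    exact Continuous.aestronglyMeasurable (by fun_prop)
  · exact integ (by fun_prop) (fun y hy => by simp [hd0 _ (one_lt_sq hy)])
  · exact Continuous.aestronglyMeasurable (by fun_prop)
  · refine Eventually.of_forall fun y x _ => ?_
    rw [norm_mul, Real.norm_eq_abs]
    gcongr
    exact (ContinuousLinearMap.le_opNorm _ _).trans (by gcongr; exact hC _)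
  · exact integ (by fun_prop) (fun y hy => by simp [hd0 _ (one_lt_sq hy)])
  · refine Eventually.of_forall fun y x _ => ?_
    apply HasDerivAt.const_mul
    have h1 : HasDerivAt (fun x : ℝ => x • y) y x := by
      simpa using (hasDerivAt_id x).smul_const y
    exact ((hu.differentiable (by norm_num)) (x • y)).hasFDerivAt.comp_hasDerivAt x h1

lemma ode {H H' : ℝ → ℝ} (hd : ∀ r, HasDerivAt H (H' r) r)
    (he : ∀ r, 0 ≤ r → r ≤ 1 → r * H' r = H r) : H 1 = H' 0 := by
  have hH0 : H 0 = 0 := by rw [← he 0 le_rfl zero_le_one]; simp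
  have h1 : ∀ ε, 0 < ε → ε < 1 → H 1 = ε⁻¹ * H ε := by
    intro ε hε hε1
    have hdd : ∀ x ∈ Set.Icc ε 1, HasDerivAt (fun r => r⁻¹ * H r) 0 x := by
      intro x hx
      have hx0 : 0 < x := hε.trans_le hx.1
      have := (hasDerivAt_inv hx0.ne').mul (hd x)
      have h3 : -(x ^ 2)⁻¹ * H x + x⁻¹ * H' x = 0 := by
        rw [← he x hx0.le hx.2]
        field_simp
        ring
      rw [h3] at this
      exact this
    have := constant_of_has_deriv_right_zero (f := fun r => r⁻¹ * H r) (a := ε) (b := 1)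
      (fun x hx => (hdd x hx).continuousAt.continuousWithinAt)
      (fun x hx => (hdd x ⟨hx.1, hx.2.le⟩).hasDerivWithinAt) 1 ⟨hε1.le, le_rfl⟩
    simpa using this
  have h2 := (hd 0).tendsto_slope_zero_right
  simp only [zero_add, hH0, sub_zero, smul_eq_mul] at h2
  refine tendsto_nhds_unique (tendsto_const_nhds.congr' ?_) h2
  filter_upwards [Ioo_mem_nhdsGT (show (0:ℝ) < 1 by norm_num)] with ε hε
  exact h1 ε hε.1 hε.2

lemma mean {n : ℕ} {ψ : ℝ → ℝ} (hψ : ContDiff ℝ 2 ψ) {b : ℝ} (hb : b ≤ 1)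
    (h0 : ∀ s, b ≤ s → ψ s = 0)
    {u : EuclideanSpace ℝ (Fin n) → ℝ} (hu : ContDiff ℝ 2 u) (hc : HasCompactSupport u) (i : Fin n)
    (hlap : ∀ y, ‖y‖^2 < b →
      (∑ j : Fin n, fderiv ℝ (fun y => fderiv ℝ u y (EuclideanSpace.single j 1)) y
      (EuclideanSpace.single j 1)) = 0) :
    ∫ y, 2 * deriv ψ (‖y‖^2) * y i * u y =
      - ((∫ y : EuclideanSpace ℝ (Fin n), ψ (‖y‖^2)) * fderiv ℝ u 0 (EuclideanSpace.single i 1)) := by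
  have h0' : ∀ s, 1 < s → ψ s = 0 := fun s hs => h0 s (by linarith)
  have := ode (hasDeriv hψ h0' hu hc i) (fun r h h' => scaled hψ hb h0 hu i hlap h h')
  simp only [one_smul, zero_smul] at this
  rw [this, ibp1 hψ h0' (fderiv ℝ u 0).contDiff, ← integral_mul_const]
  simp

lemma mean' {n : ℕ} {ψ : ℝ → ℝ} (hψ : ContDiff ℝ 2 ψ) {b : ℝ} (hb : b ≤ 1)
    (h0 : ∀ s, b ≤ s → ψ s = 0)
    {u : EuclideanSpace ℝ (Fin n) → ℝ} (hu : ContDiff ℝ 2 u) (hc : HasCompactSupport u)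
    (e : EuclideanSpace ℝ (Fin n))
    (hlap : ∀ y, ‖y‖^2 < b →
      (∑ j : Fin n, fderiv ℝ (fun y => fderiv ℝ u y (EuclideanSpace.single j 1)) y
      (EuclideanSpace.single j 1)) = 0) :
    ∫ y, 2 * deriv ψ (‖y‖^2) * inner ℝ y e * u y =
      - ((∫ y : EuclideanSpace ℝ (Fin n), ψ (‖y‖^2)) * fderiv ℝ u 0 e) := by
  have h0' : ∀ s, 1 < s → ψ s = 0 := fun s hs => h0 s (by linarith)
  have hd0 := deriv_zero h0'
  have cdψ : Continuous (deriv ψ) := hψ.continuous_deriv (by norm_num)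
  have cu := hu.continuous
  have he : e = ∑ j, e j • EuclideanSpace.single j (1:ℝ) := by
    ext k; simp [Pi.single_apply]
  have e1 : fderiv ℝ u 0 e = ∑ j, e j * fderiv ℝ u 0 (EuclideanSpace.single j 1) := by
    conv_lhs => rw [he]
    simp [map_sum]
  have e2 : (fun y : EuclideanSpace ℝ (Fin n) => 2 * deriv ψ (‖y‖^2) * inner ℝ y e * u y) =
     fun y => ∑ j, e j * (2 * deriv ψ (‖y‖^2) * y j * u y) := by
    ext y
    simp only [PiLp.inner_apply, Finset.mul_sum, Finset.sum_mul]
    refine Finset.sum_congr rfl fun j _ => ?_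
    simp; ring
  rw [e2, integral_finsetSum, e1, Finset.mul_sum, ← Finset.sum_neg_distrib]
  · refine Finset.sum_congr rfl fun j _ => ?_
    rw [integral_const_mul, mean hψ hb h0 hu hc j hlap]; ring
  · intro j _
    exact integ (by fun_prop) (fun y hy => by simp [hd0 _ (one_lt_sq hy)])

lemma oneD {ψ : ℝ → ℝ} (hψ : ContDiff ℝ 2 ψ) (h0 : ∀ s, 1 < s → ψ s = 0) (ha : Antitone ψ)
    {s : ℝ} (hs : 0 ≤ s) : ∫ t : ℝ, |2 * deriv ψ (t^2 + s) * t| = 2 * ψ s := by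
  have hd0 := deriv_zero h0
  have cdψ : Continuous (deriv ψ) := hψ.continuous_deriv (by norm_num)
  have e1 : (fun t : ℝ => |2 * deriv ψ (t^2 + s) * t|) =
      fun t => (fun t => - (deriv ψ (t^2+s) * (2 * t))) |t| := by
    ext t
    simp only [sq_abs, abs_mul, abs_of_nonpos (ha.deriv_nonpos (x := t^2+s)), abs_two]
    ring
  have hbig : ∀ t : ℝ, 1 < |t| → 1 < t^2 + s := by
    intro t ht
    rw [← sq_abs]; nlinarith
  rw [e1, integral_comp_abs (f := fun t => - (deriv ψ (t^2+s) * (2 * t))), integral_neg]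
  have := integral_Ioi_of_hasDerivAt_of_tendsto' (f := fun t => ψ (t^2+s))
    (f' := fun t => deriv ψ (t^2+s) * (2 * t)) (a := 0) (m := 0) ?_ ?_ ?_
  · rw [this]; simp
  · intro x _
    have h1 : HasDerivAt (fun t : ℝ => t^2 + s) (2 * x) x := by
      simpa using (hasDerivAt_pow 2 x).add_const s
    exact ((hψ.differentiable (by norm_num)) (x^2+s)).hasDerivAt.comp x h1
  · apply Integrable.integrableOn
    apply Continuous.integrable_of_hasCompactSupport (by fun_prop)
    apply HasCompactSupport.intro (isCompact_closedBall (0 : ℝ) 1)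
    intro x hx
    have : 1 < |x| := by simpa using hx
    simp [hd0 _ (hbig x this)]
  · refine tendsto_const_nhds.congr' ?_
    filter_upwards [eventually_gt_atTop 1] with t ht
    exact (h0 _ (hbig t (by rwa [abs_of_pos (by linarith)]))).symm

lemma slice {m : ℕ} {ψ : ℝ → ℝ} (hψ : ContDiff ℝ 2 ψ) (h0 : ∀ s, 1 < s → ψ s = 0)
    (ha : Antitone ψ) :
    ∫ y : EuclideanSpace ℝ (Fin (m+1)), |2 * deriv ψ (‖y‖^2) * y 0| =
      2 * ∫ z : EuclideanSpace ℝ (Fin m), ψ (‖z‖^2) := by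
  have hd0 := deriv_zero h0
  have cdψ : Continuous (deriv ψ) := hψ.continuous_deriv (by norm_num)
  set F : EuclideanSpace ℝ (Fin (m+1)) → ℝ := fun y => |2 * deriv ψ (‖y‖^2) * y 0| with hF
  have iF : Integrable F := integ (by fun_prop) (fun y hy => by simp [F, hd0 _ (one_lt_sq hy)])
  have mp1 := (EuclideanSpace.volume_preserving_symm_measurableEquiv_toLp (Fin (m+1))).symm
  have mp2 := (volume_preserving_piFinSuccAbove (fun _ : Fin (m + 1) => ℝ) 0).symm
  have mp := mp1.comp mp2
  have me : MeasurableEmbedding ((MeasurableEquiv.toLp 2 (Fin (m+1) → ℝ)) ∘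
      (MeasurableEquiv.piFinSuccAbove (fun _ : Fin (m + 1) => ℝ) 0).symm) :=
    (MeasurableEquiv.measurableEmbedding _).comp (MeasurableEquiv.measurableEmbedding _)
  have mp3 := (EuclideanSpace.volume_preserving_symm_measurableEquiv_toLp (Fin m)).symm
  rw [← mp.integral_comp me, ← mp3.integral_comp (MeasurableEquiv.measurableEmbedding _)]
  have iF2 := (mp.integrable_comp_emb me).2 iF
  rw [Measure.volume_eq_prod] at iF2 ⊢
  refine (integral_prod_symm _ iF2).trans ?_
  rw [← integral_const_mul]
  congr 1; ext z
  have hz : 0 ≤ ‖WithLp.toLp 2 z‖^2 := by positivity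
  have := oneD hψ h0 ha hz
  change _ = 2 * ψ (‖WithLp.toLp 2 z‖^2)
  rw [← this]
  congr 1; ext t
  simp [F, MeasurableEquiv.piFinSuccAbove, EuclideanSpace.norm_sq_eq, Fin.sum_univ_succ]

lemma sliceE {m : ℕ} {ψ : ℝ → ℝ} (hψ : ContDiff ℝ 2 ψ) (h0 : ∀ s, 1 < s → ψ s = 0)
    (ha : Antitone ψ) (e : EuclideanSpace ℝ (Fin (m+1))) (he : ‖e‖ = 1) :
    ∫ y : EuclideanSpace ℝ (Fin (m+1)), |2 * deriv ψ (‖y‖^2) * inner ℝ y e| =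
      2 * ∫ z : EuclideanSpace ℝ (Fin m), ψ (‖z‖^2) := by
  rw [← slice hψ h0 ha]
  let R := (ℝ ∙ (EuclideanSpace.single (0 : Fin (m+1)) (1:ℝ) - e))ᗮ.reflection
  have hR : R (EuclideanSpace.single (0 : Fin (m+1)) (1:ℝ)) = e :=
    Submodule.reflection_sub (by simp [he])
  rw [← R.measurePreserving.integral_comp R.toHomeomorph.measurableEmbedding]
  congr 1; ext y
  rw [← hR, R.inner_map_map, R.norm_map]
  simp [EuclideanSpace.inner_single_right]

lemma vol_pos (n : ℕ) : 0 < unitBallVol n :=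
  ENNReal.toReal_pos (Metric.measure_ball_pos _ _ one_pos).ne' measure_ball_lt_top.ne

lemma upper {m : ℕ} {ψ : ℝ → ℝ} (hψ : Continuous ψ) (h0 : ∀ s, 1 ≤ s → ψ s = 0)
    (h1 : ∀ s, ψ s ≤ 1) :
    ∫ z : EuclideanSpace ℝ (Fin m), ψ (‖z‖^2) ≤ unitBallVol m := by
  have : unitBallVol m = ∫ z : EuclideanSpace ℝ (Fin m), (Metric.ball 0 1).indicator (fun _ => (1:ℝ)) z := by
    rw [integral_indicator_const _ measurableSet_ball]; simp [unitBallVol, Measure.real]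
  rw [this]
  apply integral_mono
  · exact integ (by fun_prop) (fun y hy => h0 _ (one_lt_sq hy).le)
  · exact (integrable_indicator_iff measurableSet_ball).2 (integrableOn_const measure_ball_lt_top.ne)
  · intro z
    by_cases hz : z ∈ Metric.ball (0 : EuclideanSpace ℝ (Fin m)) 1
    · simpa only [Set.indicator_of_mem hz] using h1 _
    · simp only [Set.indicator_of_notMem hz]
      apply le_of_eq; apply h0
      have : 1 ≤ ‖z‖ := by simpa using hz
      nlinarith

lemma lower {m : ℕ} {ψ : ℝ → ℝ} (hψ : Continuous ψ) (h0 : ∀ s, 1 ≤ s → ψ s = 0)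
    (h1 : ∀ s, 0 ≤ ψ s) {a : ℝ} (ha : 0 < a) (h2 : ∀ s ≤ a^2, ψ s = 1) :
    a^(m+1) * unitBallVol (m+1) ≤ ∫ z : EuclideanSpace ℝ (Fin (m+1)), ψ (‖z‖^2) := by
  have : a^(m+1) * unitBallVol (m+1) = ∫ z : EuclideanSpace ℝ (Fin (m+1)), (Metric.ball 0 a).indicator (fun _ => (1:ℝ)) z := by
    rw [integral_indicator_const _ measurableSet_ball]
    simp only [unitBallVol, Measure.real, smul_eq_mul, mul_one]
    rw [Measure.addHaar_ball _ _ ha.le, ENNReal.toReal_mul, ENNReal.toReal_ofReal (by positivity)]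
    simp
  rw [this]
  apply integral_mono
  · exact (integrable_indicator_iff measurableSet_ball).2 (integrableOn_const measure_ball_lt_top.ne)
  · exact integ (by fun_prop) (fun y hy => h0 _ (one_lt_sq hy).le)
  · intro z
    by_cases hz : z ∈ Metric.ball (0 : EuclideanSpace ℝ (Fin (m+1))) a
    · simp only [Set.indicator_of_mem hz]
      apply le_of_eq; symm; apply h2
      have : ‖z‖ < a := by simpa using hz
      gcongr
    · simpa only [Set.indicator_of_notMem hz] using h1 _

/-- Cut-off extension of a `C^2` function on the ball. -/
lemma extend {n : ℕ} {u : EuclideanSpace ℝ (Fin n) → ℝ} (hu : ContDiffOn ℝ 2 u (Metric.ball 0 1))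
    {r : ℝ} (hr0 : 0 < r) (hr : r < 1) :
    ∃ v : EuclideanSpace ℝ (Fin n) → ℝ, ContDiff ℝ 2 v ∧ HasCompactSupport v ∧
      Set.EqOn v u (Metric.ball 0 r) := by
  let χ : ContDiffBump (0 : EuclideanSpace ℝ (Fin n)) := ⟨r, (r+1)/2, hr0, by linarith⟩
  refine ⟨fun x => χ x * u x, ?_, ?_, ?_⟩
  · rw [contDiff_iff_contDiffAt]
    intro x
    by_cases hx : x ∈ Metric.ball (0 : EuclideanSpace ℝ (Fin n)) 1
    · exact χ.contDiff.contDiffAt.mul (hu.contDiffAt (Metric.isOpen_ball.mem_nhds hx))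
    · have hx' : x ∉ tsupport χ := by
        rw [χ.tsupport_eq]
        simp only [Metric.mem_ball, dist_zero_right, not_lt, Metric.mem_closedBall, not_le] at hx ⊢
        show (r+1)/2 < ‖x‖
        linarith
      have : (fun x => χ x * u x) =ᶠ[𝓝 x] fun _ => 0 := by
        filter_upwards [(notMem_tsupport_iff_eventuallyEq.1 hx')] with z hz
        simp [hz]
      exact contDiffAt_const.congr_of_eventuallyEq this
  · exact χ.hasCompactSupport.mul_right
  · intro x hx
    have : χ x = 1 := χ.one_of_mem_closedBall (Metric.ball_subset_closedBall hx)
    simp [this]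

lemma bound {m : ℕ} {u : EuclideanSpace ℝ (Fin (m+1)) → ℝ}
    (hu : IsHarmonicOn u (Metric.ball 0 1))
    (hb : ∀ y ∈ Metric.ball (0 : EuclideanSpace ℝ (Fin (m+1))) 1, |u y| < 1)
    {a : ℝ} (ha0 : 0 < a) (ha1 : a < 1) (e : EuclideanSpace ℝ (Fin (m+1))) (he : ‖e‖ = 1) :
    a^(m+1) * unitBallVol (m+1) * |fderiv ℝ u 0 e| ≤ 2 * unitBallVol m := by
  obtain ⟨c, hac, hc1⟩ := exists_between ha1
  have hc0 : 0 < c := ha0.trans hac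
  obtain ⟨v, hv, hvc, hvu⟩ := extend hu.1 hc0 hc1
  have hsq : a^2 < c^2 := by gcongr
  have hsq1 : c^2 < 1 := by nlinarith
  let ψ : ℝ → ℝ := fun s => Real.smoothTransition ((c^2 - s) / (c^2 - a^2))
  have hψ : ContDiff ℝ 2 ψ := Real.smoothTransition.contDiff.comp (by fun_prop)
  have hψ0 : ∀ s, c^2 ≤ s → ψ s = 0 := fun s hs =>
    Real.smoothTransition.zero_of_nonpos (div_nonpos_of_nonpos_of_nonneg (by linarith) (by linarith))
  have hψ1 : ∀ s ≤ a^2, ψ s = 1 := fun s hs =>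
    Real.smoothTransition.one_of_one_le ((one_le_div (by linarith)).2 (by linarith))
  have hψa : Antitone ψ := by
    intro s t hst
    apply Real.smoothTransition.monotone
    apply div_le_div_of_nonneg_right _ (by linarith)
    linarith
  have hψ0' : ∀ s, 1 ≤ s → ψ s = 0 := fun s hs => hψ0 s (by linarith)
  have hd0 := deriv_zero (fun s (hs : 1 < s) => hψ0' s hs.le)
  have cdψ : Continuous (deriv ψ) := hψ.continuous_deriv (by norm_num)
  have cv := hv.continuous
  have hball : ∀ y : EuclideanSpace ℝ (Fin (m+1)), ‖y‖^2 < c^2 → y ∈ Metric.ball (0 : EuclideanSpace ℝ (Fin (m+1))) c := by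
    intro y hy
    simpa using lt_of_pow_lt_pow_left₀ 2 hc0.le hy
  have hev : ∀ y ∈ Metric.ball (0 : EuclideanSpace ℝ (Fin (m+1))) c, v =ᶠ[𝓝 y] u := fun y hy =>
    hvu.eventuallyEq_of_mem (Metric.isOpen_ball.mem_nhds hy)
  have hsub : Metric.ball (0 : EuclideanSpace ℝ (Fin (m+1))) c ⊆ Metric.ball 0 1 := Metric.ball_subset_ball hc1.le
  have hmean := mean' hψ hsq1.le hψ0 hv hvc e ?_
  · have h1 : |(∫ y : EuclideanSpace ℝ (Fin (m+1)), ψ (‖y‖^2)) * fderiv ℝ v 0 e| ≤ 2 * unitBallVol m := by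
      rw [← abs_neg, ← hmean]
      calc _ ≤ ∫ y, |2 * deriv ψ (‖y‖^2) * inner ℝ y e * v y| := abs_integral_le_integral_abs
        _ ≤ ∫ y, |2 * deriv ψ (‖y‖^2) * inner ℝ y e| := by
          apply integral_mono
          · exact integ (by fun_prop) (fun y hy => by simp [hd0 _ (one_lt_sq hy)])
          · exact integ (by fun_prop) (fun y hy => by simp [hd0 _ (one_lt_sq hy)])
          · intro y
            simp only
            by_cases h : ‖y‖^2 ≤ c^2
            · have hcl : |v y| ≤ 1 := by
                have hy : y ∈ closure (Metric.ball (0 : EuclideanSpace ℝ (Fin (m+1))) c) := by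
                  rw [closure_ball _ hc0.ne']
                  simpa using le_of_sq_le_sq h hc0.le
                refine closure_minimal (s := Metric.ball (0 : EuclideanSpace ℝ (Fin (m+1))) c) (t := {y | |v y| ≤ 1}) ?_ (isClosed_le (by fun_prop) continuous_const) hy
                intro z hz
                simp only [Set.mem_ofPred_eq, hvu hz]
                exact (hb z (hsub hz)).le
              rw [abs_mul _ (v y)]
              exact mul_le_of_le_one_right (abs_nonneg _) hcl
            · simp [deriv_zero (fun s hs => hψ0 s (le_of_lt hs)) _ (not_le.1 h)]
        _ = 2 * ∫ z : EuclideanSpace ℝ (Fin m), ψ (‖z‖^2) :=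
          sliceE hψ (fun s hs => hψ0' s hs.le) hψa e he
        _ ≤ 2 * unitBallVol m := by
          gcongr
          exact upper hψ.continuous hψ0' (fun s => Real.smoothTransition.le_one _)
    have h2 := lower (m := m) hψ.continuous hψ0' (fun s => Real.smoothTransition.nonneg _) ha0 hψ1
    have h3 : fderiv ℝ v 0 = fderiv ℝ u 0 := (hev 0 (by simpa using hc0)).fderiv_eq
    have h4 : 0 ≤ a^(m+1) * unitBallVol (m+1) := mul_nonneg (by positivity) (vol_pos _).le
    rw [abs_mul, h3, abs_of_nonneg (h4.trans h2)] at h1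
    exact le_trans (by gcongr) h1
  · intro y hy
    rw [← hu.2 y (hsub (hball y hy))]
    refine Finset.sum_congr rfl fun j _ => ?_
    have : (fun y => fderiv ℝ v y (EuclideanSpace.single j 1)) =ᶠ[𝓝 y] (fun y => fderiv ℝ u y (EuclideanSpace.single j 1)) := by
      filter_upwards [(hev y (hball y hy)).fderiv (𝕜 := ℝ)] with z hz
      rw [hz]
    rw [this.fderiv_eq]

lemma bound' {m : ℕ} {u : EuclideanSpace ℝ (Fin (m+1)) → ℝ}
    (hu : IsHarmonicOn u (Metric.ball 0 1))
    (hb : ∀ y ∈ Metric.ball (0 : EuclideanSpace ℝ (Fin (m+1))) 1, |u y| < 1)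
    (e : EuclideanSpace ℝ (Fin (m+1))) (he : ‖e‖ = 1) :
    unitBallVol (m+1) * |fderiv ℝ u 0 e| ≤ 2 * unitBallVol m := by
  have h : Tendsto (fun a : ℝ => a^(m+1) * unitBallVol (m+1) * |fderiv ℝ u 0 e|) (𝓝[<] 1)
      (𝓝 ((1:ℝ)^(m+1) * unitBallVol (m+1) * |fderiv ℝ u 0 e|)) :=
    (Continuous.tendsto (by fun_prop) 1).mono_left nhdsWithin_le_nhds
  rw [one_pow, one_mul] at h
  apply le_of_tendsto h
  filter_upwards [Ioo_mem_nhdsLT (show (0:ℝ) < 1 by norm_num)] with a ha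
  exact bound hu hb ha.1 ha.2 e he

end HS

theorem harmonic_schwarz_at_zero (n : Nat)
    (u : EuclideanSpace Real (Fin n) -> Real)
    (hu : IsHarmonicOn u (Metric.ball 0 1))
    (hb : ∀ y ∈ Metric.ball (0 : EuclideanSpace Real (Fin n)) 1, |u y| < 1) :
    ‖fderiv Real u 0‖ ≤ 2 * unitBallVol (n-1) / unitBallVol n := by
  have hnn : 0 ≤ 2 * unitBallVol (n-1) / unitBallVol n :=
    div_nonneg (mul_nonneg (by norm_num) (HS.vol_pos _).le) (HS.vol_pos _).le
  cases n with
  | zero =>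
    have : fderiv ℝ u 0 = 0 := by
      ext x; rw [Subsingleton.elim x 0]; simp
    rw [this, norm_zero]; exact hnn
  | succ m =>
    simp only [Nat.add_sub_cancel] at hnn ⊢
    apply ContinuousLinearMap.opNorm_le_of_unit_norm hnn
    intro e he
    rw [le_div_iff₀ (HS.vol_pos _), mul_comm]
    exact HS.bound' hu hb e he
end

section
/- For each integer n ≥ 4, the function Φ(ρ) = ∫_{-1}^{1} |t - (n-2)ρ/n| · (1-t²)^{(n-3)/2} · (1 - 2tρ + ρ²)^{-(n-2)/2} dt is strictly decreasing on [0, 1], and its maximum on [0,1] equals Φ(0) = 2/(n-1). -/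
lemma poly_pos (L q : ℝ) (hL : 1 ≤ L) (hq0 : 0 ≤ q) (hq1 : q ≤ 1)  :
    0 < ((L+1)^2-L^2*q)*((L+1)-L*q)*((1-L)*(2*L+1)+2*(2*L-1)*(L+1)+(2*L-1)*(1-L)*q)
      - (2*L+1-(2*L-1)*q)*((L+1)^3-2*L^2*(L+1)*q-L^2*(1-L)*q^2) := by
  obtain ⟨p, rfl⟩ : ∃ p, L = 1 + p := ⟨L - 1, by ring⟩
  obtain ⟨r, hr⟩ : ∃ r, r = 1 - q := ⟨_, rfl⟩
  have hp : 0 ≤ p := by linarith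
  have hr0 : 0 ≤ r := by linarith
  have key : ((1+p+1)^2-(1+p)^2*q)*((1+p+1)-(1+p)*q)*((1-(1+p))*(2*(1+p)+1)+2*(2*(1+p)-1)*((1+p)+1)+(2*(1+p)-1)*(1-(1+p))*q)
      - (2*(1+p)+1-(2*(1+p)-1)*q)*((1+p+1)^3-2*(1+p)^2*(1+p+1)*q-(1+p)^2*(1-(1+p))*q^2)
      = 4 + (4*q^2*r + 8*q*r^2+4*r^3) + p*(20*q^3+88*q^2*r+120*q*r^2+52*r^3)
        + p^2*(12*q^3+84*q^2*r+153*q*r^2+82*r^3) + p^3*(22*q^2*r+73*q*r^2+55*r^3)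
        + p^4*(12*q*r^2+17*r^3) + p^5*(2*r^3) := by
    subst hr; ring
  rw [key]; positivity

noncomputable def Hf (a x : ℝ) : ℝ := ∫ s in (0:ℝ)..x, s^(a-1) * (1-s)^(-(1/2):ℝ)

lemma Hf_deriv (a x : ℝ) (ha : 1 < a) (hx : x < 1) :
    HasDerivAt (Hf a) (x^(a-1) * (1-x)^(-(1/2):ℝ)) x := by
  have hc : ∀ s : ℝ, s < 1 → ContinuousAt (fun s : ℝ => s^(a-1) * (1-s)^(-(1/2):ℝ)) s := by
    intro s hs
    apply ContinuousAt.mul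
    · exact Real.continuousAt_rpow_const _ _ (Or.inr (by linarith))
    · exact ContinuousAt.rpow_const (by fun_prop) (Or.inl (by linarith))
  have hcO : ContinuousOn (fun s : ℝ => s^(a-1) * (1-s)^(-(1/2):ℝ)) (Set.Iio 1) :=
    fun s hs => (hc s hs).continuousWithinAt
  apply intervalIntegral.integral_hasDerivAt_right
  · apply ContinuousOn.intervalIntegrable
    apply hcO.mono
    intro s hs
    rcases Set.mem_uIcc.1 hs with h | h
    · exact lt_of_le_of_lt h.2 hx
    · exact lt_of_le_of_lt h.2 one_pos
  · exact hcO.stronglyMeasurableAtFilter isOpen_Iio x hx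
  · exact hc x hx

lemma alg_id (A B a c m x D P R : ℝ) (hD : D ≠ 0) (hP : P ≠ 0) (hR : R ≠ 0) (ha : a ≠ 0)
    (eD : D = 1+(1-2*c)*x) (eP : P = 1-m*x) (eR : R = 1-c*x) (hrel : 1 - c = 2*a*(c - m)) :
    (((1-2*c^2*x-c^2*(1-2*c)*x^2)/D^2 * a * A * B
        + A * (x*(1-c^2*x)/D) * ((1-2*c) * (1/2) * (B / D))) * (a*P)
        - A * (x*(1-c^2*x)/D) * B * (a * (-m))) / (a*P)^2 -
        A * (B / R) * ((1-2*c^2*x-c^2*(1-2*c)*x^2)/D^2) =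
    A * B * x / (a * P^2 * R * D^2 * 2) *
        ((1-c^2*x)*R*(1-2*c+2*m+m*(1-2*c)*x)-(1-c)*P*(1-2*c^2*x-c^2*(1-2*c)*x^2)) := by
  rw [hrel]
  field_simp
  subst eD eP eR
  ring

lemma G_pos (L q : ℝ) (hL : 1 ≤ L) (hq0 : 0 < q) (hq1 : q < 1) (c m a : ℝ)
    (hc : c = L/(L+1)) (hm : m = (2*L-1)/(2*L+1)) (ha : a = L + 1/2) :
    Hf a (q*(1-c^2*q)/(1+(1-2*c)*q)) <
      (q*(1-c^2*q)/(1+(1-2*c)*q))^a * (1+(1-2*c)*q)^(1/2:ℝ) / (a*(1-m*q)) := by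
  have hc0 : 0 < c := by rw [hc]; positivity
  have hc1 : c < 1 := by rw [hc, div_lt_one (by linarith)]; linarith
  have hm0 : 0 < m := by rw [hm]; apply div_pos <;> linarith
  have hm1 : m < 1 := by rw [hm, div_lt_one (by linarith)]; linarith
  have hD : ∀ x ∈ Set.Icc (0:ℝ) 1, 0 < 1+(1-2*c)*x := by
    rintro x ⟨h0, h1⟩; nlinarith
  have hX : ∀ x ∈ Set.Icc (0:ℝ) 1, 0 < 1-c^2*x := by
    rintro x ⟨h0, h1⟩; nlinarith
  have hcx : ∀ x ∈ Set.Icc (0:ℝ) 1, 0 < 1-c*x := by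
    rintro x ⟨h0, h1⟩; nlinarith
  have hmx : ∀ x ∈ Set.Icc (0:ℝ) 1, 0 < 1-m*x := by
    rintro x ⟨h0, h1⟩; nlinarith
  have h1k : ∀ x ∈ Set.Icc (0:ℝ) 1, 1 - x*(1-c^2*x)/(1+(1-2*c)*x) = (1-c*x)^2/(1+(1-2*c)*x) := by
    intro x hx
    have := (hD x hx).ne'
    rw [eq_div_iff this, sub_mul, div_mul_cancel₀ _ this]
    ring
  have hk1 : ∀ x ∈ Set.Icc (0:ℝ) 1, x*(1-c^2*x)/(1+(1-2*c)*x) < 1 := by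
    intro x hx
    have h1 := h1k x hx
    have : 0 < (1-c*x)^2/(1+(1-2*c)*x) := div_pos (pow_pos (hcx x hx) 2) (hD x hx)
    linarith
  set k : ℝ → ℝ := fun x => x*(1-c^2*x)/(1+(1-2*c)*x) with hk
  set G : ℝ → ℝ := fun x => (k x)^a * (1+(1-2*c)*x)^(1/2:ℝ) / (a*(1-m*x)) - Hf a (k x) with hG
  have hkd : ∀ x ∈ Set.Icc (0:ℝ) 1, HasDerivAt k ((1-2*c^2*x-c^2*(1-2*c)*x^2)/(1+(1-2*c)*x)^2) x := by
    intro x hx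
    have h1 : HasDerivAt (fun x : ℝ => x*(1-c^2*x)) (1-2*c^2*x) x := by
      have := (hasDerivAt_id x).mul (((hasDerivAt_id x).const_mul (c^2)).const_sub 1)
      exact this.congr_deriv (by simp; ring)
    have h2 : HasDerivAt (fun x : ℝ => 1+(1-2*c)*x) (1-2*c) x := by
      have := (((hasDerivAt_id x).const_mul (1-2*c)).const_add 1)
      exact this.congr_deriv (by simp)
    exact (h1.div h2 (hD x hx).ne').congr_deriv (by congr 1; ring)
  have hGd : ∀ x ∈ Set.Icc (0:ℝ) 1, HasDerivAt G
      ((((1-2*c^2*x-c^2*(1-2*c)*x^2)/(1+(1-2*c)*x)^2 * a * (k x)^(a-1) * (1+(1-2*c)*x)^(1/2:ℝ)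
        + (k x)^a * ((1-2*c) * (1/2) * (1+(1-2*c)*x)^(1/2-1:ℝ))) * (a*(1-m*x))
        - (k x)^a * (1+(1-2*c)*x)^(1/2:ℝ) * (a * (-m))) / (a*(1-m*x))^2 -
        (k x)^(a-1) * (1- k x)^(-(1/2):ℝ) * ((1-2*c^2*x-c^2*(1-2*c)*x^2)/(1+(1-2*c)*x)^2)) x := by
    intro x hx
    have h2 : HasDerivAt (fun x : ℝ => 1+(1-2*c)*x) (1-2*c) x := by
      have := (((hasDerivAt_id x).const_mul (1-2*c)).const_add 1)
      exact this.congr_deriv (by simp)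
    have h3 : HasDerivAt (fun x : ℝ => a*(1-m*x)) (a*(-m)) x := by
      have := (((hasDerivAt_id x).const_mul m).const_sub 1).const_mul a
      exact this.congr_deriv (by simp)
    have h4 := (hkd x hx).rpow_const (p := a) (Or.inr (by linarith))
    have h5 := h2.rpow_const (p := (1/2:ℝ)) (Or.inl (hD x hx).ne')
    have h6 := (h4.mul h5).div h3 (mul_pos (by linarith) (hmx x hx)).ne'
    have h7 := (Hf_deriv a (k x) (by linarith) (hk1 x hx)).comp x (hkd x hx)
    exact h6.sub h7
  have hmono : StrictMonoOn G (Set.Icc 0 1) := by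
    apply strictMonoOn_of_deriv_pos (convex_Icc 0 1)
    · exact fun x hx => (hGd x hx).continuousAt.continuousWithinAt
    · intro x hx
      rw [interior_Icc] at hx
      have hx' := Set.Ioo_subset_Icc_self hx
      rw [(hGd x hx').deriv]
      have hDx := hD x hx'
      have hXx := hX x hx'
      have hcxx := hcx x hx'
      have hmxx := hmx x hx'
      have hkpos : 0 < k x := div_pos (mul_pos hx.1 hXx) hDx
      have e1 : (1 - k x)^(-(1/2):ℝ) = (1+(1-2*c)*x)^(1/2:ℝ) / (1-c*x) := by
        rw [show 1 - k x = (1-c*x)^2/(1+(1-2*c)*x) from h1k x hx',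
          Real.rpow_neg (by positivity), Real.div_rpow (by positivity) hDx.le,
          ← Real.sqrt_eq_rpow, Real.sqrt_sq hcxx.le, inv_div]
      have e2 : (k x)^a = (k x)^(a-1) * k x := by
        rw [Real.rpow_sub_one hkpos.ne']; field_simp
      have e3 : (1+(1-2*c)*x)^(1/2-1:ℝ) = (1+(1-2*c)*x)^(1/2:ℝ) / (1+(1-2*c)*x) := by
        rw [Real.rpow_sub_one hDx.ne']
      have hkx : k x = x*(1-c^2*x)/(1+(1-2*c)*x) := rfl
      rw [e1, e2, e3]
      have hA : 0 < (k x)^(a-1) := Real.rpow_pos_of_pos hkpos _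
      have hB : 0 < (1+(1-2*c)*x)^(1/2:ℝ) := Real.rpow_pos_of_pos hDx _
      generalize (k x)^(a-1) = A at *
      generalize (1+(1-2*c)*x)^(1/2:ℝ) = B at *
      rw [hkx]
      have hP := poly_pos L x hL hx.1.le hx.2.le
      have hpos : 0 < A * B * x / (a * (1-m*x)^2 * (1-c*x) * (1+(1-2*c)*x)^2 * 2)
         / ((L+1)^4*(2*L+1)) := by
        have := hx.1
        have : 0 < a := by linarith
        positivity
      have := mul_pos hpos hP
      have ha0 : 0 < a := by linarith
      have hL1 : L + 1 ≠ 0 := by linarith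
      have hL2 : 2*L + 1 ≠ 0 := by linarith
      have s1 : (A * B * x / (a * (1-m*x)^2 * (1-c*x) * (1+(1-2*c)*x)^2 * 2)
         / ((L+1)^4*(2*L+1)) * (((L+1)^2-L^2*x)*((L+1)-L*x)*((1-L)*(2*L+1)+2*(2*L-1)*(L+1)+(2*L-1)*(1-L)*x)
      - (2*L+1-(2*L-1)*x)*((L+1)^3-2*L^2*(L+1)*x-L^2*(1-L)*x^2))) =
        A * B * x / (a * (1-m*x)^2 * (1-c*x) * (1+(1-2*c)*x)^2 * 2) *
        ((1-c^2*x)*(1-c*x)*(1-2*c+2*m+m*(1-2*c)*x)-(1-c)*(1-m*x)*(1-2*c^2*x-c^2*(1-2*c)*x^2)) := by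
        rw [div_mul_eq_mul_div, mul_div_assoc]
        congr 1
        rw [hc, hm]
        field_simp
        ring
      rw [s1] at this
      have hrel : 1 - c = 2*a*(c - m) := by
        rw [hc, hm, ha]; field_simp; ring
      rw [← alg_id A B a c m x _ _ _ hDx.ne' hmxx.ne' hcxx.ne' ha0.ne' rfl rfl rfl hrel] at this
      exact this
  have h0 : G 0 = 0 := by
    simp [hG, hk, Hf, Real.zero_rpow (show a ≠ 0 by linarith)]
  have := hmono (Set.left_mem_Icc.2 zero_le_one) ⟨hq0.le, hq1.le⟩ hq0
  rw [h0] at this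
  simp only [hG] at this
  linarith


noncomputable def Psi (L ρ t : ℝ) : ℝ :=
  (L/(L+1))/ρ * ((1-t^2)^(L+1/2) * (1-2*t*ρ+ρ^2)^(-L)
    - (L+1/2)*(1-(2*L-1)/(2*L+1)*ρ^2) * (ρ^2)^(-(L+1/2)) *
      Hf (L+1/2) (ρ^2*((1-t^2)/(1-2*t*ρ+ρ^2))))

lemma D_pos {ρ t : ℝ} (h0 : 0 ≤ ρ) (h1 : ρ < 1) (ht : t ≤ 1) : 0 < 1-2*t*ρ+ρ^2 := by
  nlinarith [mul_nonneg h0 (sub_nonneg.2 ht), pow_pos (sub_pos.2 h1) 2]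

lemma one_sub_eq {ρ t : ℝ} (hD : 0 < 1-2*t*ρ+ρ^2) :
    1 - ρ^2*((1-t^2)/(1-2*t*ρ+ρ^2)) = (1-t*ρ)^2/(1-2*t*ρ+ρ^2) := by
  rw [eq_div_iff hD.ne', sub_mul, mul_assoc (ρ^2), div_mul_cancel₀ _ hD.ne']
  ring

lemma arg_lt {ρ t : ℝ} (h0 : 0 ≤ ρ) (h1 : ρ < 1) (ht : t ≤ 1) :
    ρ^2*((1-t^2)/(1-2*t*ρ+ρ^2)) < 1 := by
  have hD := D_pos h0 h1 ht
  have h := one_sub_eq hD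
  have : 0 < 1 - t*ρ := by nlinarith
  have : 0 < (1-t*ρ)^2/(1-2*t*ρ+ρ^2) := by positivity
  linarith

lemma hD_deriv_t (ρ t : ℝ) : HasDerivAt (fun t : ℝ => 1-2*t*ρ+ρ^2) (-(2*ρ)) t := by
  have := ((((hasDerivAt_id t).const_mul 2).mul_const ρ).const_sub 1).add_const (ρ^2)
  exact this.congr_deriv (by simp)

lemma hX_deriv (t : ℝ) : HasDerivAt (fun t : ℝ => 1-t^2) (-(2*t)) t := by
  have := (hasDerivAt_pow 2 t).const_sub 1
  exact this.congr_deriv (by simp)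

lemma Psi_continuousOn {L ρ : ℝ} (hL : 1 ≤ L) (h0 : 0 < ρ) (h1 : ρ < 1) :
    ContinuousOn (Psi L ρ) (Set.Icc (-1) 1) := by
  intro t ht
  apply ContinuousAt.continuousWithinAt
  have hD := D_pos h0.le h1 ht.2
  have hH := (Hf_deriv (L+1/2) _ (by linarith) (arg_lt h0.le h1 ht.2)).continuousAt
  have hD' := (hD_deriv_t ρ t).continuousAt
  have hX' := (hX_deriv t).continuousAt
  have h3 : ContinuousAt (fun t : ℝ => Hf (L+1/2) (ρ^2*((1-t^2)/(1-2*t*ρ+ρ^2)))) t := by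
    apply ContinuousAt.comp (f := fun t : ℝ => ρ^2*((1-t^2)/(1-2*t*ρ+ρ^2))) hH
    exact (hX'.div hD' hD.ne').const_mul _
  unfold Psi
  exact ((hX'.rpow_const (Or.inr (by linarith))).mul (hD'.rpow_const (Or.inl hD.ne'))
    |>.sub (h3.const_mul _)).const_mul _

lemma alg2 (L ρ t c W K D R : ℝ) (hρ : ρ ≠ 0) (hD : D ≠ 0) (hR : R ≠ 0) (hL : L + 1 ≠ 0)
    (hL2 : 2*L+1 ≠ 0) (eD : D = 1-2*t*ρ+ρ^2) (eR : R = 1-t*ρ) (hc : c = L/(L+1)) :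
    c/ρ * ((-(2*t) * (L+1/2) * W * (K*D) + W*(1-t^2) * (-(2*ρ) * (-L) * K))
     - (L+1/2)*(1-(2*L-1)/(2*L+1)*ρ^2) * (W * K * D^2 / R / ρ^2 *
       (ρ^2 * ((-(2*t) * D - (1-t^2) * (-(2*ρ)))/D^2)))) =
    W * K * (-c*D + 2*L*(t-c*ρ)*(t-ρ)) := by
  have e : (-(2*t) * D - (1-t^2) * (-(2*ρ))) = -2*(t-ρ)*R := by subst eD eR; ring
  have e' : (L+1/2)*(1-(2*L-1)/(2*L+1)*ρ^2) = (2*L+1-(2*L-1)*ρ^2)/2 := by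
    have hL3 : L*2+1 ≠ 0 := by rwa [mul_comm]
    field_simp
  rw [e, e', hc]
  field_simp
  subst eD eR
  ring

lemma Psi_deriv {L ρ t : ℝ} (hL : 1 ≤ L) (h0 : 0 < ρ) (h1 : ρ < 1) (ht : t ∈ Set.Ioo (-1:ℝ) 1) :
    HasDerivAt (Psi L ρ) ((1-t^2)^(L-1/2) * (1-2*t*ρ+ρ^2)^(-L-1) *
      (-(L/(L+1))*(1-2*t*ρ+ρ^2) + 2*L*(t-(L/(L+1))*ρ)*(t-ρ))) t := by
  have hD := D_pos h0.le h1 ht.2.le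
  have hX : 0 < 1 - t^2 := by nlinarith [ht.1, ht.2]
  have hR : 0 < 1 - t*ρ := by nlinarith [ht.1, ht.2]
  have hD' := hD_deriv_t ρ t
  have hX' := hX_deriv t
  have hH := (Hf_deriv (L+1/2) _ (by linarith) (arg_lt h0.le h1 ht.2.le))
  have h3 := HasDerivAt.comp (h := fun t : ℝ => ρ^2*((1-t^2)/(1-2*t*ρ+ρ^2))) t hH
    ((hX'.div hD' hD.ne').const_mul (ρ^2))
  have h4 := (((hX'.rpow_const (p := L+1/2) (Or.inl hX.ne')).mul
    (hD'.rpow_const (p := -L) (Or.inl hD.ne'))).sub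
    (h3.const_mul ((L+1/2)*(1-(2*L-1)/(2*L+1)*ρ^2) * (ρ^2)^(-(L+1/2))))).const_mul ((L/(L+1))/ρ)
  refine HasDerivAt.congr_deriv h4 ?_
  rw [← alg2 L ρ t (L/(L+1)) _ _ _ _ h0.ne' hD.ne' hR.ne' (by linarith) (by linarith) rfl rfl rfl]
  have e0 : L + 1/2 - 1 = L - 1/2 := by ring
  have e1 : (1-t^2)^(L+1/2) = (1-t^2)^(L-1/2) * (1-t^2) := by
    rw [← Real.rpow_add_one hX.ne']; congr 1; ring
  have e2 : (1-2*t*ρ+ρ^2)^(-L) = (1-2*t*ρ+ρ^2)^(-L-1) * (1-2*t*ρ+ρ^2) := by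
    rw [← Real.rpow_add_one hD.ne']; congr 1; ring
  have e3 : (ρ^2)^(-(L+1/2)) * ((ρ^2*((1-t^2)/(1-2*t*ρ+ρ^2)))^(L-1/2) *
      (1 - ρ^2*((1-t^2)/(1-2*t*ρ+ρ^2)))^(-(1/2):ℝ)) =
      (1-t^2)^(L-1/2) * (1-2*t*ρ+ρ^2)^(-L-1) * (1-2*t*ρ+ρ^2)^2 / (1-t*ρ) / ρ^2 := by
    rw [one_sub_eq hD, Real.mul_rpow (by positivity) (by positivity),
      Real.div_rpow hX.le hD.le, Real.rpow_neg (show 0 ≤ (1-t*ρ)^2/(1-2*t*ρ+ρ^2) by positivity),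
      Real.div_rpow (by positivity) hD.le, ← Real.sqrt_eq_rpow, Real.sqrt_sq hR.le, ← Real.sqrt_eq_rpow,
      show -(L+1/2) = -(L-1/2) - 1 by ring, Real.rpow_sub_one (by positivity),
      Real.rpow_neg (by positivity : (0:ℝ) ≤ ρ^2)]
    have e4 : (1-2*t*ρ+ρ^2)^(-L-1) * (1-2*t*ρ+ρ^2)^2 =
        √(1-2*t*ρ+ρ^2) / (1-2*t*ρ+ρ^2)^(L-1/2) := by
      rw [Real.sqrt_eq_rpow, ← Real.rpow_sub hD, ← Real.rpow_add_natCast hD.ne']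
      congr 1; push_cast; ring
    rw [mul_assoc ((1-t^2)^(L-1/2)), e4]
    have : 0 < (ρ^2)^(L-1/2) := Real.rpow_pos_of_pos (by positivity) _
    have : 0 < √(1-2*t*ρ+ρ^2) := Real.sqrt_pos.2 hD
    field_simp
  rw [e0, e1, e2, ← e3]
  ring

lemma Psi_one {L ρ : ℝ} (hL : 1 ≤ L) : Psi L ρ 1 = 0 := by
  simp [Psi, Hf, Real.zero_rpow (show L+2⁻¹ ≠ 0 by linarith)]
lemma Psi_neg_one {L ρ : ℝ} (hL : 1 ≤ L) : Psi L ρ (-1) = 0 := by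
  simp [Psi, Hf, Real.zero_rpow (show L+2⁻¹ ≠ 0 by linarith)]

lemma Psi_pos {L ρ : ℝ} (hL : 1 ≤ L) (h0 : 0 < ρ) (h1 : ρ < 1) : 0 < Psi L ρ (L/(L+1)*ρ) := by
  have hG := G_pos L (ρ^2) hL (by positivity) (by nlinarith) _ _ _ rfl rfl rfl
  have hc1 : L/(L+1) < 1 := by rw [div_lt_one (by linarith)]; linarith
  have hc0 : 0 < L/(L+1) := by positivity
  have hm : 0 < 1 - (2*L-1)/(2*L+1)*ρ^2 := by
    have : (2*L-1)/(2*L+1) < 1 := by rw [div_lt_one (by linarith)]; linarith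
    nlinarith [pow_pos h0 2]
  have hD := D_pos h0.le h1 (show L/(L+1)*ρ ≤ 1 by nlinarith)
  unfold Psi
  set c := L/(L+1) with hc
  have hX : 0 < 1 - (c*ρ)^2 := by
    have : c*ρ < 1 := by nlinarith
    nlinarith [mul_pos hc0 h0]
  rw [show 1 + (1-2*c)*ρ^2 = 1-2*(c*ρ)*ρ+ρ^2 by ring, show 1-c^2*ρ^2 = 1-(c*ρ)^2 by ring,
    mul_div_assoc] at hG
  set D := 1-2*(c*ρ)*ρ+ρ^2
  set X := 1-(c*ρ)^2
  rw [lt_div_iff₀ (by positivity), Real.mul_rpow (by positivity) (by positivity),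
    Real.div_rpow hX.le hD.le] at hG
  have hq : 0 < (ρ^2)^(L+1/2) := Real.rpow_pos_of_pos (by positivity) _
  have e : X^(L+1/2) * D^(-L) = (ρ^2)^(-(L+1/2)) * ((ρ^2)^(L+1/2) * (X^(L+1/2)/D^(L+1/2)) * D^(1/2:ℝ)) := by
    have : D^(-L) = D^(1/2:ℝ) / D^(L+1/2) := by
      rw [← Real.rpow_sub hD]; congr 1; ring
    rw [this, Real.rpow_neg (by positivity)]
    field_simp
  have hq' : 0 < (ρ^2)^(-(L+1/2)) := Real.rpow_pos_of_pos (by positivity) _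
  apply mul_pos (by positivity)
  rw [e]
  have := mul_lt_mul_of_pos_left hG hq'
  linarith


open MeasureTheory Set Filter Topology

noncomputable def FF (L ρ t : ℝ) : ℝ :=
  |t - L/(L+1) * ρ| * (1 - t^2) ^ (L-1/2) * (1 - 2*t*ρ + ρ^2) ^ (-L)

lemma ae_ne_real (a : ℝ) : ∀ᵐ t : ℝ, t ≠ a := by
  have : ({a}ᶜ : Set ℝ) ∈ ae (volume : Measure ℝ) := compl_mem_ae_iff.2 (measure_singleton a)
  exact this

lemma FF_meas (L ρ : ℝ) : Measurable (FF L ρ) := by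
  unfold FF; fun_prop

lemma c_bounds {L : ℝ} (hL : 1 ≤ L) : 0 < L/(L+1) ∧ L/(L+1) < 1 :=
  ⟨by positivity, by rw [div_lt_one (by linarith)]; linarith⟩

lemma abs_le_two {L ρ t : ℝ} (hL : 1 ≤ L) (hρ : ρ ∈ Icc (0:ℝ) 1) (ht : t ∈ Icc (-1:ℝ) 1) :
    |t - L/(L+1) * ρ| ≤ 2 := by
  obtain ⟨h0, h1⟩ := c_bounds hL
  rw [abs_le]
  constructor <;> nlinarith [hρ.1, hρ.2, ht.1, ht.2]

lemma Phi_cont {L : ℝ} (hL : 1 ≤ L) :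
    ContinuousOn (fun ρ : ℝ => ∫ t in (-1:ℝ)..1, FF L ρ t) (Icc 0 1) := by
  intro ρ hρ
  apply intervalIntegral.continuousWithinAt_of_dominated_interval
    (bound := fun t => 2 * √(1 - t^2)⁻¹)
  · exact Eventually.of_forall fun x => (FF_meas L x).aestronglyMeasurable
  · filter_upwards [self_mem_nhdsWithin] with x hx
    filter_upwards [ae_ne_real 1] with t ht1 ht
    rw [uIoc_of_le (by norm_num)] at ht
    have ht' : t < 1 := lt_of_le_of_ne ht.2 ht1
    have hX : 0 < 1 - t^2 := by nlinarith [ht.1]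
    have hXD : 1 - t^2 ≤ 1 - 2*t*x + x^2 := by nlinarith [sq_nonneg (t-x)]
    have hD : 0 < 1 - 2*t*x + x^2 := by linarith
    have h2 := abs_le_two hL hx ⟨ht.1.le, ht.2⟩
    have h3 : (1 - 2*t*x + x^2)^(-L) ≤ (1 - t^2)^(-L) :=
      Real.rpow_le_rpow_of_nonpos hX hXD (by linarith)
    have h4 : (1 - t^2)^(L-1/2) * (1-t^2)^(-L) = √(1 - t^2)⁻¹ := by
      rw [← Real.rpow_add hX, Real.sqrt_eq_rpow, Real.inv_rpow hX.le, ← Real.rpow_neg hX.le]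
      congr 1; ring
    rw [Real.norm_of_nonneg (by unfold FF; positivity), ← h4]
    unfold FF
    rw [mul_assoc]
    gcongr
  · exact (Polynomial.Chebyshev.intervalIntegrable_sqrt_one_sub_sq_inv).const_mul 2
  · filter_upwards [ae_ne_real 1] with t ht1 ht
    rw [uIoc_of_le (by norm_num)] at ht
    have ht' : t < 1 := lt_of_le_of_ne ht.2 ht1
    have hX : 0 < 1 - t^2 := by nlinarith [ht.1]
    have hXD : 1 - t^2 ≤ 1 - 2*t*ρ + ρ^2 := by nlinarith [sq_nonneg (t-ρ)]
    apply ContinuousAt.continuousWithinAt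
    unfold FF
    exact ContinuousAt.mul (by fun_prop) (ContinuousAt.rpow_const (by fun_prop) (Or.inl (by linarith)))

lemma FF_int {L ρ : ℝ} (hL : 1 ≤ L) (h0 : 0 ≤ ρ) (h1 : ρ < 1) :
    IntervalIntegrable (FF L ρ) volume (-1) 1 := by
  apply ContinuousOn.intervalIntegrable
  rw [uIcc_of_le (by norm_num)]
  intro t ht
  apply ContinuousAt.continuousWithinAt
  have hD := D_pos h0 h1 ht.2
  unfold FF
  exact ((ContinuousAt.mul (by fun_prop) (ContinuousAt.rpow_const (by fun_prop) (Or.inr (by linarith))))).mul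
    (ContinuousAt.rpow_const (by fun_prop) (Or.inl hD.ne'))

lemma D_deriv_rho (ρ t : ℝ) : HasDerivAt (fun ρ : ℝ => 1-2*t*ρ+ρ^2) (-(2*t)+2*ρ) ρ := by
  have := (((hasDerivAt_id ρ).const_mul (2*t)).const_sub 1).add (hasDerivAt_pow 2 ρ)
  exact this.congr_deriv (by simp)

noncomputable def FF' (L ρ t : ℝ) : ℝ :=
  (if L/(L+1)*ρ < t then 1 else -1) * ((1-t^2)^(L-1/2) * (1-2*t*ρ+ρ^2)^(-L-1) *
      (-(L/(L+1))*(1-2*t*ρ+ρ^2) + 2*L*(t-(L/(L+1))*ρ)*(t-ρ)))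

lemma FF_deriv {L ρ t : ℝ} (h0 : 0 < ρ) (h1 : ρ < 1) (ht : t ≤ 1)
    (hne : t ≠ L/(L+1)*ρ) : HasDerivAt (fun ρ => FF L ρ t) (FF' L ρ t) ρ := by
  have hD := D_pos h0.le h1 ht
  have hd := (D_deriv_rho ρ t).rpow_const (p := -L) (Or.inl hD.ne')
  have e2 : (1-2*t*ρ+ρ^2)^(-L) = (1-2*t*ρ+ρ^2)^(-L-1) * (1-2*t*ρ+ρ^2) := by
    rw [← Real.rpow_add_one hD.ne']; congr 1; ring
  have hl : HasDerivAt (fun ρ : ℝ => t - L/(L+1)*ρ) (-(L/(L+1))) ρ := by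
    have := ((hasDerivAt_id ρ).const_mul (L/(L+1))).const_sub t
    exact this.congr_deriv (by simp)
  unfold FF FF'
  by_cases h : L/(L+1)*ρ < t
  · have ha : HasDerivAt (fun ρ : ℝ => |t - L/(L+1)*ρ|) (-(L/(L+1))) ρ := by
      apply hl.congr_of_eventuallyEq
      have : ∀ᶠ x in 𝓝 ρ, 0 < t - L/(L+1)*x :=
        hl.continuousAt.eventually (lt_mem_nhds (by linarith))
      filter_upwards [this] with x hx using abs_of_pos hx
    refine ((ha.mul_const ((1-t^2)^(L-1/2))).mul hd).congr_deriv ?_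
    rw [if_pos h, e2, abs_of_pos (by linarith)]
    ring
  · have h' : t - L/(L+1)*ρ < 0 := by
      have := lt_of_le_of_ne (not_lt.1 h) hne
      linarith
    have ha : HasDerivAt (fun ρ : ℝ => |t - L/(L+1)*ρ|) (-(-(L/(L+1)))) ρ := by
      apply hl.neg.congr_of_eventuallyEq
      have : ∀ᶠ x in 𝓝 ρ, t - L/(L+1)*x < 0 :=
        hl.continuousAt.eventually (gt_mem_nhds h')
      filter_upwards [this] with x hx using abs_of_neg hx
    refine ((ha.mul_const ((1-t^2)^(L-1/2))).mul hd).congr_deriv ?_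
    rw [if_neg h, e2, abs_of_neg h']
    ring

lemma FF_lip {L r t : ℝ} (hL : 1 ≤ L) (hr1 : r < 1) (ht : t ∈ Icc (-1:ℝ) 1) :
    LipschitzOnWith (Real.nnabs (((1-r)^2)^(-L) + 2*(4*L*((1-r)^2)^(-L-1))))
      (fun ρ => FF L ρ t) (Ioo 0 r) := by
  have hd : 0 < (1-r)^2 := pow_pos (by linarith) 2
  have hDd : ∀ x ∈ Ioo 0 r, (1-r)^2 ≤ 1-2*t*x+x^2 := by
    intro x hx
    nlinarith [hx.1, hx.2, mul_nonneg hx.1.le (sub_nonneg.2 ht.2)]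
  have hK0 : ∀ p, 0 < ((1-r)^2)^(p:ℝ) := fun p => Real.rpow_pos_of_pos hd _
  have hb : ∀ x ∈ Ioo 0 r, (1-2*t*x+x^2)^(-L) ≤ ((1-r)^2)^(-L) := fun x hx =>
    Real.rpow_le_rpow_of_nonpos hd (hDd x hx) (by linarith)
  have hlip : ∀ x ∈ Ioo 0 r, ∀ y ∈ Ioo 0 r,
      |(1-2*t*y+y^2)^(-L) - (1-2*t*x+x^2)^(-L)| ≤ 4*L*((1-r)^2)^(-L-1) * |y - x| := by
    intro x hx y hy
    refine Convex.norm_image_sub_le_of_norm_hasDerivWithin_le (s := Ioo 0 r)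
      (f := fun ρ : ℝ => (1-2*t*ρ+ρ^2)^(-L))
      (fun z hz => ((D_deriv_rho z t).rpow_const (p := -L) (Or.inl ?_)).hasDerivWithinAt) ?_
      (convex_Ioo 0 r) hx hy
    · exact (lt_of_lt_of_le hd (hDd z hz)).ne'
    · intro z hz
      have h1 := Real.rpow_le_rpow_of_nonpos hd (hDd z hz) (show -L-1 ≤ 0 by linarith)
      have h2 : 0 < (1-2*t*z+z^2)^(-L-1) := Real.rpow_pos_of_pos (lt_of_lt_of_le hd (hDd z hz)) _
      rw [norm_mul, norm_mul, norm_neg, Real.norm_of_nonneg h2.le,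
        Real.norm_of_nonneg (show 0 ≤ L by linarith), Real.norm_eq_abs]
      have h3 : |-(2*t)+2*z| ≤ 4 := by
        rw [abs_le]; constructor <;> linarith [ht.1, ht.2, hz.1, hz.2]
      gcongr
  have hw0 : 0 ≤ (1-t^2)^(L-1/2) := Real.rpow_nonneg (by nlinarith [ht.1, ht.2]) _
  have hw1 : (1-t^2)^(L-1/2) ≤ 1 :=
    Real.rpow_le_one (by nlinarith [ht.1, ht.2]) (by nlinarith [sq_nonneg t]) (by linarith)
  obtain ⟨hc0, hc1⟩ := c_bounds hL
  rw [lipschitzOnWith_iff_norm_sub_le]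
  intro x hx y hy
  have hC : 0 ≤ ((1-r)^2)^(-L) + 2*(4*L*((1-r)^2)^(-L-1)) := by
    have := hK0 (-L); have := hK0 (-L-1); positivity
  rw [Real.coe_nnabs, abs_of_nonneg hC, Real.norm_eq_abs, Real.norm_eq_abs]
  have e : FF L x t - FF L y t = (1-t^2)^(L-1/2) *
      ((|t - L/(L+1)*x| - |t - L/(L+1)*y|) * (1-2*t*x+x^2)^(-L)
      + |t - L/(L+1)*y| * ((1-2*t*x+x^2)^(-L) - (1-2*t*y+y^2)^(-L))) := by
    unfold FF; ring
  rw [e, abs_mul, abs_of_nonneg hw0]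
  have h5 : |(|t - L/(L+1)*x| - |t - L/(L+1)*y|)| ≤ |x - y| := by
    refine (abs_abs_sub_abs_le_abs_sub _ _).trans ?_
    rw [show t - L/(L+1)*x - (t - L/(L+1)*y) = -(L/(L+1)) * (x-y) by ring, abs_mul, abs_neg,
      abs_of_pos hc0]
    exact mul_le_of_le_one_left (abs_nonneg _) hc1.le
  have h6 : 0 < (1-2*t*x+x^2)^(-L) := Real.rpow_pos_of_pos (lt_of_lt_of_le hd (hDd x hx)) _
  refine (mul_le_of_le_one_left (abs_nonneg _) hw1).trans ?_
  refine (abs_add_le _ _).trans ?_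
  rw [abs_mul, abs_mul, abs_of_pos h6, abs_abs, add_mul]
  have h7 : |t - L/(L+1)*y| ≤ 2 := abs_le_two hL ⟨hy.1.le, by linarith [hy.2]⟩ ht
  have h8 := hlip y hy x hx
  have h9 := hb x hx
  have := hK0 (-L)
  apply add_le_add
  · rw [mul_comm]; gcongr
  · refine (mul_le_mul h7 h8 (abs_nonneg _) (by norm_num)).trans (le_of_eq ?_)
    ring

lemma Phi_deriv {L ρ : ℝ} (hL : 1 ≤ L) (h0 : 0 < ρ) (h1 : ρ < 1) :
    HasDerivAt (fun ρ : ℝ => ∫ t in (-1:ℝ)..1, FF L ρ t) (-2 * Psi L ρ (L/(L+1)*ρ)) ρ := by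
  obtain ⟨hc0, hc1⟩ := c_bounds hL
  have hp0 : 0 < L/(L+1)*ρ := by positivity
  have hp1 : L/(L+1)*ρ < 1 := by nlinarith
  have key := intervalIntegral.hasDerivAt_integral_of_dominated_loc_of_lip (μ := volume)
    (a := -1) (b := 1) (F := FF L) (F' := FF' L ρ) (x₀ := ρ) (s := Ioo 0 ((1+ρ)/2))
    (bound := fun _ => ((1-(1+ρ)/2)^2)^(-L) + 2*(4*L*((1-(1+ρ)/2)^2)^(-L-1)))
    (Ioo_mem_nhds h0 (by linarith))
    (Eventually.of_forall fun x => (FF_meas L x).aestronglyMeasurable)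
    (FF_int hL h0.le h1) ?_ ?_ (by simp) ?_
  · obtain ⟨hi, hd⟩ := key
    refine hd.congr_deriv ?_
    have hi1 : IntervalIntegrable (FF' L ρ) volume (-1) (L/(L+1)*ρ) := hi.mono_set (by
      rw [uIcc_of_le (by linarith), uIcc_of_le (by norm_num)]
      exact Icc_subset_Icc_right hp1.le)
    have hi2 : IntervalIntegrable (FF' L ρ) volume (L/(L+1)*ρ) 1 := hi.mono_set (by
      rw [uIcc_of_le (by linarith), uIcc_of_le (by norm_num)]
      exact Icc_subset_Icc_left (by linarith))
    rw [← intervalIntegral.integral_add_adjacent_intervals hi1 hi2,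
      intervalIntegral.integral_eq_sub_of_hasDerivAt_of_le (f := fun t => - Psi L ρ t)
        (by linarith) ?_ ?_ hi1,
      intervalIntegral.integral_eq_sub_of_hasDerivAt_of_le (f := Psi L ρ)
        (by linarith) ?_ ?_ hi2, Psi_one hL, Psi_neg_one hL]
    · ring
    · exact (Psi_continuousOn hL h0 h1).mono (Icc_subset_Icc_left (by linarith))
    · intro t ht
      refine (Psi_deriv hL h0 h1 ⟨by linarith [ht.1], ht.2⟩).congr_deriv ?_
      rw [FF', if_pos ht.1, one_mul]
    · exact ((Psi_continuousOn hL h0 h1).mono (Icc_subset_Icc_right hp1.le)).neg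
    · intro t ht
      refine (Psi_deriv hL h0 h1 ⟨ht.1, by linarith [ht.2]⟩).neg.congr_deriv ?_
      rw [FF', if_neg (not_lt.2 ht.2.le), neg_one_mul]
  · apply Measurable.aestronglyMeasurable
    unfold FF'
    exact (Measurable.ite measurableSet_Ioi measurable_const measurable_const).mul (by fun_prop)
  · refine Eventually.of_forall fun t ht => ?_
    rw [uIoc_of_le (by norm_num)] at ht
    exact FF_lip hL (by linarith) ⟨ht.1.le, ht.2⟩
  · filter_upwards [ae_ne_real (L/(L+1)*ρ)] with t hne ht
    rw [uIoc_of_le (by norm_num)] at ht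
    exact FF_deriv h0 h1 ht.2 hne

lemma Phi_zero {L : ℝ} (hL : 1 ≤ L) : (∫ t in (-1:ℝ)..1, FF L 0 t) = 2/(2*L+1) := by
  have hi := FF_int hL le_rfl one_pos
  have hi1 : IntervalIntegrable (FF L 0) volume (-1) 0 := hi.mono_set (by
    rw [uIcc_of_le (by norm_num), uIcc_of_le (by norm_num)]
    exact Icc_subset_Icc_right (by norm_num))
  have hi2 : IntervalIntegrable (FF L 0) volume 0 1 := hi.mono_set (by
    rw [uIcc_of_le (by norm_num), uIcc_of_le (by norm_num)]
    exact Icc_subset_Icc_left (by norm_num))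
  have hd : ∀ t : ℝ, HasDerivAt (fun t : ℝ => (1-t^2)^(L+1/2) / (2*L+1)) (-t * (1-t^2)^(L-1/2)) t := by
    intro t
    have := ((hX_deriv t).rpow_const (p := L+1/2) (Or.inr (by linarith))).div_const (2*L+1)
    refine this.congr_deriv ?_
    have : 2*L+1 ≠ 0 := by linarith
    rw [div_eq_iff this, show L+1/2-1 = L-1/2 by ring]
    ring
  have hF : ∀ t, FF L 0 t = |t| * (1-t^2)^(L-1/2) := by intro t; simp [FF]
  rw [← intervalIntegral.integral_add_adjacent_intervals hi1 hi2,
    intervalIntegral.integral_eq_sub_of_hasDerivAt_of_le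
      (f := fun t : ℝ => (1-t^2)^(L+1/2) / (2*L+1)) (by norm_num) ?_ ?_ hi1,
    intervalIntegral.integral_eq_sub_of_hasDerivAt_of_le
      (f := fun t : ℝ => -((1-t^2)^(L+1/2) / (2*L+1))) (by norm_num) ?_ ?_ hi2]
  · have : L + 1/2 ≠ 0 := by linarith
    norm_num [Real.zero_rpow this]
    ring
  · exact fun t _ => (hd t).neg.continuousAt.continuousWithinAt
  · intro t ht
    refine (hd t).neg.congr_deriv ?_
    rw [hF, abs_of_pos ht.1]; ring
  · exact fun t _ => (hd t).continuousAt.continuousWithinAt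
  · intro t ht
    refine (hd t).congr_deriv ?_
    rw [hF, abs_of_neg ht.2]

lemma Phi_anti {L : ℝ} (hL : 1 ≤ L) :
    StrictAntiOn (fun ρ : ℝ => ∫ t in (-1:ℝ)..1, FF L ρ t) (Icc 0 1) := by
  apply strictAntiOn_of_deriv_neg (convex_Icc 0 1) (Phi_cont hL)
  intro ρ hρ
  rw [interior_Icc] at hρ
  rw [(Phi_deriv hL hρ.1 hρ.2).deriv]
  linarith [Psi_pos hL hρ.1 hρ.2]

theorem Phi_strictAnti_and_max (n : Nat) (hn : 4 ≤ n) :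
    StrictAntiOn (fun ρ : Real => ∫ t in (-1:Real)..1,
        |t - ((n:Real)-2)/n * ρ| * (1 - t^2) ^ (((n:Real)-3)/2)
          * (1 - 2*t*ρ + ρ^2) ^ (-(((n:Real)-2)/2))) (Set.Icc (0:Real) 1)
    ∧ (∀ ρ ∈ Set.Icc (0:Real) 1,
        (∫ t in (-1:Real)..1, |t - ((n:Real)-2)/n * ρ| * (1 - t^2) ^ (((n:Real)-3)/2)
          * (1 - 2*t*ρ + ρ^2) ^ (-(((n:Real)-2)/2)))
        ≤ ∫ t in (-1:Real)..1, |t - ((n:Real)-2)/n * 0| * (1 - t^2) ^ (((n:Real)-3)/2)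
          * (1 - 2*t*0 + 0^2) ^ (-(((n:Real)-2)/2)))
    ∧ (∫ t in (-1:Real)..1, |t - ((n:Real)-2)/n * 0| * (1 - t^2) ^ (((n:Real)-3)/2)
          * (1 - 2*t*0 + 0^2) ^ (-(((n:Real)-2)/2))) = 2/((n:Real)-1) := by
  have hn' : (4:ℝ) ≤ n := by exact_mod_cast hn
  have hL : (1:ℝ) ≤ ((n:ℝ)-2)/2 := by linarith
  have hF : ∀ ρ t : ℝ, |t - ((n:Real)-2)/n * ρ| * (1 - t^2) ^ (((n:Real)-3)/2)
          * (1 - 2*t*ρ + ρ^2) ^ (-(((n:Real)-2)/2)) = FF (((n:ℝ)-2)/2) ρ t := by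
    intro ρ t
    have e1 : ((n:ℝ)-2)/2/(((n:ℝ)-2)/2+1) = ((n:ℝ)-2)/n := by
      have : (n:ℝ) ≠ 0 := by linarith
      rw [show ((n:ℝ)-2)/2+1 = n/2 by ring]
      field_simp
    have e2 : ((n:ℝ)-2)/2 - 1/2 = ((n:ℝ)-3)/2 := by ring
    rw [FF, e1, e2]
  simp only [hF]
  refine ⟨Phi_anti hL, fun ρ hρ => (Phi_anti hL).antitoneOn (left_mem_Icc.2 zero_le_one) hρ hρ.1, ?_⟩
  rw [Phi_zero hL]
  congr 1; ring
end
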